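/- arXiv:1408.5194 — 2 statements merged into one kernel-verified Lean document; each statement's English description precedes it below -/
import Mathlib

section
/- Let ℓ be a prime and let K be a function field over an algebraically closed field k with char k ≠ ℓ. (1) If t_1,…,t_r ∈ K are algebraically independent over k, then there exist a_1,…,a_r ∈ k such that {t_1 − a_1, …, t_r − a_r} ≠ 0 in k^M_r(K). (2) Consequently, if F_1,…,F_r are subextensions of K|k with trdeg(F_i|k) = 1 for each i and such that the compositum F_1⋯F_r has transcendence degree r over k, then there exist elements x_i ∈ F_i (i = 1,…,r) with {x_1,…,x_r} ≠ 0 in k^M_r(K). -/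
/-! Common definitions: mod-ℓ Milnor K-theory, K^×/(K^×)^ℓ, Ω_K, relative algebraic
closure, transcendence degree predicates, discrete valuations, etc. -/

noncomputable section

open scoped TensorProduct

universe u v

/-- The `n`-fold tensor power (over `ℤ`) of the multiplicative group `Kˣ`,
written additively. -/
abbrev MilnorPre (n : ℕ) (K : Type*) [Field K] : Type _ :=
  PiTensorProduct ℤ (fun _ : Fin n => Additive Kˣ)

/-- The submodule of Steinberg relations: generated by all `a₁ ⊗ ⋯ ⊗ aₙ`
with `aᵢ + aⱼ = 1` for some `i < j`. -/
def SteinbergRel (n : ℕ) (K : Type*) [Field K] : Submodule ℤ (MilnorPre n K) :=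
  Submodule.span ℤ
    {x | ∃ a : Fin n → Kˣ,
      (∃ i j : Fin n, i < j ∧ ((a i : K) + (a j : K) = 1)) ∧
        x = PiTensorProduct.tprod ℤ (fun i => Additive.ofMul (a i))}

/-- The `n`-th Milnor K-group `K^M_n(K)`: the quotient of the `n`-fold tensor
power of `K^×` by the Steinberg relations. -/
abbrev MilnorK (n : ℕ) (K : Type*) [Field K] : Type _ :=
  MilnorPre n K ⧸ SteinbergRel n K

/-- The mod-`ℓ` Milnor K-group `k^M_n(K) = K^M_n(K)/ℓ`. -/
abbrev MilnorKMod (ℓ n : ℕ) (K : Type*) [Field K] : Type _ :=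
  MilnorK n K ⧸ LinearMap.range ((ℓ : ℤ) • (LinearMap.id : MilnorK n K →ₗ[ℤ] MilnorK n K))

/-- The symbol `{a₁, …, aₙ}` in `k^M_n(K)`. -/
def milnorSymbol (ℓ : ℕ) {n : ℕ} {K : Type*} [Field K] (a : Fin n → Kˣ) :
    MilnorKMod ℓ n K :=
  Submodule.Quotient.mk (Submodule.Quotient.mk
    (PiTensorProduct.tprod ℤ (fun i => Additive.ofMul (a i))))

/-- `k^M_1(K) = K^×/(K^×)^ℓ`, written multiplicatively. -/
abbrev K1 (ℓ : ℕ) (K : Type*) [Field K] : Type _ :=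
  Kˣ ⧸ (powMonoidHom ℓ : Kˣ →* Kˣ).range

/-- The projection `K^× → K^×/(K^×)^ℓ`. -/
def K1proj (ℓ : ℕ) (K : Type*) [Field K] : Kˣ →* K1 ℓ K :=
  QuotientGroup.mk' _

/-- The subgroup of `Kˣ` consisting of the units lying in an intermediate field `L`. -/
def fieldUnits {k K : Type*} [Field k] [Field K] [Algebra k K]
    (L : IntermediateField k K) : Subgroup Kˣ where
  carrier := {x : Kˣ | (x : K) ∈ L}
  one_mem' := by simpa using one_mem L
  mul_mem' := by
    intro a b ha hb
    simpa using mul_mem ha hb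
  inv_mem' := by
    intro a ha
    simpa using inv_mem (show (a : K) ∈ L from ha)

/-- `Ω_K(L)`: the image of `L^×` in `K^×/(K^×)^ℓ`. -/
def Omega (ℓ : ℕ) {k K : Type*} [Field k] [Field K] [Algebra k K]
    (L : IntermediateField k K) : Subgroup (K1 ℓ K) :=
  (fieldUnits L).map (K1proj ℓ K)

/-- A subextension `L` of `K|k` is relatively algebraically closed in `K` if every
element of `K` algebraic over `L` lies in `L`. -/
def RelAlgClosed {k K : Type*} [Field k] [Field K] [Algebra k K]
    (L : IntermediateField k K) : Prop :=
  ∀ x : K, IsAlgebraic L x → x ∈ L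

/-- `K` is a function field over `k`: a finitely generated field extension. -/
def IsFunctionField (k K : Type*) [Field k] [Field K] [Algebra k K] : Prop :=
  ∃ s : Finset K, IntermediateField.adjoin k (s : Set K) = ⊤

/-- `trdeg(K|k) = d`: there is a transcendence basis indexed by `Fin d`. -/
def HasTrdeg (k : Type*) (K : Type*) [Field k] [Field K] [Algebra k K] (d : ℕ) : Prop :=
  ∃ x : Fin d → K, IsTranscendenceBasis k x

/-- `trdeg(K|k) ≥ m`: there are `m` algebraically independent elements. -/
def TrdegGe (k : Type*) (K : Type*) [Field k] [Field K] [Algebra k K] (m : ℕ) : Prop :=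
  ∃ x : Fin m → K, AlgebraicIndependent k x

/-- `dim^M_K(S) ≥ d` for a subset `S ⊆ k^M_1(K)`: there are `s₁, …, s_d ∈ S` with
`{s₁, …, s_d} ≠ 0` in `k^M_d(K)`. -/
def dimMge (ℓ : ℕ) {K : Type*} [Field K] (S : Set (K1 ℓ K)) (d : ℕ) : Prop :=
  ∃ a : Fin d → Kˣ, (∀ i, K1proj ℓ K (a i) ∈ S) ∧ milnorSymbol ℓ a ≠ 0

/-- `dim^M_K(S) = r`. -/
def dimMeq (ℓ : ℕ) {K : Type*} [Field K] (S : Set (K1 ℓ K)) (r : ℕ) : Prop :=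
  dimMge ℓ S r ∧ ¬ dimMge ℓ S (r + 1)

/-- `t` is a general element of `K` over `k`: `t ∉ k` and `k(t)` is relatively
algebraically closed in `K`. -/
def IsGeneralElement (k : Type*) {K : Type*} [Field k] [Field K] [Algebra k K] (t : K) : Prop :=
  t ∉ (⊥ : IntermediateField k K) ∧ RelAlgClosed (IntermediateField.adjoin k {t})

/-- A rational subgroup of `k^M_1(K)`: `Ω_K(k(t))` for a general element `t`. -/
def IsRationalSubgroup (ℓ : ℕ) (k : Type*) {K : Type*} [Field k] [Field K] [Algebra k K]
    (A : Subgroup (K1 ℓ K)) : Prop :=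
  ∃ t : K, IsGeneralElement k t ∧ A = Omega ℓ (IntermediateField.adjoin k {t})

/-- `𝔊^r(K|k)`: the subgroups `Ω_K(L)` for `L` relatively algebraically closed
in `K` of transcendence degree `r` over `k`. -/
def GSet (ℓ : ℕ) (k : Type*) {K : Type*} [Field k] [Field K] [Algebra k K] (r : ℕ) :
    Set (Subgroup (K1 ℓ K)) :=
  {A | ∃ L : IntermediateField k K, RelAlgClosed L ∧ HasTrdeg k L r ∧ A = Omega ℓ L}

/-- `𝔐^1(K)`: subgroups maximal among the subgroups `B` of `k^M_1(K)`
with `dim^M_K(B) = 1`. -/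
def M1Set (ℓ : ℕ) (K : Type*) [Field K] : Set (Subgroup (K1 ℓ K)) :=
  {A | dimMeq ℓ (A : Set (K1 ℓ K)) 1 ∧
    ∀ B : Subgroup (K1 ℓ K), dimMeq ℓ (B : Set (K1 ℓ K)) 1 → A ≤ B → B = A}

/-- Condition (a) and (b) of the maximality characterization of `𝔊^r`:
`B` is generated by rational subgroups and `dim^M_K(B) = r`. -/
def SpannedByRatWithDim (ℓ : ℕ) (k : Type*) {K : Type*} [Field k] [Field K] [Algebra k K]
    (r : ℕ) (B : Subgroup (K1 ℓ K)) : Prop :=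
  (∃ S : Set (Subgroup (K1 ℓ K)), (∀ T ∈ S, IsRationalSubgroup ℓ k T) ∧ B = sSup S) ∧
    dimMeq ℓ (B : Set (K1 ℓ K)) r

/-- A discrete valuation of a field `F`: a surjective homomorphism `F^× → ℤ`
satisfying the ultrametric inequality. -/
structure DiscreteValuation (F : Type*) [Field F] where
  v : Fˣ → ℤ
  map_mul' : ∀ x y : Fˣ, v (x * y) = v x + v y
  surjective' : Function.Surjective v
  min_le' : ∀ x y z : Fˣ, (x : F) + (y : F) = (z : F) → min (v x) (v y) ≤ v z

lemma DiscreteValuation.v_one {F : Type*} [Field F] (w : DiscreteValuation F) : w.v 1 = 0 := by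
  have h := w.map_mul' 1 1
  simp only [mul_one] at h
  omega

/-- A discrete valuation of `F` is trivial on the base field `k`. -/
def DiscreteValuation.TrivialOn (k : Type*) {F : Type*} [Field k] [Field F] [Algebra k F]
    (w : DiscreteValuation F) : Prop :=
  ∀ (c : k) (hc : algebraMap k F c ≠ 0), w.v (Units.mk0 _ hc) = 0

/-- The unit group `U_w ⊆ F^×` of a discrete valuation. -/
def DiscreteValuation.units {F : Type*} [Field F] (w : DiscreteValuation F) : Subgroup Fˣ where
  carrier := {x : Fˣ | w.v x = 0}
  one_mem' := w.v_one
  mul_mem' := by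
    intro a b ha hb
    have h := w.map_mul' a b
    simp only [Set.mem_setOf_eq] at ha hb ⊢
    omega
  inv_mem' := by
    intro a ha
    have h := w.map_mul' a a⁻¹
    rw [mul_inv_cancel] at h
    have h1 := w.v_one
    simp only [Set.mem_setOf_eq] at ha ⊢
    omega

/-- `𝔘_v`: the image of the unit group `U_v` in `K^×/(K^×)^ℓ`. -/
def DiscreteValuation.unitsImage (ℓ : ℕ) {F : Type*} [Field F] (w : DiscreteValuation F) :
    Subgroup (K1 ℓ F) :=
  w.units.map (K1proj ℓ F)

/-- For a discrete valuation `w` of an intermediate field `F` of `K|k`, the image of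
the unit group `U_w` in `K^×/(K^×)^ℓ`. -/
def unitsImageIn (ℓ : ℕ) {k K : Type*} [Field k] [Field K] [Algebra k K]
    (F : IntermediateField k K) (w : DiscreteValuation F) : Subgroup (K1 ℓ K) :=
  (w.units.map (Units.map (algebraMap F K).toMonoidHom)).map (K1proj ℓ K)

/-- The residue field of `v` has transcendence degree `≥ m` over `k`: there are
`v`-units `x₁, …, x_m` whose residues are algebraically independent over `k`,
expressed by saying that every nonzero polynomial over `k` evaluated at the `xᵢ`
is a unit of value `0`. -/
def DiscreteValuation.ResidueTrdegGe (k : Type*) {K : Type*} [Field k] [Field K] [Algebra k K]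
    (v : DiscreteValuation K) (m : ℕ) : Prop :=
  ∃ x : Fin m → Kˣ, (∀ i, v.v (x i) = 0) ∧
    ∀ P : MvPolynomial (Fin m) k, P ≠ 0 →
      ∃ u : Kˣ, (u : K) = MvPolynomial.aeval (fun i => ((x i : K))) P ∧ v.v u = 0

/-- A divisorial-type valuation of `K|k` (where `d = trdeg(K|k)`): a discrete valuation
trivial on `k` whose residue field has transcendence degree exactly `d - 1` over `k`. -/
def IsDivisorialType (k : Type*) {K : Type*} [Field k] [Field K] [Algebra k K] (d : ℕ)
    (v : DiscreteValuation K) : Prop :=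
  v.TrivialOn k ∧ v.ResidueTrdegGe k (d - 1) ∧ ¬ v.ResidueTrdegGe k d

/-- `Δ_A`: the set of subgroups `A ⊓ 𝔘_v`, for `v` ranging over the divisorial-type
valuations of `K` with `A ⊄ 𝔘_v`. -/
def DeltaA (ℓ : ℕ) (k : Type*) {K : Type*} [Field k] [Field K] [Algebra k K] (d : ℕ)
    (A : Subgroup (K1 ℓ K)) : Set (Subgroup (K1 ℓ K)) :=
  {T | ∃ v : DiscreteValuation K, IsDivisorialType k d v ∧
    ¬ A ≤ v.unitsImage ℓ ∧ T = A ⊓ v.unitsImage ℓ}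

/-- A good rational subgroup: a rational subgroup `A = Ω_K(k(t))` such that for every
discrete valuation `w` of `k(t)` trivial on `k`, the image of `U_w` in `K^×/(K^×)^ℓ`
belongs to `Δ_A`. -/
def IsGoodRationalSubgroup (ℓ : ℕ) (k : Type*) {K : Type*} [Field k] [Field K] [Algebra k K]
    (d : ℕ) (A : Subgroup (K1 ℓ K)) : Prop :=
  ∃ t : K, IsGeneralElement k t ∧ A = Omega ℓ (IntermediateField.adjoin k {t}) ∧
    ∀ w : DiscreteValuation (IntermediateField.adjoin k {t}), w.TrivialOn k →
      unitsImageIn ℓ (IntermediateField.adjoin k {t}) w ∈ DeltaA ℓ k d A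

/-- A very general element: a general element `t` such that `Ω_K(k(t))` is a good
rational subgroup. -/
def IsVeryGeneral (ℓ : ℕ) (k : Type*) {K : Type*} [Field k] [Field K] [Algebra k K]
    (d : ℕ) (t : K) : Prop :=
  IsGeneralElement k t ∧ IsGoodRationalSubgroup ℓ k d (Omega ℓ (IntermediateField.adjoin k {t}))

/-- `x` is separable in `K`: in characteristic `p > 0`, `x` is not a `p`-th power;
in characteristic `0` every element is separable. -/
def IsSeparableIn (K : Type*) [Field K] (x : K) : Prop :=
  ∀ p : ℕ, p.Prime → CharP K p → ¬ ∃ y : K, y ^ p = x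

/-- A perfect closure of `K`: a perfect field which is a purely inseparable
extension of `K`. -/
structure PerfectClosureOf (K : Type u) [Field K] : Type (u + 1) where
  carrier : Type u
  [fieldInst : Field carrier]
  [algebraInst : Algebra K carrier]
  purelyInseparable : IsPurelyInseparable K carrier
  perfect : PerfectField carrier

attribute [instance] PerfectClosureOf.fieldInst PerfectClosureOf.algebraInst

/-- A group isomorphism `φ : k^M_1(K) → k^M_1(L)` is induced by a field isomorphism
`σ : K^i → L^i` of the perfect closures, via the canonical identifications
`k^M_1(K) ≅ k^M_1(K^i)` and `k^M_1(L) ≅ k^M_1(L^i)`. -/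
def InducesOnK1 (ℓ : ℕ) {K : Type u} {L : Type v} [Field K] [Field L]
    (PK : PerfectClosureOf K) (PL : PerfectClosureOf L)
    (σ : PK.carrier ≃+* PL.carrier) (φ : K1 ℓ K ≃* K1 ℓ L) : Prop :=
  ∀ (x : Kˣ) (y : Lˣ),
    (φ (K1proj ℓ K x) = K1proj ℓ L y ↔
      ∃ z : (PL.carrier)ˣ,
        Units.map σ.toRingHom.toMonoidHom
            (Units.map (algebraMap K PK.carrier).toMonoidHom x) =
          Units.map (algebraMap L PL.carrier).toMonoidHom y * z ^ ℓ)

/-- `φ : k^M_1(K) → k^M_1(L)` is compatible with `k^M_2`: `φ ⊗ φ` descends, along the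
multiplication maps, to an isomorphism `k^M_2(K) → k^M_2(L)`; equivalently, there is an
additive isomorphism `k^M_2(K) ≃ k^M_2(L)` carrying `{a, b}` to `{a', b'}` whenever
`φ` carries the class of `a` (resp. `b`) to the class of `a'` (resp. `b'`). -/
def CompatWithK2 (ℓ : ℕ) {K L : Type*} [Field K] [Field L] (φ : K1 ℓ K ≃* K1 ℓ L) : Prop :=
  ∃ ψ : MilnorKMod ℓ 2 K ≃+ MilnorKMod ℓ 2 L,
    ∀ (a b : Kˣ) (a' b' : Lˣ),
      φ (K1proj ℓ K a) = K1proj ℓ L a' → φ (K1proj ℓ K b) = K1proj ℓ L b' →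
        ψ (milnorSymbol ℓ ![a, b]) = milnorSymbol ℓ ![a', b']

/-- `φ : k^M_1(K) → k^M_1(L)` is compatible with `𝔊^1_rat`: it maps rational subgroups
bijectively onto rational subgroups. -/
def CompatWithRat (ℓ : ℕ) (k : Type*) (l : Type*) {K L : Type*}
    [Field k] [Field K] [Algebra k K] [Field l] [Field L] [Algebra l L]
    (φ : K1 ℓ K ≃* K1 ℓ L) : Prop :=
  (∀ A : Subgroup (K1 ℓ K), IsRationalSubgroup ℓ k A →
     IsRationalSubgroup ℓ l (A.map φ.toMonoidHom)) ∧
  (∀ B : Subgroup (K1 ℓ L), IsRationalSubgroup ℓ l B →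
     ∃ A : Subgroup (K1 ℓ K), IsRationalSubgroup ℓ k A ∧ A.map φ.toMonoidHom = B)

/-- Two isomorphisms of perfect closures differ by a power of the Frobenius
(in characteristic `0`, they are equal). -/
def FrobTwistEquiv {Ki Li : Type*} [Field Ki] [Field Li] (σ σ' : Ki ≃+* Li) : Prop :=
  σ = σ' ∨ ∃ p : ℕ, p.Prime ∧ CharP Ki p ∧
    ((∃ n : ℕ, ∀ x, σ' x = σ (x ^ p ^ n)) ∨ (∃ n : ℕ, ∀ x, σ x = σ' (x ^ p ^ n)))

/-- A homomorphism from the multiplicative group of `E` to `(ℤ/ℓ)^r` is of Steinberg type if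
on each pair `a + b = 1` one of its values vanishes or the two values agree. Alternating forms
on `(ℤ/ℓ)^r` then turn it into a function on Milnor K-theory. -/
def IsSteinberg {ℓ r : ℕ} {E : Type*} [Field E] (w : Additive Eˣ →+ (Fin r → ZMod ℓ)) : Prop :=
  ∀ a b : Eˣ, (a : E) + (b : E) = 1 →
    w (.ofMul a) = 0 ∨ w (.ofMul b) = 0 ∨ w (.ofMul a) = w (.ofMul b)

/-- Some translates `t i - c (a i)` are mapped to the standard basis of `(ℤ/ℓ)^r` by a
homomorphism of Steinberg type. -/
def HasSteinbergFrame (ℓ : ℕ) {k E : Type*} [Field k] [Field E] (c : k →+* E) {r : ℕ}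
    (t : Fin r → E) : Prop :=
  ∃ (a : Fin r → k) (w : Additive Eˣ →+ (Fin r → ZMod ℓ)) (u : Fin r → Eˣ),
    IsSteinberg w ∧ (∀ i, (u i : E) = t i - c (a i)) ∧
      ∀ i, w (.ofMul (u i)) = Pi.single i 1

theorem milnorSymbol_ne_zero_of_isSteinberg {ℓ r : ℕ} (hℓ : ℓ ≠ 1) {E : Type*} [Field E]
    {w : Additive Eˣ →+ (Fin r → ZMod ℓ)} (hw : IsSteinberg w) {u : Fin r → Eˣ}
    (hu : ∀ i, w (.ofMul (u i)) = Pi.single i 1) : milnorSymbol ℓ u ≠ 0 := by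
  have : Nontrivial (ZMod ℓ) := ZMod.nontrivial_iff.2 hℓ
  let D : MultilinearMap ℤ (fun _ : Fin r => Fin r → ZMod ℓ) (ZMod ℓ) :=
    (Matrix.detRowAlternating (n := Fin r) (R := ZMod ℓ)).toMultilinearMap.restrictScalars ℤ
  let φ : MilnorPre r E →ₗ[ℤ] ZMod ℓ :=
    PiTensorProduct.lift (D.compLinearMap fun _ => w.toIntLinearMap)
  have hφ (a : Fin r → Eˣ) : φ (PiTensorProduct.tprod ℤ fun i => Additive.ofMul (a i)) =
      Matrix.det (Matrix.of fun i => w (.ofMul (a i))) := by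
    simp only [φ, PiTensorProduct.lift.tprod]
    rfl
  have h1 : SteinbergRel r E ≤ LinearMap.ker φ := by
    refine Submodule.span_le.2 ?_
    rintro _ ⟨a, ⟨i, j, hij, hab⟩, rfl⟩
    rw [SetLike.mem_coe, LinearMap.mem_ker, hφ]
    rcases hw _ _ hab with h | h | h
    · exact Matrix.det_eq_zero_of_row_eq_zero i fun s => congrFun h s
    · exact Matrix.det_eq_zero_of_row_eq_zero j fun s => congrFun h s
    · exact Matrix.det_zero_of_row_eq hij.ne h
  let ψ : MilnorK r E →ₗ[ℤ] ZMod ℓ := (SteinbergRel r E).liftQ φ h1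
  have h2 : LinearMap.range ((ℓ : ℤ) • (LinearMap.id : MilnorK r E →ₗ[ℤ] MilnorK r E)) ≤
      LinearMap.ker ψ := by
    rintro _ ⟨x, rfl⟩
    rw [LinearMap.mem_ker, LinearMap.smul_apply, LinearMap.id_apply, map_smul]
    simp
  intro h
  have h3 : Submodule.liftQ _ ψ h2 (milnorSymbol ℓ u) = 1 := by
    rw [milnorSymbol, Submodule.liftQ_apply, Submodule.liftQ_apply, hφ]
    have : (Matrix.of fun i => w (.ofMul (u i))) = (1 : Matrix (Fin r) (Fin r) (ZMod ℓ)) := by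
      ext i j
      rw [Matrix.of_apply, hu, Matrix.one_eq_pi_single]
    rw [this, Matrix.det_one]
  rw [h, map_zero] at h3
  exact zero_ne_one h3

theorem IsSteinberg.comp_unitsMap {ℓ r : ℕ} {E K : Type*} [Field E] [Field K]
    {w : Additive Eˣ →+ (Fin r → ZMod ℓ)} (hw : IsSteinberg w) (σ : K →+* E) :
    IsSteinberg (w.comp (Units.map (σ : K →* E)).toAdditive) := by
  intro a b hab
  exact hw _ _ (by simpa using congrArg σ hab)

/-- The homomorphism on the Laurent series field given by the order together with a
homomorphism evaluated at the leading coefficient. -/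
def laurentExtend {ℓ r : ℕ} {E : Type*} [Field E] (w : Additive Eˣ →+ (Fin r → ZMod ℓ)) :
    Additive (LaurentSeries E)ˣ →+ (Fin (r + 1) → ZMod ℓ) where
  toFun x := Fin.cons (((x.toMul : LaurentSeries E).order : ℤ) : ZMod ℓ)
    (w (.ofMul (Units.mk0 (x.toMul : LaurentSeries E).leadingCoeff
      (HahnSeries.leadingCoeff_ne_zero.2 x.toMul.ne_zero))))
  map_zero' := by
    ext i
    cases i using Fin.cases <;> simp
  map_add' x y := by
    have : w (.ofMul (Units.mk0 ((x + y).toMul : LaurentSeries E).leadingCoeff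
        (HahnSeries.leadingCoeff_ne_zero.2 (x + y).toMul.ne_zero))) =
        w (.ofMul (Units.mk0 (x.toMul : LaurentSeries E).leadingCoeff
          (HahnSeries.leadingCoeff_ne_zero.2 x.toMul.ne_zero))) +
        w (.ofMul (Units.mk0 (y.toMul : LaurentSeries E).leadingCoeff
          (HahnSeries.leadingCoeff_ne_zero.2 y.toMul.ne_zero))) := by
      rw [← map_add, ← ofMul_mul]
      congr 2
      ext
      simp [HahnSeries.leadingCoeff_mul]
    rw [this]
    ext i
    cases i using Fin.cases
    · simp [HahnSeries.order_mul x.toMul.ne_zero y.toMul.ne_zero]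
    · simp

theorem laurentExtend_eq {ℓ r : ℕ} {E : Type*} [Field E] (w : Additive Eˣ →+ (Fin r → ZMod ℓ))
    (x : (LaurentSeries E)ˣ) {n : ℤ} {e : Eˣ} (hn : (x : LaurentSeries E).order = n)
    (he : (x : LaurentSeries E).leadingCoeff = e) :
    laurentExtend w (.ofMul x) = Fin.cons (n : ZMod ℓ) (w (.ofMul e)) := by
  subst hn
  obtain rfl : Units.mk0 (x : LaurentSeries E).leadingCoeff
      (HahnSeries.leadingCoeff_ne_zero.2 x.ne_zero) = e := by
    ext; exact he
  rfl

theorem IsSteinberg.laurentExtend {ℓ r : ℕ} {E : Type*} [Field E]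
    {w : Additive Eˣ →+ (Fin r → ZMod ℓ)} (hw : IsSteinberg w) (hneg : w (.ofMul (-1)) = 0) :
    IsSteinberg (laurentExtend w) := by
  have pos : ∀ a b : (LaurentSeries E)ˣ, (a : LaurentSeries E) + b = 1 →
      0 < (a : LaurentSeries E).order → _root_.laurentExtend w (.ofMul b) = 0 := by
    intro a b hab ha
    have hb : (b : LaurentSeries E) = 1 - a := by rw [← hab]; ring
    have hlt : (1 : LaurentSeries E).orderTop < (a : LaurentSeries E).orderTop := by
      rw [HahnSeries.orderTop_one, ← HahnSeries.order_eq_orderTop_of_ne_zero a.ne_zero]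
      exact_mod_cast ha
    have hl : (b : LaurentSeries E).leadingCoeff = ((1 : Eˣ) : E) := by
      rw [hb, HahnSeries.leadingCoeff_sub hlt]; simp
    have ho : (b : LaurentSeries E).order = 0 := by
      have := HahnSeries.orderTop_sub hlt
      rw [← hb, HahnSeries.orderTop_one,
        ← HahnSeries.order_eq_orderTop_of_ne_zero b.ne_zero] at this
      exact_mod_cast this
    rw [laurentExtend_eq w b ho hl, ofMul_one, map_zero]
    ext i
    cases i using Fin.cases <;> simp
  have hnegu (e : Eˣ) : w (.ofMul (-e)) = w (.ofMul e) := by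
    rw [← neg_one_mul, ofMul_mul, map_add, hneg, zero_add]
  intro a b hab
  rcases lt_trichotomy 0 (a : LaurentSeries E).order with ha | ha | ha
  · exact Or.inr (Or.inl (pos a b hab ha))
  · rcases lt_trichotomy 0 (b : LaurentSeries E).order with hb | hb | hb
    · exact Or.inl (pos b a (by rwa [add_comm]) hb)
    · have hla : (a : LaurentSeries E).leadingCoeff = (a : LaurentSeries E).coeff 0 := by
        rw [HahnSeries.leadingCoeff_eq, ← ha]
      have hlb : (b : LaurentSeries E).leadingCoeff = (b : LaurentSeries E).coeff 0 := by
        rw [HahnSeries.leadingCoeff_eq, ← hb]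
      have h0 := congrArg (fun x : LaurentSeries E => x.coeff 0) hab
      simp only [HahnSeries.coeff_add, HahnSeries.coeff_one, if_true] at h0
      rw [← hla, ← hlb] at h0
      set ea : Eˣ := Units.mk0 _ (HahnSeries.leadingCoeff_ne_zero.2 a.ne_zero) with hea
      set eb : Eˣ := Units.mk0 _ (HahnSeries.leadingCoeff_ne_zero.2 b.ne_zero) with heb
      rw [laurentExtend_eq w a (e := ea) ha.symm rfl, laurentExtend_eq w b (e := eb) hb.symm rfl]
      have hz : (Fin.cons ((0 : ℤ) : ZMod ℓ) 0 : Fin (r + 1) → ZMod ℓ) = 0 := by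
        ext i
        cases i using Fin.cases <;> simp
      rcases hw ea eb h0 with h | h | h
      · left; rw [h, hz]
      · right; left; rw [h, hz]
      · right; right; rw [h]
    · exfalso
      have h1 := congrArg (fun x : LaurentSeries E => x.coeff (b : LaurentSeries E).order) hab
      simp only [HahnSeries.coeff_add, HahnSeries.coeff_one, hb.ne, if_false] at h1
      rw [HahnSeries.coeff_eq_zero_of_lt_order (hb.trans_eq ha), zero_add] at h1
      exact b.ne_zero (HahnSeries.coeff_order_eq_zero.1 h1)
  · right; right
    have hb : (b : LaurentSeries E) = -(a - 1) := by rw [← hab]; ring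
    have hlt : (a : LaurentSeries E).orderTop < (1 : LaurentSeries E).orderTop := by
      rw [HahnSeries.orderTop_one, ← HahnSeries.order_eq_orderTop_of_ne_zero a.ne_zero]
      exact_mod_cast ha
    set ea : Eˣ := Units.mk0 _ (HahnSeries.leadingCoeff_ne_zero.2 a.ne_zero) with hea
    have hl : (b : LaurentSeries E).leadingCoeff = ((-ea : Eˣ) : E) := by
      rw [hb, HahnSeries.leadingCoeff_neg, HahnSeries.leadingCoeff_sub hlt]; simp [hea]
    have ho : (b : LaurentSeries E).order = (a : LaurentSeries E).order := by
      have := HahnSeries.orderTop_sub hlt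
      rw [← HahnSeries.orderTop_neg, ← hb,
        ← HahnSeries.order_eq_orderTop_of_ne_zero a.ne_zero,
        ← HahnSeries.order_eq_orderTop_of_ne_zero b.ne_zero] at this
      exact_mod_cast this
    rw [laurentExtend_eq w b ho hl, laurentExtend_eq w a (e := ea) rfl rfl, hnegu]

/-- Taylor expansion at `α`, after extending scalars along `j`. -/
def taylorSeries {E E' : Type*} [Field E] [Field E'] (j : E →+* E') (α : E) :
    Polynomial E →+* PowerSeries E' :=
  Polynomial.coeToPowerSeries.ringHom.comp
    ((Polynomial.taylorAlgHom (j α)).toRingHom.comp (Polynomial.mapRingHom j))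

theorem taylorSeries_apply {E E' : Type*} [Field E] [Field E'] (j : E →+* E') (α : E)
    (p : Polynomial E) :
    taylorSeries j α p = ((Polynomial.taylor (j α) (p.map j) : Polynomial E') : PowerSeries E') :=
  rfl

theorem taylorSeries_injective {E E' : Type*} [Field E] [Field E'] (j : E →+* E') (α : E) :
    Function.Injective (taylorSeries j α) := by
  intro p q h
  rw [taylorSeries_apply, taylorSeries_apply] at h
  exact Polynomial.map_injective j j.injective
    (Polynomial.taylor_injective _ (Polynomial.coe_injective _ h))

theorem constantCoeff_comp_taylorSeries {E E' : Type*} [Field E] [Field E'] (j : E →+* E') (α : E) :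
    (PowerSeries.constantCoeff (R := E')).comp (taylorSeries j α) =
      j.comp (Polynomial.evalRingHom α) := by
  ext p <;> simp [taylorSeries_apply]

/-- Hensel's lemma for power series, for a polynomial whose leading coefficient is a unit. -/
theorem PowerSeries.exists_root_of_isUnit_leadingCoeff {F : Type*} [Field F]
    (g : Polynomial (PowerSeries F)) (hg : IsUnit g.leadingCoeff) (y₀ : F)
    (h0 : (g.map PowerSeries.constantCoeff).eval y₀ = 0)
    (h1 : (g.map PowerSeries.constantCoeff).derivative.eval y₀ ≠ 0) :
    ∃ y, g.eval y = 0 := by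
  obtain ⟨b, hb⟩ := hg.exists_left_inv
  have hbu : IsUnit b := IsUnit.of_mul_eq_one _ hb
  have hmon : (Polynomial.C b * g).Monic := by
    rw [mul_comm]
    exact Polynomial.monic_mul_C_of_leadingCoeff_mul_eq_one (by rw [mul_comm, hb])
  have hev (q : Polynomial (PowerSeries F)) :
      PowerSeries.constantCoeff (q.eval (PowerSeries.C y₀)) =
        (q.map PowerSeries.constantCoeff).eval y₀ := by
    rw [Polynomial.eval_map]
    conv_rhs => rw [← PowerSeries.constantCoeff_C (R := F) y₀]
    exact (Polynomial.eval₂_hom PowerSeries.constantCoeff (PowerSeries.C y₀)).symm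
  obtain ⟨y, hy, -⟩ := HenselianRing.is_henselian (I := Ideal.span {PowerSeries.X})
    (Polynomial.C b * g) hmon (PowerSeries.C y₀)
    (by
      rw [Ideal.mem_span_singleton, PowerSeries.X_dvd_iff, hev]
      simp [h0])
    (by
      refine IsUnit.map _ ?_
      rw [PowerSeries.isUnit_iff_constantCoeff, hev, Polynomial.derivative_C_mul]
      rw [PowerSeries.isUnit_iff_constantCoeff] at hbu
      rw [Polynomial.derivative_map] at h1
      simp [h1, hbu.ne_zero])
  refine ⟨y, ?_⟩
  simpa [hbu.ne_zero] using hy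

theorem exists_laurentSeries_embedding {k : Type*} {E : Type u} {L M : Type*} [Field k] [Infinite k]
    [Field E] [Field L] [Field M] (c : k →+* E) [Algebra (Polynomial E) L]
    [IsFractionRing (Polynomial E) L] [Algebra L M] [FiniteDimensional L M]
    [Algebra.IsSeparable L M] :
    ∃ (a : k) (E' : Type u) (_ : Field E') (j : E →+* E') (σ : M →+* LaurentSeries E'),
      j.Finite ∧ ∀ p : Polynomial E, σ (algebraMap L M (algebraMap (Polynomial E) L p)) =
        HahnSeries.ofPowerSeries ℤ E' (taylorSeries j (c a) p) := by
  classical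
  let pb := Field.powerBasisOfFiniteOfSeparable L M
  let f := minpoly L pb.gen
  have hint : IsIntegral L pb.gen := Algebra.IsIntegral.isIntegral _
  have hmon : f.Monic := minpoly.monic hint
  let S := nonZeroDivisors (Polynomial E)
  obtain ⟨U, V, hUV⟩ : f.Separable := Algebra.IsSeparable.isSeparable L pb.gen
  obtain ⟨b₀, hS₀, hb₀⟩ := IsLocalization.integerNormalization_spec S f
  obtain ⟨b₁, hS₁, hb₁⟩ := IsLocalization.integerNormalization_spec S U
  obtain ⟨b₂, hS₂, hb₂⟩ := IsLocalization.integerNormalization_spec S V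
  set g := IsLocalization.integerNormalization S f
  set U' := IsLocalization.integerNormalization S U
  set V' := IsLocalization.integerNormalization S V
  let ι := algebraMap (Polynomial E) L
  have hι : Function.Injective ι := IsFractionRing.injective _ _
  have hsmul (b : Polynomial E) (q : Polynomial L) : b • q = Polynomial.C (ι b) * q := by
    rw [← Polynomial.smul_eq_C_mul, algebraMap_smul]
  have hbez : (Polynomial.C b₂ * U') * g +
      (Polynomial.C b₁ * V') * g.derivative =
        Polynomial.C (b₀ * b₁ * b₂) := by
    apply Polynomial.map_injective ι hι
    rw [hsmul] at hb₀ hb₁ hb₂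
    simp only [Polynomial.map_add, Polynomial.map_mul, Polynomial.map_C, ← Polynomial.derivative_map]
    rw [hb₀, hb₁, hb₂, Polynomial.derivative_C_mul]
    simp only [map_mul]
    linear_combination (Polynomial.C (ι b₀) * Polynomial.C (ι b₁) * Polynomial.C (ι b₂)) * hUV
  have hgdeg : g.natDegree = f.natDegree := by
    rw [← Polynomial.natDegree_map_eq_of_injective hι, hb₀, hsmul,
      Polynomial.natDegree_C_mul]
    simpa using (map_ne_zero_iff ι hι).2 (nonZeroDivisors.ne_zero hS₀)
  have hglead : g.leadingCoeff = b₀ := by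
    apply hι
    rw [← Polynomial.leadingCoeff_map_of_injective hι, hb₀, hsmul,
      Polynomial.leadingCoeff_mul, hmon.leadingCoeff]
    simp
  obtain ⟨a, ha⟩ : ∃ a : k, (b₀ * b₁ * b₂).eval (c a) ≠ 0 := by
    have hfin : {x : E | (b₀ * b₁ * b₂).IsRoot x}.Finite :=
      Polynomial.finite_setOfPred_isRoot (nonZeroDivisors.ne_zero (mul_mem (mul_mem hS₀ hS₁) hS₂))
    obtain ⟨a, ha⟩ := (hfin.preimage (f := c) c.injective.injOn).exists_notMem
    exact ⟨a, ha⟩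
  set α := c a
  let g₀ := g.map (Polynomial.evalRingHom α)
  have hlead₀ : (Polynomial.evalRingHom α) g.leadingCoeff ≠ 0 := by
    rw [hglead]
    intro h
    apply ha
    simp only [Polynomial.coe_evalRingHom] at h
    simp [h]
  have hg₀ : g₀.natDegree ≠ 0 := by
    rw [Polynomial.natDegree_map_of_leadingCoeff_ne_zero _ hlead₀, hgdeg]
    exact (minpoly.natDegree_pos hint).ne'
  obtain ⟨h, hirr, hdvd⟩ := Polynomial.exists_irreducible_of_natDegree_ne_zero hg₀
  have : Fact (Irreducible h) := ⟨hirr⟩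
  let j : E →+* AdjoinRoot h := AdjoinRoot.of h
  let y₀ := AdjoinRoot.root h
  have hy₀ : (g₀.map j).eval y₀ = 0 := by
    obtain ⟨q, hq⟩ := hdvd
    rw [hq, Polynomial.map_mul, Polynomial.eval_mul, Polynomial.eval_map, AdjoinRoot.eval₂_root,
      zero_mul]
  have hmap (q : Polynomial (Polynomial E)) :
      (q.map (taylorSeries j α)).map PowerSeries.constantCoeff =
        (q.map (Polynomial.evalRingHom α)).map j := by
    rw [Polynomial.map_map, Polynomial.map_map, constantCoeff_comp_taylorSeries]
  have hτ := taylorSeries_injective j α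
  obtain ⟨y, hy⟩ := PowerSeries.exists_root_of_isUnit_leadingCoeff (g.map (taylorSeries j α))
    (by
      rw [Polynomial.leadingCoeff_map_of_injective hτ, PowerSeries.isUnit_iff_constantCoeff,
        ← RingHom.comp_apply, constantCoeff_comp_taylorSeries, RingHom.comp_apply]
      simpa using hlead₀)
    y₀ (by rw [hmap]; exact hy₀)
    (by
      rw [hmap]
      intro hder
      have := congrArg (fun q => ((q.map (Polynomial.evalRingHom α)).map j).eval y₀) hbez
      simp only [Polynomial.map_add, Polynomial.map_mul, Polynomial.eval_add, Polynomial.eval_mul,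
        ← Polynomial.derivative_map, Polynomial.map_C, Polynomial.eval_C] at this
      rw [hder, hy₀, mul_zero, mul_zero, add_zero, eq_comm, map_eq_zero] at this
      exact ha this)
  let lam : Polynomial E →+* LaurentSeries (AdjoinRoot h) :=
    (HahnSeries.ofPowerSeries ℤ (AdjoinRoot h)).comp (taylorSeries j α)
  have hlam : Function.Injective lam := HahnSeries.ofPowerSeries_injective.comp hτ
  let lift : L →+* LaurentSeries (AdjoinRoot h) := IsFractionRing.lift hlam
  have hlift (p : Polynomial E) : lift (ι p) = lam p := IsFractionRing.lift_algebraMap hlam p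
  let alg : Algebra L (LaurentSeries (AdjoinRoot h)) := lift.toAlgebra
  have hroot : Polynomial.aeval (HahnSeries.ofPowerSeries ℤ (AdjoinRoot h) y) f = 0 := by
    have h1 : (g.map ι).eval₂ lift (HahnSeries.ofPowerSeries ℤ (AdjoinRoot h) y) = 0 := by
      have hcomp : lift.comp ι = lam := RingHom.ext hlift
      rw [Polynomial.eval₂_map, hcomp, ← Polynomial.hom_eval₂, ← Polynomial.eval_map, hy, map_zero]
    rw [hb₀, hsmul, Polynomial.eval₂_mul, Polynomial.eval₂_C, hlift] at h1
    exact (mul_eq_zero.1 h1).resolve_left ((map_ne_zero_iff lam hlam).2 (nonZeroDivisors.ne_zero hS₀))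
  refine ⟨a, AdjoinRoot h, inferInstance, j, (pb.lift _ hroot).toRingHom, ?_, fun p => ?_⟩
  · have := (AdjoinRoot.powerBasis hirr.ne_zero).finite
    exact RingHom.finite_algebraMap.2 this
  · change pb.lift _ hroot _ = _
    rw [AlgHom.commutes]
    exact hlift p

/-- A homomorphism into an elementary abelian `ℓ`-group kills `-1` when `-1` is an `ℓ`-th power. -/
theorem map_neg_one_of_isAlgClosed {ℓ r : ℕ} (hℓ : ℓ ≠ 0) {k E : Type*} [Field k] [IsAlgClosed k]
    [Field E] (c : k →+* E) (w : Additive Eˣ →+ (Fin r → ZMod ℓ)) : w (.ofMul (-1)) = 0 := by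
  obtain ⟨z, hz⟩ := IsAlgClosed.exists_pow_nat_eq (-1 : k) (Nat.pos_of_ne_zero hℓ)
  have hz0 : z ≠ 0 := by
    rintro rfl
    rw [zero_pow hℓ] at hz
    exact neg_ne_zero.2 one_ne_zero hz.symm
  have h : (-1 : Eˣ) = (Units.mk0 (c z) ((map_ne_zero c).2 hz0)) ^ ℓ := by
    ext
    simp [← map_pow, hz]
  rw [h, ofMul_pow, map_nsmul]
  ext
  simp

/-- Descent of Steinberg homomorphisms along a finite purely inseparable extension of degree prime
to `ℓ`. -/
theorem exists_isSteinberg_of_isPurelyInseparable {ℓ r : ℕ} [Fact ℓ.Prime] {M K : Type*} [Field M]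
    [Field K] [Algebra M K] [FiniteDimensional M K] [IsPurelyInseparable M K] (hℓ : (ℓ : M) ≠ 0)
    {w : Additive Mˣ →+ (Fin r → ZMod ℓ)} (hw : IsSteinberg w) :
    ∃ w' : Additive Kˣ →+ (Fin r → ZMod ℓ), IsSteinberg w' ∧
      ∀ x : Mˣ, w' (.ofMul (Units.map (algebraMap M K : M →* K) x)) = w (.ofMul x) := by
  obtain ⟨p, hp⟩ := ExpChar.exists M
  let n := IsPurelyInseparable.exponent M K
  let φ : K →+* M := IsPurelyInseparable.iterateFrobenius M K p (n := n) le_rfl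
  have hq : ((p ^ n : ℕ) : ZMod ℓ) ≠ 0 := by
    rw [Ne, ZMod.natCast_eq_zero_iff]
    intro hdvd
    have h1 := Fact.out (p := ℓ.Prime).dvd_of_dvd_pow hdvd
    rcases hp with _ | hp'
    · exact (Fact.out : ℓ.Prime).one_lt.ne' (Nat.dvd_one.1 h1)
    · rw [(Nat.prime_dvd_prime_iff_eq Fact.out hp').1 h1] at hℓ
      exact hℓ (CharP.cast_eq_zero M p)
  let s : (Fin r → ZMod ℓ) →+ (Fin r → ZMod ℓ) :=
    DistribSMul.toAddMonoidHom _ ((p ^ n : ℕ) : ZMod ℓ)⁻¹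
  refine ⟨s.comp (w.comp (Units.map (φ : K →* M)).toAdditive), ?_, fun x => ?_⟩
  · intro a b hab
    rcases hw.comp_unitsMap φ a b hab with h | h | h
    · left; rw [AddMonoidHom.comp_apply, h, map_zero]
    · right; left; rw [AddMonoidHom.comp_apply, h, map_zero]
    · right; right; exact congrArg s h
  · have hx : Units.map (φ : K →* M) (Units.map (algebraMap M K : M →* K) x) = x ^ p ^ n := by
      ext
      simp [φ, IsPurelyInseparable.iterateFrobenius_algebraMap]
    change s (w (.ofMul (Units.map (φ : K →* M) (Units.map (algebraMap M K : M →* K) x)))) = _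
    rw [hx, ofMul_pow, map_nsmul, ← Nat.cast_smul_eq_nsmul (ZMod ℓ)]
    exact inv_smul_smul₀ hq _

theorem HasSteinbergFrame.cons {ℓ r : ℕ} [Fact ℓ.Prime] {k : Type*} [Field k] [IsAlgClosed k]
    (hℓ : (ℓ : k) ≠ 0) {E : Type u} {L K : Type*} [Field E] [Field L] [Field K] (c : k →+* E)
    [Algebra (Polynomial E) L] [IsFractionRing (Polynomial E) L] [Algebra L K]
    [FiniteDimensional L K] (t : Fin r → E)
    (h : ∀ (E' : Type u) [Field E'] (j : E →+* E'), j.Finite →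
      HasSteinbergFrame ℓ (j.comp c) (j ∘ t)) :
    HasSteinbergFrame ℓ
      (((algebraMap L K).comp (algebraMap (Polynomial E) L)).comp (Polynomial.C.comp c))
      (Fin.cons (algebraMap L K (algebraMap (Polynomial E) L Polynomial.X))
        (fun i => algebraMap L K (algebraMap (Polynomial E) L (Polynomial.C (t i))))) := by
  let M := separableClosure L K
  have : Infinite k := IsAlgClosed.instInfinite
  obtain ⟨a₀, E', _, j, σ, hj, hσ⟩ := exists_laurentSeries_embedding (L := L) (M := M) c
  obtain ⟨a, w, u, hw, hu, hwu⟩ := h E' j hj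
  let η : Polynomial E →+* M := (algebraMap L M).comp (algebraMap (Polynomial E) L)
  have hη : Function.Injective η :=
    (algebraMap L M).injective.comp (IsFractionRing.injective _ _)
  have hW := (hw.laurentExtend (map_neg_one_of_isAlgClosed
    (Fact.out (p := ℓ.Prime)).ne_zero (j.comp c) w)).comp_unitsMap σ
  have hℓM : (ℓ : M) ≠ 0 := by
    simpa using (map_ne_zero (η.comp (Polynomial.C.comp c))).2 hℓ
  obtain ⟨w', hw', hww'⟩ := exists_isSteinberg_of_isPurelyInseparable (K := K) hℓM hW
  have hX : Polynomial.X - Polynomial.C (c a₀) ≠ 0 := Polynomial.X_sub_C_ne_zero _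
  have hC (i : Fin r) : Polynomial.C (t i - c (a i)) ≠ 0 := by
    rw [Ne, Polynomial.C_eq_zero, ← map_eq_zero j, map_sub]
    have := hu i
    simp only [RingHom.comp_apply, Function.comp_apply] at this
    rw [← this]
    exact (u i).ne_zero
  let x₀ : Mˣ := Units.mk0 (η _) ((map_ne_zero_iff η hη).2 hX)
  let x (i : Fin r) : Mˣ := Units.mk0 (η _) ((map_ne_zero_iff η hη).2 (hC i))
  refine ⟨Fin.cons a₀ a, w', Fin.cons (Units.map (algebraMap M K : M →* K) x₀)
    fun i => Units.map (algebraMap M K : M →* K) (x i), hw', fun i => ?_, fun i => ?_⟩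
  · cases i using Fin.cases
    · simp [x₀]; rfl
    · simp [x]; rfl
  · cases i using Fin.cases with
    | zero =>
      rw [Fin.cons_zero, hww']
      have hval : σ (η (Polynomial.X - Polynomial.C (c a₀))) = HahnSeries.single 1 1 := by
        rw [RingHom.comp_apply, hσ, taylorSeries_apply]
        simp
      change laurentExtend w (.ofMul (Units.map (σ : M →* LaurentSeries E') x₀)) = _
      rw [laurentExtend_eq w _ (n := 1) (e := 1)]
      · rw [ofMul_one, map_zero]
        ext i
        cases i using Fin.cases <;> simp
      · change (σ (η _)).order = 1
        rw [hval, HahnSeries.order_single one_ne_zero]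
      · change (σ (η _)).leadingCoeff = _
        rw [hval, HahnSeries.leadingCoeff_of_single, Units.val_one]
    | succ i =>
      rw [Fin.cons_succ, hww']
      have hval : σ (η (Polynomial.C (t i - c (a i)))) = HahnSeries.single 0 (u i : E') := by
        rw [RingHom.comp_apply, hσ, taylorSeries_apply, hu]
        simp
      change laurentExtend w (.ofMul (Units.map (σ : M →* LaurentSeries E') (x i))) = _
      rw [laurentExtend_eq w _ (n := 0) (e := u i)]
      · rw [hwu]
        ext i'
        cases i' using Fin.cases with
        | zero => simp
        | succ i' => simp [Pi.single_apply]
      · change (σ (η _)).order = 0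
        rw [hval, HahnSeries.order_single (u i).ne_zero]
      · change (σ (η _)).leadingCoeff = _
        rw [hval, HahnSeries.leadingCoeff_of_single]

theorem HasSteinbergFrame.of_transcendental {ℓ r : ℕ} [Fact ℓ.Prime] {k : Type*} [Field k]
    [IsAlgClosed k] (hℓ : (ℓ : k) ≠ 0) {F K : Type u} [Field F] [Field K] [Algebra F K]
    (c : k →+* F) {E L : IntermediateField F K} (hEL : E ≤ L) (x : L)
    (hx : Transcendental E (x : K))
    (hL : ∀ z ∈ L, ∃ p q : Polynomial E, z = Polynomial.aeval (x : K) p / Polynomial.aeval (x : K) q)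
    (t : Fin r → E)
    (h : ∀ (E' : Type u) [Field E'] (j : E →+* E'), j.Finite →
      HasSteinbergFrame ℓ (j.comp ((algebraMap F E).comp c)) (j ∘ t))
    {E' : Type u} [Field E'] (j : L →+* E') (hj : j.Finite) :
    HasSteinbergFrame ℓ (j.comp ((algebraMap F L).comp c))
      (Fin.cons (j x) fun i => j (IntermediateField.inclusion hEL (t i))) := by
  let inc : E →+* L := IntermediateField.inclusion hEL
  let η : Polynomial E →+* L := Polynomial.eval₂RingHom inc x
  have hη (p : Polynomial E) : (η p : K) = Polynomial.aeval (x : K) p := by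
    change algebraMap L K (Polynomial.eval₂ inc x p) = _
    rw [Polynomial.hom_eval₂]
    rfl
  have hinj : Function.Injective η := by
    rw [injective_iff_map_eq_zero]
    intro p hp
    apply transcendental_iff.1 hx p
    rw [← hη, hp, ZeroMemClass.coe_zero]
  let _ : Algebra (Polynomial E) L := η.toAlgebra
  have : FaithfulSMul (Polynomial E) L := (faithfulSMul_iff_algebraMap_injective _ _).2 hinj
  have : IsFractionRing (Polynomial E) L := by
    refine IsFractionRing.of_field _ _ fun z => ?_
    obtain ⟨p, q, hpq⟩ := hL z z.2
    refine ⟨p, q, Subtype.ext ?_⟩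
    change (z : K) = (η p : K) / (η q : K)
    rw [hη, hη, hpq]
  let _ : Algebra L E' := j.toAlgebra
  have : FiniteDimensional L E' := hj
  have h := HasSteinbergFrame.cons (L := L) (K := E') hℓ ((algebraMap F E).comp c) t h
  convert h using 1
  · ext y
    change j _ = j (Polynomial.eval₂ inc x (Polynomial.C _))
    rw [Polynomial.eval₂_C]
    rfl
  · congr 1
    · change j _ = j (Polynomial.eval₂ inc x Polynomial.X)
      rw [Polynomial.eval₂_X]
    · ext i
      change j _ = j (Polynomial.eval₂ inc x (Polynomial.C _))
      rw [Polynomial.eval₂_C]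
      rfl

theorem adjoin_range_le_adjoin_simple {F K : Type*} [Field F] [Field K] [Algebra F K] {r : ℕ}
    {t : Fin (r + 1) → K} {E : IntermediateField F K} (hE : ∀ i : Fin r, t i.succ ∈ E) :
    IntermediateField.adjoin F (Set.range t) ≤
      (IntermediateField.adjoin E {t 0}).restrictScalars F := by
  rw [IntermediateField.adjoin_le_iff]
  rintro _ ⟨i, rfl⟩
  rw [SetLike.mem_coe, IntermediateField.mem_restrictScalars]
  cases i using Fin.cases with
  | zero => exact IntermediateField.subset_adjoin E {t 0} rfl
  | succ i => exact (IntermediateField.adjoin E {t 0}).algebraMap_mem ⟨_, hE i⟩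

theorem hasSteinbergFrame_adjoin {ℓ : ℕ} [Fact ℓ.Prime] {k : Type*} [Field k] [IsAlgClosed k]
    (hℓ : (ℓ : k) ≠ 0) {F K : Type u} [Field F] [Field K] [Algebra F K] (c : k →+* F) {r : ℕ}
    (t : Fin r → K) (ht : AlgebraicIndependent F t) (L : IntermediateField F K)
    (hL : L = IntermediateField.adjoin F (Set.range t)) (t' : Fin r → L) (htt' : ∀ i, t' i = t i)
    (E' : Type u) [Field E'] (j : L →+* E') (hj : j.Finite) :
    HasSteinbergFrame ℓ (j.comp ((algebraMap F L).comp c)) (j ∘ t') := by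
  induction r generalizing L E' with
  | zero =>
    exact ⟨finZeroElim, 0, finZeroElim, fun _ _ _ => .inl rfl, finZeroElim, finZeroElim⟩
  | succ r ih =>
    obtain ⟨E, hE⟩ : ∃ E, E = IntermediateField.adjoin F (Set.range (Fin.tail t)) := ⟨_, rfl⟩
    have htE (i : Fin r) : t i.succ ∈ E :=
      hE ▸ IntermediateField.subset_adjoin F _ ⟨i, rfl⟩
    have hEL : E ≤ L := by
      rw [hE, hL]
      refine IntermediateField.adjoin.mono _ _ _ ?_
      rintro _ ⟨i, rfl⟩
      exact ⟨_, rfl⟩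
    have hx : Transcendental E (t' 0 : K) := by
      rw [htt', hE, IntermediateField.transcendental_adjoin_iff]
      have h := ht.transcendental_adjoin (s := Set.range Fin.succ) (i := 0) (by simp)
      rwa [← Set.range_comp] at h
    have hfrac (z : K) (hz : z ∈ L) : ∃ p q : Polynomial E,
        z = Polynomial.aeval (t' 0 : K) p / Polynomial.aeval (t' 0 : K) q := by
      rw [htt']
      rw [hL] at hz
      exact (IntermediateField.mem_adjoin_simple_iff _ _).1 (adjoin_range_le_adjoin_simple htE hz)
    have h := HasSteinbergFrame.of_transcendental hℓ c hEL (t' 0) hx hfrac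
      (fun i => ⟨t i.succ, htE i⟩)
      (fun E'' _ j' hj' => ih (Fin.tail t) (ht.comp _ (Fin.succ_injective _)) E hE _
        (fun _ => rfl) E'' j' hj') j hj
    convert h using 1
    ext i
    cases i using Fin.cases with
    | zero => rfl
    | succ i => exact congrArg j (Subtype.ext (htt' _))

theorem natCast_ne_zero_of_ringChar_ne {ℓ : ℕ} (hℓ : ℓ.Prime) {k : Type*} [Field k]
    (h : ringChar k ≠ ℓ) : (ℓ : k) ≠ 0 := by
  intro h0
  rcases (Nat.dvd_prime hℓ).1 (ringChar.dvd h0) with h1 | h1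
  · exact CharP.ringChar_ne_one h1
  · exact h h1

theorem AlgebraicIndependent.exists_hasSteinbergFrame {ℓ : ℕ} (hℓ : ℓ.Prime) {k K : Type*}
    [Field k] [Field K] [Algebra k K] [IsAlgClosed k] (hchar : ringChar k ≠ ℓ)
    (hK : IsFunctionField k K) {r : ℕ} {t : Fin r → K} (ht : AlgebraicIndependent k t) :
    HasSteinbergFrame ℓ (algebraMap k K) t := by
  have : Fact ℓ.Prime := ⟨hℓ⟩
  obtain ⟨S, htS, hS⟩ := exists_isTranscendenceBasis_superset ht.coe_range
  let F := IntermediateField.adjoin k (S \ Set.range t)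
  have htF : AlgebraicIndependent F t := by
    rw [IntermediateField.algebraicIndependent_adjoin_iff]
    have h := hS.1.adjoin_of_disjoint (s := Subtype.val ⁻¹' (S \ Set.range t))
      (t := Subtype.val ⁻¹' Set.range t)
      (Disjoint.preimage _ Set.disjoint_sdiff_left)
    rw [Subtype.image_preimage_coe, Set.inter_eq_right.2 Set.sdiff_subset] at h
    exact h.comp (fun i => ⟨⟨t i, htS ⟨i, rfl⟩⟩, ⟨i, rfl⟩⟩) fun i i' hi =>
      ht.injective (congrArg (fun z => (z.1 : K)) hi)
  obtain ⟨L, hL⟩ : ∃ L, L = IntermediateField.adjoin F (Set.range t) := ⟨_, rfl⟩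
  have hSL (x : K) (hx : x ∈ IntermediateField.adjoin k S) : x ∈ L := by
    have : IntermediateField.adjoin k S ≤ L.restrictScalars k := by
      rw [IntermediateField.adjoin_le_iff]
      intro y hy
      rw [SetLike.mem_coe, IntermediateField.mem_restrictScalars]
      by_cases hyt : y ∈ Set.range t
      · exact hL ▸ IntermediateField.subset_adjoin F _ hyt
      · exact L.algebraMap_mem ⟨y, IntermediateField.subset_adjoin k _ ⟨hy, hyt⟩⟩
    exact this hx
  have hfin : FiniteDimensional L K := by
    obtain ⟨s, hs⟩ := hK
    have halg := hS.isAlgebraic_field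
    rw [Subtype.range_coe] at halg
    have hint (x : K) : IsIntegral L x :=
      (halg.isAlgebraic x).isIntegral.map_of_comp_eq
        ((algebraMap (IntermediateField.adjoin k S) K).codRestrict L fun y => hSL y y.2)
        (RingHom.id K) rfl
    have htop : IntermediateField.adjoin L (s : Set K) = ⊤ := by
      rw [eq_top_iff]
      intro x _
      have : IntermediateField.adjoin k (s : Set K) ≤
          ((IntermediateField.adjoin L (s : Set K)).restrictScalars F).restrictScalars k :=
        IntermediateField.adjoin_le_iff.2 (IntermediateField.subset_adjoin L _)
      exact this (hs ▸ IntermediateField.mem_top)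
    have h := IntermediateField.finiteDimensional_adjoin (K := L) (S := (s : Set K))
      fun x _ => hint x
    rw [htop] at h
    exact Module.Finite.equiv (IntermediateField.topEquiv (F := L) (E := K)).toLinearEquiv
  exact hasSteinbergFrame_adjoin (natCast_ne_zero_of_ringChar_ne hℓ hchar) (algebraMap k F) t htF L
    hL (fun i => ⟨t i, hL ▸ IntermediateField.subset_adjoin F _ ⟨i, rfl⟩⟩) (fun _ => rfl) K
    (algebraMap L K) (RingHom.finite_algebraMap.2 hfin)

theorem algebraicIndependent_of_hasTrdeg_iSup {k K : Type*} [Field k] [Field K] [Algebra k K]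
    {r : ℕ} {F : Fin r → IntermediateField k K} {x : ∀ i, F i}
    (hx : ∀ i, IsTranscendenceBasis k fun _ : Fin 1 => x i)
    (hF : HasTrdeg k (⨆ i, F i : IntermediateField k K) r) :
    AlgebraicIndependent k fun i => (x i : K) := by
  obtain ⟨G, hG⟩ : ∃ G, G = ⨆ i, F i := ⟨_, rfl⟩
  rw [← hG] at hF
  obtain ⟨y, hy⟩ := hF
  have hFG (i : Fin r) : F i ≤ G := hG ▸ le_iSup F i
  let x' (i : Fin r) : G := IntermediateField.inclusion (hFG i) (x i)
  obtain ⟨A, hA⟩ : ∃ A, A = IntermediateField.adjoin k (Set.range x') := ⟨_, rfl⟩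
  have hGA : G ≤ (algebraicClosure A K).restrictScalars k := by
    refine hG.le.trans (iSup_le fun i z hz => ?_)
    rw [IntermediateField.mem_restrictScalars, mem_algebraicClosure_iff]
    obtain ⟨B, hB⟩ : ∃ B, B = IntermediateField.adjoin k (Set.range fun _ : Fin 1 => x i) :=
      ⟨_, rfl⟩
    have hle : B ≤ A.comap (IntermediateField.inclusion (hFG i)) := by
      rw [hB, IntermediateField.adjoin_le_iff]
      rintro _ ⟨_, rfl⟩
      exact hA ▸ IntermediateField.subset_adjoin k _ ⟨i, rfl⟩
    have halg := (hx i).isAlgebraic_field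
    rw [← hB] at halg
    exact ((halg.isAlgebraic ⟨z, hz⟩).isIntegral.map_of_comp_eq
      (((IntermediateField.inclusion (hFG i) : F i →+* G).comp (algebraMap B (F i))).codRestrict A
        fun b => hle b.2) (algebraMap (F i) K) rfl).isAlgebraic
  have halg : Algebra.IsAlgebraic (Algebra.adjoin k (Set.range x')) G := by
    refine ⟨fun g => ?_⟩
    rw [← IntermediateField.isAlgebraic_adjoin_iff, ← hA,
      ← isAlgebraic_algebraMap_iff (algebraMap G K).injective]
    exact mem_algebraicClosure_iff.1 (hGA g.2)
  have hx' := Algebra.IsAlgebraic.isTranscendenceBasis_of_lift_le_trdeg_of_finite k x'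
    hy.lift_cardinalMk_eq_trdeg.le
  exact hx'.1.map' (f := G.val) G.val.injective

theorem statement_2 (ℓ : ℕ) (hℓ : ℓ.Prime) (k K : Type*) [Field k] [Field K] [Algebra k K]
    [IsAlgClosed k] (hchar : ringChar k ≠ ℓ) (hK : IsFunctionField k K) :
    (∀ (r : ℕ) (t : Fin r → K), AlgebraicIndependent k t →
      ∃ a : Fin r → k, ∃ u : Fin r → Kˣ,
        (∀ i, (u i : K) = t i - algebraMap k K (a i)) ∧ milnorSymbol ℓ u ≠ 0) ∧
    (∀ (r : ℕ) (F : Fin r → IntermediateField k K),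
      (∀ i, HasTrdeg k (F i) 1) → HasTrdeg k (⨆ i, F i : IntermediateField k K) r →
      ∃ x : Fin r → Kˣ, (∀ i, (x i : K) ∈ F i) ∧ milnorSymbol ℓ x ≠ 0) := by
  have key (r : ℕ) (t : Fin r → K) (ht : AlgebraicIndependent k t) :
      ∃ a : Fin r → k, ∃ u : Fin r → Kˣ,
        (∀ i, (u i : K) = t i - algebraMap k K (a i)) ∧ milnorSymbol ℓ u ≠ 0 := by
    obtain ⟨a, w, u, hw, hu, hwu⟩ := ht.exists_hasSteinbergFrame hℓ hchar hK
    exact ⟨a, u, hu, milnorSymbol_ne_zero_of_isSteinberg hℓ.ne_one hw hwu⟩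
  refine ⟨key, fun r F h₁ hF => ?_⟩
  choose x hx using h₁
  have hx' (i : Fin r) : IsTranscendenceBasis k fun _ : Fin 1 => x i 0 := by
    convert hx i using 2 with j
    rw [Subsingleton.elim j 0]
  obtain ⟨a, u, hu, hne⟩ := key r _ (algebraicIndependent_of_hasTrdeg_iSup hx' hF)
  refine ⟨u, fun i => ?_, hne⟩
  rw [hu]
  exact sub_mem (x i 0).2 ((F i).algebraMap_mem _)

end
end

section
/- Let ℓ be a prime and let K be a function field over an algebraically closed field k with char k ≠ ℓ, and set d := trdeg(K|k). Let L be a relatively algebraically closed subextension of K|k with r := trdeg(L|k) < d, and let z ∈ K^× be an element with z ∉ L^×·(K^×)^ℓ. Then there exist x_1,…,x_r ∈ L^× such that {x_1,…,x_r,z} ≠ 0 in k^M_{r+1}(K). -/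
/-! Common definitions: mod-ℓ Milnor K-theory, K^×/(K^×)^ℓ, Ω_K, relative algebraic
closure, transcendence degree predicates, discrete valuations, etc. -/

noncomputable section

open scoped TensorProduct

universe u v

theorem LinearIndependent.exists_dual_family {F V ι : Type*} [Field F] [AddCommGroup V]
    [Module F V] [DecidableEq ι] {v : ι → V} (hv : LinearIndependent F v) :
    ∃ φ : ι → V →ₗ[F] F, ∀ i j, φ i (v j) = if i = j then 1 else 0 := by
  choose φ hφ using fun i => ((Module.Basis.span hv).coord i).exists_extend
  refine ⟨φ, fun i j => ?_⟩
  have h := LinearMap.congr_fun (hφ i) (Module.Basis.span hv j)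
  rw [Module.Basis.coord_apply, Module.Basis.repr_self, Finsupp.single_apply,
    LinearMap.comp_apply, Submodule.subtype_apply, Module.Basis.span_apply] at h
  rw [h]
  exact if_congr eq_comm rfl rfl
/-- In an abelian group `G`, a finite family whose classes are independent modulo `ℓ` relative to a
subgroup `H ⊇ ℓG` admits dual homomorphisms to `ZMod ℓ` which kill `H`. -/
theorem AddSubgroup.exists_dual_family {ℓ : ℕ} [Fact ℓ.Prime] {G : Type*} [AddCommGroup G]
    (H : AddSubgroup G) (hH : ∀ g : G, ℓ • g ∈ H) {ι : Type*} [Fintype ι] [DecidableEq ι]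
    (x : ι → G) (hx : ∀ e : ι → ℤ, ∑ i, e i • x i ∈ H → ∀ i, (ℓ : ℤ) ∣ e i) :
    ∃ φ : ι → G →+ ZMod ℓ, (∀ i, ∀ h ∈ H, φ i h = 0) ∧
      ∀ i j, φ i (x j) = if i = j then 1 else 0 := by
  let _ : Module (ZMod ℓ) (G ⧸ H) := AddCommGroup.zmodModule (fun q => by
    obtain ⟨g, rfl⟩ := QuotientAddGroup.mk_surjective q
    rw [← QuotientAddGroup.mk_nsmul, QuotientAddGroup.eq_zero_iff]
    exact hH g)
  have hli : LinearIndependent (ZMod ℓ) (fun i => (QuotientAddGroup.mk (x i) : G ⧸ H)) := by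
    rw [Fintype.linearIndependent_iff]
    intro g hg i
    choose e he using fun i => ZMod.intCast_surjective (g i)
    have : ∑ i, e i • x i ∈ H := by
      rw [← QuotientAddGroup.eq_zero_iff]
      have h1 : ((∑ i, e i • x i : G) : G ⧸ H) = ∑ i, e i • (x i : G ⧸ H) := by
        rw [← QuotientAddGroup.mk'_apply, map_sum]
        simp
      rw [h1, ← hg]
      refine Finset.sum_congr rfl fun i _ => ?_
      rw [← he i, Int.cast_smul_eq_zsmul]
    rw [← he i, ZMod.intCast_zmod_eq_zero_iff_dvd]
    exact hx e this i
  obtain ⟨φ, hφ⟩ := hli.exists_dual_family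
  refine ⟨fun i => (φ i).toAddMonoidHom.comp (QuotientAddGroup.mk' H), ?_, hφ⟩
  intro i h hh
  rw [AddMonoidHom.comp_apply, QuotientAddGroup.mk'_apply, (QuotientAddGroup.eq_zero_iff h).2 hh,
    map_zero]

/-- A multilinear functional detecting a mod-`ℓ` Milnor symbol. -/
theorem milnorSymbol_ne_zero_of_functional {K : Type*} [Field K] {ℓ n : ℕ}
    (D : MultilinearMap ℤ (fun _ : Fin n => Additive Kˣ) (ZMod ℓ))
    (hD : ∀ a : Fin n → Kˣ, (∃ i j : Fin n, i < j ∧ ((a i : K) + (a j : K) = 1)) →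
      D (fun i => Additive.ofMul (a i)) = 0)
    (a : Fin n → Kˣ) (ha : D (fun i => Additive.ofMul (a i)) ≠ 0) :
    milnorSymbol ℓ a ≠ 0 := by
  have h1 : SteinbergRel n K ≤ LinearMap.ker (PiTensorProduct.lift D) := by
    refine Submodule.span_le.2 ?_
    rintro _ ⟨a, h, rfl⟩
    simpa using hD a h
  let E := (SteinbergRel n K).liftQ (PiTensorProduct.lift D) h1
  have h2 : LinearMap.range ((ℓ : ℤ) • (LinearMap.id : MilnorK n K →ₗ[ℤ] MilnorK n K)) ≤
      LinearMap.ker E := by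
    rintro _ ⟨y, rfl⟩
    simp
  intro h0
  apply ha
  have h3 : Submodule.liftQ _ E h2 (milnorSymbol ℓ a) = D (fun i => Additive.ofMul (a i)) := by
    simp [milnorSymbol, E]
  rw [← h3, h0, map_zero]

theorem milnorSymbol_snoc_ne_zero_of_valuationSubring {K : Type*} [Field K] {ℓ : ℕ}
    [Fact ℓ.Prime] (O : ValuationSubring K) {r : ℕ} (x : Fin r → Kˣ) (z : Kˣ)
    (h1 : ∀ (e : Fin r → ℤ) (c b : Kˣ), O.valuation (c : K) = 1 →
      ∏ i, x i ^ e i = c * b ^ ℓ → ∀ i, (ℓ : ℤ) ∣ e i)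
    (h2 : ∀ (e : Fin r → ℤ) (m b : Kˣ), O.valuation ((m : K) - 1) < 1 →
      z ≠ (∏ i, x i ^ e i) * m * b ^ ℓ)
    (h3 : ∃ y : Kˣ, y ^ ℓ = -1) :
    milnorSymbol ℓ (Fin.snoc x z) ≠ 0 := by
  have hv1 : ∀ m : K, O.valuation (m - 1) < 1 → O.valuation m = 1 := fun m hm => by
    have := O.valuation.map_one_add_of_lt hm
    rwa [add_sub_cancel] at this
  let P : Subgroup Kˣ := (powMonoidHom ℓ : Kˣ →* Kˣ).range
  let H1 : Subgroup Kˣ := O.unitGroup ⊔ P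
  let M : Subgroup Kˣ := O.principalUnitGroup
  let X : Subgroup Kˣ := Subgroup.closure (Set.range x)
  let H2 : Subgroup Kˣ := X ⊔ M ⊔ P
  have hX : ∀ y ∈ X, ∃ e : Fin r → ℤ, y = ∏ i, x i ^ e i := by
    intro y hy
    exact Subgroup.mem_closure_range_iff_of_fintype.1 hy
  have hPpow : ∀ y : Kˣ, y ^ ℓ ∈ P := fun y => ⟨y, rfl⟩
  have hneg : (-1 : Kˣ) ∈ P := h3
  obtain ⟨f, hf0, hfx⟩ := AddSubgroup.exists_dual_family (ℓ := ℓ) (Subgroup.toAddSubgroup H1)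
    (fun g => Subgroup.mem_sup_right (T := P) (hPpow (Additive.toMul g))) (fun i => Additive.ofMul (x i)) (by
      intro e he
      have he' : ∏ i, x i ^ e i ∈ H1 := he
      obtain ⟨c, hc, _, ⟨b, rfl⟩, hcb⟩ := Subgroup.mem_sup.1 he'
      exact h1 e c b ((O.mem_unitGroup_iff c).1 hc) hcb.symm)
  obtain ⟨g, hg0, hgz⟩ := AddSubgroup.exists_dual_family (ℓ := ℓ) (Subgroup.toAddSubgroup H2)
    (fun g => Subgroup.mem_sup_right (T := P) (hPpow (Additive.toMul g))) (fun _ : Unit => Additive.ofMul z) (by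
      intro e he _
      have he' : z ^ e () ∈ H2 := by simpa using he
      by_contra hnd
      have hz : z ∈ H2 := by
        have hc : IsCoprime (ℓ : ℤ) (e ()) :=
          (Nat.prime_iff_prime_int.1 Fact.out).coprime_iff_not_dvd.2 hnd
        obtain ⟨s, t, hst⟩ := hc
        have : z = (z ^ s) ^ ℓ * (z ^ e ()) ^ t := by
          rw [← zpow_natCast, ← zpow_mul, ← zpow_mul, ← zpow_add, mul_comm (e ()), hst, zpow_one]
        rw [this]
        exact mul_mem (Subgroup.mem_sup_right (hPpow _)) (zpow_mem he' _)
      obtain ⟨xm, hxm, _, ⟨b, rfl⟩, hb⟩ := Subgroup.mem_sup.1 hz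
      obtain ⟨y, hy, m, hm, rfl⟩ := Subgroup.mem_sup.1 hxm
      obtain ⟨e', rfl⟩ := hX y hy
      exact h2 e' m b ((O.mem_principalUnitGroup_iff m).1 hm) hb.symm)
  have hfg : ∀ i (y : Kˣ), y ∈ H1 → f i (Additive.ofMul y) = 0 := fun i y hy => hf0 i _ hy
  have hgg : ∀ (y : Kˣ), y ∈ H2 → g () (Additive.ofMul y) = 0 := fun y hy => hg0 () _ hy
  let Φ : Additive Kˣ →ₗ[ℤ] (Fin (r + 1) → ZMod ℓ) :=
    LinearMap.pi (Fin.snoc (fun i => (f i).toIntLinearMap) (g ()).toIntLinearMap)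
  have hΦl : ∀ y, Φ y (Fin.last r) = g () y := by intro y; simp [Φ]
  have hΦc : ∀ y i, Φ y (Fin.castSucc i) = f i y := by intro y i; simp [Φ]
  let D := ((Matrix.detRowAlternating (n := Fin (r + 1)) (R := ZMod ℓ)).toMultilinearMap.restrictScalars
    ℤ).compLinearMap (fun _ => Φ)
  have hDdet : ∀ a, D a = Matrix.det (Matrix.of fun i => Φ (a i)) := fun a => rfl
  have hM1 : M ≤ H1 := fun m hm =>
    Subgroup.mem_sup_left ((O.mem_unitGroup_iff m).2 (hv1 _ ((O.mem_principalUnitGroup_iff m).1 hm)))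
  have hΦM : ∀ y ∈ M, Φ (Additive.ofMul y) = 0 := by
    intro y hy
    ext i
    refine Fin.lastCases ?_ (fun i => ?_) i
    · rw [hΦl]; exact hgg y (Subgroup.mem_sup_left (Subgroup.mem_sup_right hy))
    · rw [hΦc]; exact hfg i y (hM1 hy)
  have hΦneg : Φ (Additive.ofMul (-1)) = 0 := by
    ext i
    refine Fin.lastCases ?_ (fun i => ?_) i
    · rw [hΦl]; exact hgg _ (Subgroup.mem_sup_right hneg)
    · rw [hΦc]; exact hfg i _ (Subgroup.mem_sup_right hneg)
  refine milnorSymbol_ne_zero_of_functional D ?_ _ ?_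
  · rintro a ⟨i, j, hij, hadd⟩
    rw [hDdet]
    set A : Matrix (Fin (r + 1)) (Fin (r + 1)) (ZMod ℓ) :=
      Matrix.of fun i => Φ (Additive.ofMul (a i)) with hA
    have hrow : ∀ i j, (a i : K) + a j = 1 → O.valuation (a i : K) < 1 → A.det = 0 := by
      intro i j hadd hi
      refine Matrix.det_eq_zero_of_row_eq_zero j fun l => ?_
      have hj : a j ∈ M := by
        rw [O.mem_principalUnitGroup_iff, show (a j : K) - 1 = -(a i) by rw [← hadd]; ring,
          Valuation.map_neg]
        exact hi
      simp [hA, hΦM _ hj]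
    rcases lt_trichotomy (O.valuation (a i : K)) 1 with hi | hi | hi
    · exact hrow i j hadd hi
    · rcases lt_or_ge (O.valuation (a j : K)) 1 with hj | hj
      · exact hrow j i (by rw [add_comm, hadd]) hj
      have hj' : O.valuation (a j : K) = 1 := by
        refine le_antisymm ?_ hj
        rw [show (a j : K) = 1 - a i by rw [← hadd]; ring]
        exact (O.valuation.map_sub _ _).trans (by simp [hi])
      have hc : ∀ i l, O.valuation (a i : K) = 1 → A i (Fin.castSucc l) = 0 := fun i l hi => by
        simp only [hA, Matrix.of_apply, hΦc]
        exact hfg _ _ (Subgroup.mem_sup_left ((O.mem_unitGroup_iff _).2 hi))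
      by_cases h0 : A i (Fin.last r) = 0
      · exact Matrix.det_eq_zero_of_row_eq_zero i (Fin.lastCases h0 fun l => hc i l hi)
      · refine Matrix.exists_vecMul_eq_zero_iff.1
          ⟨Pi.single i (A j (Fin.last r)) - Pi.single j (A i (Fin.last r)), fun h => h0 ?_, ?_⟩
        · simpa [hij.ne'] using congr_fun h j
        · ext l
          rw [Matrix.sub_vecMul, Matrix.single_vecMul, Matrix.single_vecMul]
          refine Fin.lastCases ?_ (fun l => ?_) l
          · simp [mul_comm]
          · simp [hc i l hi, hc j l hj']
    · refine Matrix.det_zero_of_row_eq hij.ne ?_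
      have hm : -(a j) * (a i)⁻¹ ∈ M := by
        rw [O.mem_principalUnitGroup_iff]
        have : ((-(a j) * (a i)⁻¹ : Kˣ) : K) - 1 = -(a i : K)⁻¹ := by
          have : (a j : K) = 1 - a i := by rw [← hadd]; ring
          push_cast
          rw [this]
          field_simp
          ring
        rw [this, Valuation.map_neg, map_inv₀]
        exact inv_lt_one_of_one_lt₀ hi
      have hj : a j = (-1) * (-(a j) * (a i)⁻¹) * a i := by
        rw [← mul_assoc, inv_mul_cancel_right, neg_mul_neg, one_mul]
      change Φ _ = Φ _
      rw [hj, ofMul_mul, ofMul_mul, map_add, map_add, hΦneg, hΦM _ hm, zero_add, zero_add]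
  · rw [hDdet, Matrix.det_of_isLowerTriangular, Fin.prod_univ_castSucc]
    · simp [hΦl, hΦc, hfx, hgz () ()]
    · intro i j hij
      rcases Fin.eq_castSucc_or_eq_last i with ⟨i, rfl⟩ | rfl
      · rcases Fin.eq_castSucc_or_eq_last j with ⟨j, rfl⟩ | rfl
        · have : j ≠ i := fun h => by simp [h] at hij
          simp [hΦc, hfx, this]
        · simp only [Matrix.of_apply, hΦl, Fin.snoc_castSucc]
          exact hgg _ (Subgroup.mem_sup_left (Subgroup.mem_sup_left
            (Subgroup.subset_closure ⟨i, rfl⟩)))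
      · exact absurd hij (not_lt.2 (Fin.le_last j))

namespace MvPolynomial

/-- The polynomial with prescribed coefficients on a finite set of exponents. -/
def ofCoeffs {τ R : Type*} [CommSemiring R] (B : Finset (τ →₀ ℕ)) (c : B → R) :
    MvPolynomial τ R :=
  ∑ m : B, monomial (m : τ →₀ ℕ) (c m)

theorem map_ofCoeffs {τ R S : Type*} [CommSemiring R] [CommSemiring S] (φ : R →+* S)
    (B : Finset (τ →₀ ℕ)) (c : B → R) :
    map φ (ofCoeffs B c) = ofCoeffs B (fun m => φ (c m)) := by
  simp [ofCoeffs, map_sum, map_monomial]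

theorem coeff_ofCoeffs_of_notMem {τ R : Type*} [CommSemiring R] {B : Finset (τ →₀ ℕ)}
    (c : B → R) {m : τ →₀ ℕ} (hm : m ∉ B) : coeff m (ofCoeffs B c) = 0 := by
  classical
  rw [ofCoeffs, coeff_sum]
  refine Finset.sum_eq_zero fun i _ => ?_
  rw [coeff_monomial, if_neg]
  rintro rfl
  exact hm i.2

theorem ofCoeffs_coeff {τ R : Type*} [CommSemiring R] {B : Finset (τ →₀ ℕ)}
    {g : MvPolynomial τ R} (hg : g.support ⊆ B) : ofCoeffs B (fun m => coeff m g) = g := by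
  classical
  rw [ofCoeffs, Finset.sum_coe_sort B (fun m => monomial m (coeff m g))]
  conv_rhs => rw [g.as_sum]
  refine (Finset.sum_subset hg fun m _ hm => ?_).symm
  rw [notMem_support_iff.1 hm, monomial_zero]

theorem not_irreducible_ofCoeffs_mul {τ F : Type*} [Field F] {B : Finset (τ →₀ ℕ)}
    {c c' : B → F} {m : τ →₀ ℕ} (hm : m ∉ B)
    (h0 : coeff m (ofCoeffs B c * ofCoeffs B c') ≠ 0) :
    ¬ Irreducible (ofCoeffs B c * ofCoeffs B c') := by
  intro hirr
  rcases hirr.isUnit_or_isUnit rfl with h | h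
  · obtain ⟨a, -, ha⟩ := isUnit_iff_eq_C_of_isReduced.1 h
    rw [ha, coeff_C_mul, coeff_ofCoeffs_of_notMem _ hm, mul_zero] at h0
    exact h0 rfl
  · obtain ⟨a, -, ha⟩ := isUnit_iff_eq_C_of_isReduced.1 h
    rw [ha, mul_comm, coeff_C_mul, coeff_ofCoeffs_of_notMem _ hm, mul_zero] at h0
    exact h0 rfl

theorem irreducible_of_ne_ofCoeffs_mul {τ F : Type*} [Field F] {B : Finset (τ →₀ ℕ)} {d : ℕ}
    (hd : 0 < d) (hB : ∀ m : τ →₀ ℕ, m.degree < d → m ∈ B) {P : MvPolynomial τ F}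
    (hP : P.totalDegree = d) (h : ∀ c c' : B → F, P ≠ ofCoeffs B c * ofCoeffs B c') :
    Irreducible P := by
  have hP0 : P ≠ 0 := by
    rintro rfl
    simp at hP; omega
  have key : ∀ g h : MvPolynomial τ F, P = g * h → ¬ IsUnit h → g.support ⊆ B := by
    intro g h hgh hh m hm
    have hg0 : g ≠ 0 := by rintro rfl; simp at hm
    have hh0 : h ≠ 0 := by rintro rfl; simp [hP0] at hgh
    have h1 := totalDegree_mul_of_isDomain hg0 hh0
    rw [← hgh, hP] at h1
    have h2 : h.totalDegree ≠ 0 := by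
      intro h2
      rw [totalDegree_eq_zero_iff_eq_C] at h2
      apply hh
      rw [h2]
      refine (IsUnit.mk0 _ ?_).map C
      rintro h3
      rw [h3, map_zero] at h2
      exact hh0 h2
    have h3 := le_totalDegree hm
    refine hB m ?_
    change (m.sum fun _ e => e) < d
    omega
  refine ⟨fun hu => ?_, fun g h' hgh => ?_⟩
  · obtain ⟨a, -, rfl⟩ := isUnit_iff_eq_C_of_isReduced.1 hu
    simp at hP; omega
  · by_contra! hc
    refine h (fun m => coeff m g) (fun m => coeff m h') ?_
    rw [ofCoeffs_coeff (key g h' hgh hc.2),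
      ofCoeffs_coeff (key h' g (by rw [hgh, mul_comm]) hc.1), hgh]

/-- **Bertini–Noether**: a polynomial over a field `L` that remains irreducible over every finite
extension of `L` has irreducible reductions along all ring homomorphisms from subrings of `L`
containing a suitable finite set. -/
theorem exists_finset_irreducible_map {L : Type u} [Field L] {τ : Type v} [Finite τ]
    (P : MvPolynomial τ L)
    (hP : ∀ (D : Type max u v) [Field D] [Algebra L D] [FiniteDimensional L D],
      Irreducible (map (algebraMap L D) P)) :
    ∃ S : Finset L, ∀ {O : Type*} {κ : Type*} [CommRing O] [Field κ] (j : O →+* L) (ρ : O →+* κ),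
      Function.Injective j → (S : Set L) ⊆ Set.range j →
      ∀ P' : MvPolynomial τ O, map j P' = P → Irreducible (map ρ P') := by
  classical
  obtain ⟨d, hd⟩ : ∃ d, d = P.totalDegree := ⟨_, rfl⟩
  let B : Finset (τ →₀ ℕ) := (Finsupp.finite_of_degree_lt (σ := τ) d).toFinset
  have hB : ∀ m, m ∈ B ↔ m.degree < d := fun m => by simp [B]
  have hd0 : 0 < d := by
    refine Nat.pos_of_ne_zero fun h0 => ?_
    rw [hd, totalDegree_eq_zero_iff_eq_C] at h0
    have h1 := hP (ULift.{v} L)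
    rw [h0, map_C] at h1
    by_cases hc : coeff 0 P = 0
    · rw [hc, map_zero, map_zero] at h1
      exact h1.ne_zero rfl
    · exact h1.not_isUnit (((IsUnit.mk0 _ hc).map (algebraMap L (ULift.{v} L))).map C)
  have hP0 : P ≠ 0 := by
    rintro rfl
    simp at hd; omega
  obtain ⟨m₀, hm₀, hm₀d⟩ := Finset.exists_mem_eq_sup P.support
    (support_nonempty.2 hP0) (fun s => s.sum fun _ e => e)
  have hm₀d' : m₀.degree = d := by rw [hd]; exact hm₀d.symm
  have hm₀B : m₀ ∉ B := by rw [hB, hm₀d']; exact lt_irrefl d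
  let V := MvPolynomial (B ⊕ B) L
  let f : (τ →₀ ℕ) → V := fun m =>
    coeff m (ofCoeffs B (fun i => (X (Sum.inl i) : V)) * ofCoeffs B (fun i => X (Sum.inr i)) -
      map C P)
  have htop : Ideal.span (Set.range f) = ⊤ := by
    by_contra hne
    obtain ⟨M, hM, hIM⟩ := Ideal.exists_le_maximal _ hne
    let _ : Field (V ⧸ M) := Ideal.Quotient.field M
    have : FiniteDimensional L (V ⧸ M) := finite_of_finite_type_of_isJacobsonRing L (V ⧸ M)
    have h1 : map (algebraMap L (V ⧸ M)) P =
        ofCoeffs B (fun i => Ideal.Quotient.mk M (X (Sum.inl i))) *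
          ofCoeffs B (fun i => Ideal.Quotient.mk M (X (Sum.inr i))) := by
      rw [← map_ofCoeffs, ← map_ofCoeffs, ← map_mul, ← sub_eq_zero]
      have h2 : map (algebraMap L (V ⧸ M)) P = map (Ideal.Quotient.mk M) (map C P) := by
        rw [map_map]; rfl
      rw [h2, ← map_sub, ← neg_eq_zero, ← map_neg, neg_sub]
      ext m
      rw [coeff_map, coeff_zero, Ideal.Quotient.eq_zero_iff_mem]
      exact hIM (Ideal.subset_span ⟨m, rfl⟩)
    have h3 := hP (V ⧸ M)
    rw [h1] at h3
    refine not_irreducible_ofCoeffs_mul hm₀B ?_ h3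
    rw [← h1, coeff_map]
    exact (map_ne_zero _).2 (mem_support_iff.1 hm₀)
  obtain ⟨c, hc⟩ := Finsupp.mem_ideal_span_range_iff_exists_finsupp.1
    ((Ideal.eq_top_iff_one _).1 htop)
  refine ⟨insert (coeff m₀ P)⁻¹ (c.support.biUnion fun m => (c m).coeffs), ?_⟩
  intro O κ _ _ j ρ hj hS P' hP'
  rw [Finset.coe_insert, Set.insert_subset_iff] at hS
  obtain ⟨⟨t, ht⟩, hS⟩ := hS
  have htu : coeff m₀ P' * t = 1 := by
    apply hj
    rw [map_mul, map_one, ht, ← coeff_map, hP']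
    exact mul_inv_cancel₀ (mem_support_iff.1 hm₀)
  have hρm : coeff m₀ (map ρ P') ≠ 0 := by
    rw [coeff_map]
    intro h0
    have := congr_arg ρ htu
    rw [map_mul, h0, zero_mul, map_one] at this
    exact zero_ne_one this
  refine irreducible_of_ne_ofCoeffs_mul (B := B) hd0 (fun m => (hB m).2) ?_ ?_
  · refine le_antisymm ?_ ?_
    · rw [hd, totalDegree, totalDegree]
      refine Finset.sup_mono fun m hm => ?_
      rw [mem_support_iff] at hm ⊢
      rw [← hP', coeff_map]
      intro h0
      rw [map_eq_zero_iff j hj] at h0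
      rw [coeff_map, h0, map_zero] at hm
      exact hm rfl
    · have := le_totalDegree (mem_support_iff.2 hρm)
      rwa [← hm₀d']
  · intro g h hgh
    have hex : ∀ m, ∃ q : MvPolynomial (B ⊕ B) O, m ∈ c.support → map j q = c m := by
      intro m
      by_cases hm : m ∈ c.support
      · obtain ⟨q, hq⟩ := mem_range_map_iff_coeffs_subset.2
          (Set.Subset.trans (by
            intro x hx
            exact Finset.mem_coe.2 (Finset.mem_biUnion.2 ⟨m, hm, hx⟩)) hS : ((c m).coeffs : Set L) ⊆ Set.range j)
        exact ⟨q, fun _ => hq⟩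
      · exact ⟨0, fun h => absurd h hm⟩
    choose q hq using hex
    let f' : (τ →₀ ℕ) → MvPolynomial (B ⊕ B) O := fun m =>
      coeff m (ofCoeffs B (fun i => (X (Sum.inl i) : MvPolynomial (B ⊕ B) O)) *
        ofCoeffs B (fun i => X (Sum.inr i)) - map C P')
    have hf' : ∀ m, map j (f' m) = f m := by
      intro m
      simp only [f', f]
      rw [← coeff_map, map_sub, map_mul, map_ofCoeffs, map_ofCoeffs, map_map, ← hP', map_map]
      simp only [map_X]
      rw [show (map j).comp (C : O →+* MvPolynomial (B ⊕ B) O) = C.comp j from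
        RingHom.ext fun x => map_C _ _]
    have h1 : ∑ m ∈ c.support, q m * f' m = 1 := by
      apply map_injective j hj
      rw [map_sum, map_one, ← hc, Finsupp.sum]
      refine Finset.sum_congr rfl fun m hm => ?_
      rw [map_mul, hf', hq m hm]
    have h2 : ∀ m, eval₂Hom ρ (Sum.elim g h) (f' m) = 0 := by
      intro m
      simp only [f']
      rw [← coeff_map, map_sub, map_mul, map_ofCoeffs, map_ofCoeffs, map_map]
      simp only [eval₂Hom_X', Sum.elim_inl, Sum.elim_inr]
      rw [← hgh, eval₂Hom_comp_C, sub_self, coeff_zero]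
    have h3 := congr_arg (eval₂Hom ρ (Sum.elim g h)) h1
    rw [map_sum, map_one] at h3
    refine zero_ne_one (h3 ▸ (Finset.sum_eq_zero fun m _ => ?_).symm)
    rw [map_mul, h2, mul_zero]

theorem map_map_optionEquivLeft {ι R S : Type*} [CommRing R] [CommRing S] (φ : R →+* S)
    (f : MvPolynomial (Option ι) R) :
    (optionEquivLeft R ι f).map (map φ) = optionEquivLeft S ι (map φ f) := by
  induction f using induction_on with
  | C a => simp
  | add p q hp hq => simp [hp, hq]
  | mul_X p n hp => cases n <;> simp [hp, optionEquivLeft_X_some, optionEquivLeft_X_none]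

theorem irreducible_map_optionEquivLeft_iff {ι R S : Type*} [CommRing R] [CommRing S] (φ : R →+* S)
    (f : Polynomial (MvPolynomial ι R)) :
    Irreducible (map φ ((optionEquivLeft R ι).symm f)) ↔ Irreducible (f.map (map φ)) := by
  rw [← MulEquiv.irreducible_iff (optionEquivLeft S ι), ← map_map_optionEquivLeft,
    AlgEquiv.apply_symm_apply]

/-- **Bertini–Noether** for univariate polynomials over a multivariate polynomial ring. -/
theorem exists_finset_irreducible_polynomial_map {L : Type u} [Field L] {ι : Type v} [Finite ι]
    (P : Polynomial (MvPolynomial ι L))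
    (hP : ∀ (D : Type max u v) [Field D] [Algebra L D] [FiniteDimensional L D],
      Irreducible (P.map (map (algebraMap L D)))) :
    ∃ S : Finset L, ∀ {O : Type*} {κ : Type*} [CommRing O] [Field κ] (j : O →+* L) (ρ : O →+* κ),
      Function.Injective j → (S : Set L) ⊆ Set.range j →
      ∃ P' : Polynomial (MvPolynomial ι O), P'.map (map j) = P ∧ Irreducible (P'.map (map ρ)) := by
  classical
  obtain ⟨S, hS⟩ := exists_finset_irreducible_map ((optionEquivLeft L ι).symm P) (by
    intro D _ _ _
    rw [irreducible_map_optionEquivLeft_iff]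
    exact hP D)
  refine ⟨S ∪ ((optionEquivLeft L ι).symm P).coeffs, fun {O κ} _ _ j ρ hj hjS => ?_⟩
  rw [Finset.coe_union, Set.union_subset_iff] at hjS
  obtain ⟨q, hq⟩ := mem_range_map_iff_coeffs_subset.2 hjS.2
  refine ⟨optionEquivLeft O ι q, ?_, ?_⟩
  · rw [map_map_optionEquivLeft, hq, AlgEquiv.apply_symm_apply]
  · rw [← irreducible_map_optionEquivLeft_iff, AlgEquiv.symm_apply_apply]
    exact hS j ρ hj hjS.1 _ hq

end MvPolynomial

theorem ValuationSubring.exists_center_eq {R E : Type*} [CommRing R] [Field E] (φ : R →+* E)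
    (p : Ideal R) [p.IsPrime] (hp : RingHom.ker φ ≤ p) :
    ∃ W : ValuationSubring E, (∀ r, φ r ∈ W) ∧ ∀ r, W.valuation (φ r) < 1 ↔ r ∈ p := by
  let f : Localization.AtPrime p →+* E := IsLocalization.lift (M := p.primeCompl) (g := φ)
    (fun y => IsUnit.mk0 _ fun h => y.2 (hp h))
  have hf : ∀ r, f (algebraMap R _ r) = φ r := fun r => IsLocalization.lift_eq _ r
  obtain ⟨W, hW, hloc⟩ := IsLocalRing.exists_factor_valuationRing f
  have hmem : ∀ r, φ r ∈ W := fun r => by rw [← hf]; exact hW _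
  refine ⟨W, hmem, fun r => ?_⟩
  have h1 : W.valuation (φ r) < 1 ↔ ¬ IsUnit (⟨φ r, hmem r⟩ : W) := by
    exact (W.valuation_lt_one_iff ⟨φ r, hmem r⟩).symm
  rw [h1]
  have h2 : IsUnit (⟨φ r, hmem r⟩ : W) ↔ IsUnit (algebraMap R (Localization.AtPrime p) r) := by
    rw [← isUnit_map_iff (f.codRestrict W.toSubring hW)]
    have : f.codRestrict W.toSubring hW (algebraMap R _ r) = ⟨φ r, hmem r⟩ := Subtype.ext (hf r)
    rw [this]
  rw [h2, IsLocalization.AtPrime.isUnit_to_map_iff _ p]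
  simp [Ideal.primeCompl]


open Polynomial in
theorem ValuationSubring.exists_extension_of_irreducible_map {O κ L E ι : Type*} [CommRing O]
    [Field κ] [Field L] [Field E] (i : O →+* L) (hi : Function.Injective i) (ρ : O →+* κ)
    (ε : MvPolynomial ι L →+* E) (θ : E) (P : (MvPolynomial ι O)[X]) (hP : P.Monic)
    (hker : ∀ f : (MvPolynomial ι L)[X], f.eval₂ ε θ = 0 → P.map (MvPolynomial.map i) ∣ f)
    (hirr : Irreducible (P.map (MvPolynomial.map ρ))) :
    ∃ W : ValuationSubring E,
      (∀ G : (MvPolynomial ι O)[X], G.eval₂ (ε.comp (MvPolynomial.map i)) θ ∈ W) ∧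
      (∀ G : (MvPolynomial ι O)[X], G.degree < P.degree → G.map (MvPolynomial.map ρ) ≠ 0 →
        W.valuation (G.eval₂ (ε.comp (MvPolynomial.map i)) θ) = 1) ∧
      ∀ c : O, ρ c = 0 → W.valuation (ε (MvPolynomial.C (i c))) < 1 := by
  have hjinj : Function.Injective (MvPolynomial.map (σ := ι) i) := MvPolynomial.map_injective _ hi
  let ev : (MvPolynomial ι O)[X] →+* E := eval₂RingHom (ε.comp (MvPolynomial.map i)) θ
  have hpp : (Ideal.span {P.map (MvPolynomial.map ρ)}).IsPrime :=
    (Ideal.span_singleton_prime hirr.ne_zero).2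
      (UniqueFactorizationMonoid.irreducible_iff_prime.1 hirr)
  let p : Ideal (MvPolynomial ι O)[X] :=
    (Ideal.span {P.map (MvPolynomial.map ρ)}).comap (mapRingHom (MvPolynomial.map ρ))
  have : p.IsPrime := Ideal.comap_isPrime _ _
  have hp : ∀ G, G ∈ p ↔ P.map (MvPolynomial.map ρ) ∣ G.map (MvPolynomial.map ρ) := fun G => by
    rw [Ideal.mem_comap, Ideal.mem_span_singleton, coe_mapRingHom]
  have hpk : RingHom.ker ev ≤ p := by
    intro G hG
    rw [hp]
    refine Polynomial.map_dvd _ ?_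
    rw [← modByMonic_eq_zero_iff_dvd hP]
    apply map_injective _ hjinj
    rw [map_modByMonic _ hP, Polynomial.map_zero, modByMonic_eq_zero_iff_dvd (hP.map _)]
    apply hker
    rw [eval₂_map]
    exact hG
  obtain ⟨W, hW1, hW2⟩ := exists_center_eq ev p hpk
  refine ⟨W, hW1, fun G hG hG0 => ?_, fun c hc => ?_⟩
  · refine le_antisymm ((W.valuation_le_one_iff _).2 (hW1 G)) (not_lt.1 fun h => ?_)
    have h1 := (hp G).1 ((hW2 G).1 h)
    refine hG0 (eq_zero_of_dvd_of_degree_lt h1 ?_)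
    rw [hP.degree_map]
    exact degree_map_le.trans_lt hG
  · have h1 : ev (C (MvPolynomial.C c)) = ε (MvPolynomial.C (i c)) := by
      simp [ev]
    rw [← h1, hW2, hp]
    simp [hc]

section

open Polynomial

theorem Valuation.exists_eq_C_mul_map {O κ L ι Γ₀ : Type*} [CommRing O] [Field κ] [Field L]
    [LinearOrderedCommGroupWithZero Γ₀] (v : Valuation L Γ₀) (j : O →+* L) (ρ : O →+* κ)
    (hj : ∀ c, v c ≤ 1 ↔ ∃ a, j a = c) (hρ : ∀ a, ρ a = 0 ↔ v (j a) < 1)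
    (G : (MvPolynomial ι L)[X]) (hG : G ≠ 0) :
    ∃ c : L, c ≠ 0 ∧ ∃ G₁ : (MvPolynomial ι O)[X],
      G = C (MvPolynomial.C c) * G₁.map (MvPolynomial.map j) ∧
      G₁.map (MvPolynomial.map ρ) ≠ 0 := by
  classical
  let T : Finset (ℕ × (ι →₀ ℕ)) := G.support.biUnion fun n => (G.coeff n).support.image (Prod.mk n)
  have hT : ∀ n m, (n, m) ∈ T ↔ (G.coeff n).coeff m ≠ 0 := by
    intro n m
    simp only [T, Finset.mem_biUnion, Finset.mem_image, MvPolynomial.mem_support_iff,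
      Polynomial.mem_support_iff, Prod.mk.injEq]
    constructor
    · rintro ⟨n', h1, m', h2, rfl, rfl⟩
      exact h2
    · intro h
      exact ⟨n, fun h0 => h (by simp [h0]), m, h, rfl, rfl⟩
  have hne : T.Nonempty := by
    obtain ⟨n, hn⟩ := Polynomial.support_nonempty.2 hG
    obtain ⟨m, hm⟩ := MvPolynomial.ne_zero_iff.1 (Polynomial.mem_support_iff.1 hn)
    exact ⟨(n, m), (hT n m).2 hm⟩
  obtain ⟨⟨n, m⟩, hmem, hmax⟩ := T.exists_max_image (fun p => v ((G.coeff p.1).coeff p.2)) hne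
  have hc := (hT n m).1 hmem
  set c := (G.coeff n).coeff m with hcdef
  have hle : ∀ n' m', v (c⁻¹ * (G.coeff n').coeff m') ≤ 1 := by
    intro n' m'
    by_cases h0 : (G.coeff n').coeff m' = 0
    · simp [h0]
    · have := hmax (n', m') ((hT _ _).2 h0)
      rw [map_mul, map_inv₀]
      exact (inv_mul_le_one₀ (zero_lt_iff.2 ((Valuation.ne_zero_iff v).2 hc))).2 this
  have hlift : C (MvPolynomial.C c⁻¹) * G ∈ Polynomial.lifts (MvPolynomial.map (σ := ι) j) := by
    rw [Polynomial.lifts_iff_coeff_lifts]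
    intro n'
    rw [Polynomial.coeff_C_mul]
    have : MvPolynomial.C c⁻¹ * G.coeff n' ∈ Set.range (MvPolynomial.map (σ := ι) j) := by
      rw [MvPolynomial.mem_range_map_iff_coeffs_subset]
      intro y hy
      obtain ⟨m', -, rfl⟩ := MvPolynomial.mem_coeffs_iff.1 hy
      rw [MvPolynomial.coeff_C_mul]
      exact (hj _).1 (hle n' m')
    exact this
  obtain ⟨G₁, hG₁⟩ := (Polynomial.mem_lifts _).1 hlift
  refine ⟨c, hc, G₁, ?_, ?_⟩
  · rw [hG₁, ← mul_assoc, ← Polynomial.C_mul, ← MvPolynomial.C_mul, mul_inv_cancel₀ hc]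
    simp
  · intro h0
    have h1 : ρ ((G₁.coeff n).coeff m) = 0 := by
      rw [← MvPolynomial.coeff_map, ← Polynomial.coeff_map, h0]; simp
    have h2 : j ((G₁.coeff n).coeff m) = 1 := by
      rw [← MvPolynomial.coeff_map, ← Polynomial.coeff_map, hG₁, Polynomial.coeff_C_mul,
        MvPolynomial.coeff_C_mul, ← hcdef, inv_mul_cancel₀ hc]
    rw [hρ, h2, map_one] at h1
    exact lt_irrefl _ h1

theorem ValuationSubring.exists_extension_of_irreducible {O κ L E ι Γ₀ : Type*} [CommRing O]
    [Field κ] [Field L] [Field E] [LinearOrderedCommGroupWithZero Γ₀] (v : Valuation L Γ₀)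
    (j : O →+* L) (hinj : Function.Injective j) (ρ : O →+* κ)
    (hj : ∀ c, v c ≤ 1 ↔ ∃ a, j a = c) (hρ : ∀ a, ρ a = 0 ↔ v (j a) < 1)
    (ε : MvPolynomial ι L →+* E) (hε : Function.Injective ε) (θ : E)
    (P : (MvPolynomial ι O)[X]) (hP : P.Monic)
    (hP0 : P.eval₂ (ε.comp (MvPolynomial.map j)) θ = 0)
    (hker : ∀ f : (MvPolynomial ι L)[X], f.eval₂ ε θ = 0 → P.map (MvPolynomial.map j) ∣ f)
    (hirr : Irreducible (P.map (MvPolynomial.map ρ)))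
    (q : ℕ) (hq0 : q ≠ 0) (hq : ∀ a : E, ∃ (G : (MvPolynomial ι L)[X]) (f : MvPolynomial ι L), f ≠ 0 ∧
      a ^ q * ε f = G.eval₂ ε θ) :
    ∃ W : ValuationSubring E,
      (∀ c, W.valuation (ε (MvPolynomial.C c)) ≤ 1 ↔ v c ≤ 1) ∧
      (∀ a, a ≠ 0 → ∃ c, c ≠ 0 ∧ W.valuation (a ^ q) = W.valuation (ε (MvPolynomial.C c))) ∧
      ∀ σ : E →+* E, (∀ f, σ (ε f) = ε f) → ∀ a, W.valuation a < 1 → W.valuation (σ a) < 1 := by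
  obtain ⟨W, hW1, hW2, hW3⟩ :=
    ValuationSubring.exists_extension_of_irreducible_map j hinj ρ ε θ P hP hker hirr
  have hle : ∀ c, v c ≤ 1 → W.valuation (ε (MvPolynomial.C c)) ≤ 1 := by
    intro c hc
    obtain ⟨a, rfl⟩ := (hj c).1 hc
    have := hW1 (C (MvPolynomial.C a))
    simpa [ValuationSubring.valuation_le_one_iff] using this
  have hlt : ∀ c, v c < 1 → W.valuation (ε (MvPolynomial.C c)) < 1 := by
    intro c hc
    obtain ⟨a, rfl⟩ := (hj c).1 hc.le
    exact hW3 a ((hρ a).2 hc)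
  have hiff : ∀ c, W.valuation (ε (MvPolynomial.C c)) ≤ 1 ↔ v c ≤ 1 := by
    refine fun c => ⟨fun h => ?_, hle c⟩
    by_contra hcv
    push Not at hcv
    have hc0 : c ≠ 0 := by rintro rfl; simp at hcv
    have h1 := hlt c⁻¹ (by rw [map_inv₀]; exact inv_lt_one_of_one_lt₀ hcv)
    have h2 : ε (MvPolynomial.C c) * ε (MvPolynomial.C c⁻¹) = 1 := by
      rw [← map_mul, ← MvPolynomial.C_mul, mul_inv_cancel₀ hc0]; simp
    have h3 : W.valuation (ε (MvPolynomial.C c)) * W.valuation (ε (MvPolynomial.C c⁻¹)) = 1 := by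
      rw [← map_mul, h2, map_one]
    exact absurd h3 (mul_lt_one_of_nonneg_of_lt_one_right h zero_le h1).ne
  have hdeg : P.natDegree ≠ 0 := by
    intro h
    have : P = 1 := hP.natDegree_eq_zero.1 h
    rw [this, Polynomial.map_one] at hirr
    exact hirr.not_isUnit isUnit_one
  have hO : Nontrivial O := ρ.domain_nontrivial
  have hdeg1 : (1 : (MvPolynomial ι O)[X]).degree < P.degree := by
    rw [Polynomial.degree_one]
    exact Polynomial.natDegree_pos_iff_degree_pos.1 (Nat.pos_of_ne_zero hdeg)
  have hPm : (P.map (MvPolynomial.map (σ := ι) j)).Monic := hP.map _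
  have key : ∀ a, a ≠ 0 → ∃ c, c ≠ 0 ∧ ∃ (G₁ : (MvPolynomial ι O)[X]) (g : MvPolynomial ι O),
      W.valuation (G₁.eval₂ (ε.comp (MvPolynomial.map j)) θ) = 1 ∧
      W.valuation (ε (MvPolynomial.map j g)) = 1 ∧
      a ^ q * ε (MvPolynomial.map j g) =
        ε (MvPolynomial.C c) * G₁.eval₂ (ε.comp (MvPolynomial.map j)) θ := by
    intro a ha
    obtain ⟨G, f, hf, hG⟩ := hq a
    set R := G %ₘ P.map (MvPolynomial.map j) with hR
    have hRG : G.eval₂ ε θ = R.eval₂ ε θ := by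
      conv_lhs => rw [← Polynomial.modByMonic_add_div G (P.map (MvPolynomial.map j))]
      rw [Polynomial.eval₂_add, Polynomial.eval₂_mul, Polynomial.eval₂_map, hP0]
      simp [hR]
    have hR0 : R ≠ 0 := by
      intro h
      rw [hRG, h, Polynomial.eval₂_zero] at hG
      exact mul_ne_zero (pow_ne_zero q ha) ((map_ne_zero_iff ε hε).2 hf) hG
    obtain ⟨c, hc, G₁, hG₁, hG₁0⟩ := v.exists_eq_C_mul_map j ρ hj hρ R hR0
    obtain ⟨e, he, f₁, hf₁, hf₁0⟩ :=
      v.exists_eq_C_mul_map j ρ hj hρ (C f) (Polynomial.C_ne_zero.2 hf)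
    have hmapinj : Function.Injective (MvPolynomial.map (σ := ι) j) :=
      MvPolynomial.map_injective _ hinj
    have hdegG : G₁.degree < P.degree := by
      have h1 : R.degree < (P.map (MvPolynomial.map j)).degree :=
        Polynomial.degree_modByMonic_lt _ hPm
      rw [hG₁, Polynomial.degree_C_mul (MvPolynomial.C_ne_zero.2 hc),
        Polynomial.degree_map_eq_of_injective hmapinj,
        Polynomial.degree_map_eq_of_injective hmapinj] at h1
      exact h1
    have hdegf : f₁.degree ≤ 0 := by
      have h1 : (C f).degree ≤ 0 := Polynomial.degree_C_le
      rwa [hf₁, Polynomial.degree_C_mul (MvPolynomial.C_ne_zero.2 he),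
        Polynomial.degree_map_eq_of_injective hmapinj] at h1
    have hfC := Polynomial.eq_C_of_degree_le_zero hdegf
    set g := f₁.coeff 0
    have hfg : f = MvPolynomial.C e * MvPolynomial.map j g := by
      have := congrArg (Polynomial.coeff · 0) hf₁
      simpa [hfC, Polynomial.coeff_C_mul, Polynomial.coeff_map] using this
    have hWe : W.valuation (ε (MvPolynomial.map j g)) = 1 := by
      have h1 := hW2 f₁ (hdegf.trans_lt (by simpa using hdeg1)) hf₁0
      rw [hfC] at h1
      simpa using h1
    have hee : ε (MvPolynomial.C e) ≠ 0 := (map_ne_zero_iff ε hε).2 (MvPolynomial.C_ne_zero.2 he)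
    refine ⟨c * e⁻¹, mul_ne_zero hc (inv_ne_zero he), G₁, g, hW2 G₁ hdegG hG₁0, hWe, ?_⟩
    have h5 : ε (MvPolynomial.C (c * e⁻¹)) * ε (MvPolynomial.C e) = ε (MvPolynomial.C c) := by
      rw [← map_mul, ← MvPolynomial.C_mul, inv_mul_cancel_right₀ he]
    apply mul_right_cancel₀ hee
    have h6 : R.eval₂ ε θ = ε (MvPolynomial.C c) * G₁.eval₂ (ε.comp (MvPolynomial.map j)) θ := by
      rw [hG₁, Polynomial.eval₂_mul, Polynomial.eval₂_C, Polynomial.eval₂_map]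
    rw [hRG, h6, hfg, map_mul] at hG
    calc _ = a ^ q * (ε (MvPolynomial.C e) * ε (MvPolynomial.map j g)) := by ring
      _ = _ := hG
      _ = _ := by rw [← h5]; ring
  have hroot_int : ∀ θ' : E, P.eval₂ (ε.comp (MvPolynomial.map j)) θ' = 0 → θ' ∈ W := by
    intro θ' h0
    let φ : MvPolynomial ι O →+* W := (ε.comp (MvPolynomial.map j)).codRestrict W.toSubring
      fun g => by simpa using hW1 (C g)
    have h1 : IsIntegral W θ' := by
      refine ⟨P.map φ, hP.map _, ?_⟩
      rw [Polynomial.eval₂_map]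
      exact h0
    obtain ⟨y, hy⟩ := IsIntegrallyClosed.isIntegral_iff.1 h1
    rw [← hy]
    exact y.2
  refine ⟨W, hiff, ?_, ?_⟩
  · intro a ha
    obtain ⟨c, hc, G₁, g, h1, h2, h3⟩ := key a ha
    refine ⟨c, hc, ?_⟩
    have := congrArg W.valuation h3
    rwa [map_mul, map_mul, h1, h2, mul_one, mul_one] at this
  · intro σ hσ a ha
    by_cases ha0 : a = 0
    · simp [ha0]
    obtain ⟨c, hc, G₁, g, h1, h2, h3⟩ := key a ha0
    have hcl : W.valuation (ε (MvPolynomial.C c)) < 1 := by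
      have := congrArg W.valuation h3
      rw [map_mul, map_mul, h1, h2, mul_one, mul_one, map_pow] at this
      rw [← this]
      exact pow_lt_one₀ zero_le ha hq0
    have hσθ : σ θ ∈ W := by
      refine hroot_int _ ?_
      have := congrArg σ hP0
      rw [Polynomial.hom_eval₂, map_zero] at this
      convert this using 2
      ext x <;> simp [hσ]
    have hmem : (G₁.eval₂ (ε.comp (MvPolynomial.map j)) (σ θ)) ∈ W := by
      rw [Polynomial.eval₂_eq_sum_range]
      refine sum_mem fun n _ => W.mul_mem _ _ ?_ (pow_mem hσθ n)
      simpa using hW1 (C (G₁.coeff n))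
    have h4 := congrArg (fun x => W.valuation (σ x)) h3
    have h5 : σ.comp (ε.comp (MvPolynomial.map j)) = ε.comp (MvPolynomial.map j) := by
      ext x <;> simp [hσ]
    simp only [map_mul, hσ, h2, mul_one, Polynomial.hom_eval₂, map_pow, h5] at h4
    have h6 : W.valuation (σ a) ^ q < 1 := by
      rw [h4]
      exact mul_lt_one_of_nonneg_of_lt_one_left zero_le hcl
        ((ValuationSubring.valuation_le_one_iff _ _).2 hmem)
    exact (pow_lt_one_iff hq0).1 h6

end

section

open Polynomial

theorem ValuationSubring.exists_finset_forall_exists_extension {L : Type u} {E : Type*}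
    {ι : Type v} [Finite ι] [Field L] [Field E]
    (ε : MvPolynomial ι L →+* E) (hε : Function.Injective ε) (θ : E)
    (P : (MvPolynomial ι L)[X]) (hP : P.Monic) (hP0 : P.eval₂ ε θ = 0)
    (hker : ∀ f : (MvPolynomial ι L)[X], f.eval₂ ε θ = 0 → P ∣ f)
    (hirr : ∀ (D : Type max u v) [Field D] [Algebra L D] [FiniteDimensional L D],
      Irreducible (P.map (MvPolynomial.map (algebraMap L D))))
    (q : ℕ) (hq0 : q ≠ 0) (hq : ∀ a : E, ∃ (G : (MvPolynomial ι L)[X]) (f : MvPolynomial ι L),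
      f ≠ 0 ∧ a ^ q * ε f = G.eval₂ ε θ) :
    ∃ S : Finset L, ∀ O : ValuationSubring L, (∀ s ∈ S, s ∈ O) → ∃ W : ValuationSubring E,
      (∀ c, W.valuation (ε (MvPolynomial.C c)) ≤ 1 ↔ O.valuation c ≤ 1) ∧
      (∀ a, a ≠ 0 → ∃ c, c ≠ 0 ∧ W.valuation (a ^ q) = W.valuation (ε (MvPolynomial.C c))) ∧
      ∀ σ : E →+* E, (∀ f, σ (ε f) = ε f) → ∀ a, W.valuation a < 1 → W.valuation (σ a) < 1 := by
  obtain ⟨S, hS⟩ := MvPolynomial.exists_finset_irreducible_polynomial_map P hirr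
  refine ⟨S, fun O hO => ?_⟩
  have hinj : Function.Injective O.subtype := Subtype.val_injective
  obtain ⟨P', hP', hirr'⟩ := hS O.subtype (IsLocalRing.residue O) hinj
    (fun s hs => ⟨⟨s, hO s hs⟩, rfl⟩)
  have hP'm : P'.Monic :=
    Polynomial.monic_of_injective (MvPolynomial.map_injective _ hinj) (by rwa [hP'])
  refine ValuationSubring.exists_extension_of_irreducible O.valuation O.subtype hinj
    (IsLocalRing.residue O) (fun c => ?_) (fun a => ?_) ε hε θ P' hP'm ?_ ?_ hirr' q hq0 hq
  · rw [ValuationSubring.valuation_le_one_iff]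
    exact ⟨fun h => ⟨⟨c, h⟩, rfl⟩, by rintro ⟨a, rfl⟩; exact a.2⟩
  · rw [IsLocalRing.residue_eq_zero_iff]
    exact (ValuationSubring.valuation_lt_one_iff O a)
  · rw [← Polynomial.eval₂_map, hP', hP0]
  · rwa [hP']

end

section

open Polynomial

theorem ValuationSubring.valuation_eq_one_iff_mem {K : Type*} [Field K] (O : ValuationSubring K)
    {x : K} (hx : x ≠ 0) : O.valuation x = 1 ↔ O.valuation x ≤ 1 ∧ O.valuation x⁻¹ ≤ 1 := by
  have h : 0 < O.valuation x := zero_lt_iff.2 ((Valuation.ne_zero_iff _).2 hx)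
  rw [map_inv₀, inv_le_one₀ h]
  exact ⟨fun h => by simp [h], fun h => le_antisymm h.1 h.2⟩

theorem ValuationSubring.valuation_lt_one_iff_inv {K : Type*} [Field K] (O : ValuationSubring K)
    {x : K} (hx : x ≠ 0) : O.valuation x < 1 ↔ ¬ O.valuation x⁻¹ ≤ 1 := by
  have h : 0 < O.valuation x := zero_lt_iff.2 ((Valuation.ne_zero_iff _).2 hx)
  rw [map_inv₀, inv_le_one₀ h, not_le]

section

variable {K E : Type*} [Field K] [Field E] {O : ValuationSubring K} {W : ValuationSubring E}
  {f : K →+* E}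

theorem ValuationSubring.valuation_map_eq_one_iff
    (h : ∀ c, W.valuation (f c) ≤ 1 ↔ O.valuation c ≤ 1) (x : K) :
    W.valuation (f x) = 1 ↔ O.valuation x = 1 := by
  by_cases hx : x = 0
  · simp [hx]
  · rw [valuation_eq_one_iff_mem _ hx, valuation_eq_one_iff_mem _ ((map_ne_zero f).2 hx),
      ← map_inv₀, h, h]

theorem ValuationSubring.valuation_map_lt_one_iff
    (h : ∀ c, W.valuation (f c) ≤ 1 ↔ O.valuation c ≤ 1) (x : K) :
    W.valuation (f x) < 1 ↔ O.valuation x < 1 := by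
  by_cases hx : x = 0
  · simp [hx]
  · rw [valuation_lt_one_iff_inv _ hx, valuation_lt_one_iff_inv _ ((map_ne_zero f).2 hx),
      ← map_inv₀, h]

end

/-- A class `{x, z}` is nonzero as soon as a valuation on `K(z^{1/ℓ})` extends, with the same
value group up to index prime to `ℓ`, a valuation of `L` whose value group is free modulo `ℓ` on
the values of `x`, and is stable under a nontrivial automorphism. -/
theorem milnorSymbol_snoc_ne_zero_of_extension {L K E : Type*} [Field L] [Field K] [Field E]
    {ℓ : ℕ} [hℓ : Fact ℓ.Prime] (iL : L →+* K) (iE : K →+* E) (O : ValuationSubring L)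
    (W : ValuationSubring E) (ξ : L) (hξ : IsPrimitiveRoot ξ ℓ) (hξ1 : O.valuation (ξ - 1) = 1)
    (h3 : ∃ y : Kˣ, y ^ ℓ = -1)
    (hA : ∀ c, W.valuation ((iE.comp iL) c) ≤ 1 ↔ O.valuation c ≤ 1)
    (q : ℕ) (hqℓ : ℓ.Coprime q)
    (hB : ∀ a, a ≠ 0 → ∃ c, c ≠ 0 ∧ W.valuation (a ^ q) = W.valuation (iE (iL c)))
    (σ : E →+* E) (hσ : ∀ a, σ (iE a) = iE a)
    (hC : ∀ a, W.valuation a < 1 → W.valuation (σ a) < 1)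
    (z : Kˣ) (w : E) (hw : w ^ ℓ = iE z) (hσw : σ w = iE (iL ξ) * w)
    {r : ℕ} (x : Fin r → Lˣ)
    (hx : ∀ (e : Fin r → ℤ) (c b : Lˣ), O.valuation (c : L) = 1 →
      ∏ i, x i ^ e i = c * b ^ ℓ → ∀ i, (ℓ : ℤ) ∣ e i) :
    milnorSymbol ℓ (Fin.snoc (fun i => Units.map (iL : L →* K) (x i)) z) ≠ 0 := by
  have hℓ0 : ℓ ≠ 0 := hℓ.out.ne_zero
  set jE : L →+* E := iE.comp iL with hjE
  have hAeq := ValuationSubring.valuation_map_eq_one_iff (f := jE) hA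
  have key : ∀ (e : Fin r → ℤ) (c b : Eˣ), W.valuation (c : E) = 1 →
      Units.map (jE : L →* E) (∏ i, x i ^ e i) = c * b ^ ℓ → ∀ i, (ℓ : ℤ) ∣ e i := by
    intro e c b hc h i
    obtain ⟨b', hb', hbb'⟩ := hB b b.ne_zero
    have h1 : Units.map (jE : L →* E) (∏ i, x i ^ (e i * q)) = c ^ q * (b ^ q) ^ ℓ := by
      have : ∏ i, x i ^ (e i * q) = (∏ i, x i ^ e i) ^ q := by
        rw [← Finset.prod_pow]
        exact Finset.prod_congr rfl fun i _ => by rw [zpow_mul, zpow_natCast]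
      rw [this, map_pow, h, mul_pow, ← pow_mul, ← pow_mul, mul_comm ℓ q]
    have h2 := hx (fun i => e i * q) ((∏ i, x i ^ (e i * q)) * ((Units.mk0 b' hb') ^ ℓ)⁻¹)
      (Units.mk0 b' hb') ?_ (by simp) i
    · exact (Int.isCoprime_iff_gcd_eq_one.2 (by simpa using hqℓ)).dvd_of_dvd_mul_right h2
    · rw [← hAeq]
      have h4 : jE ((∏ i, x i ^ (e i * q) : Lˣ) : L) = (c : E) ^ q * ((b : E) ^ q) ^ ℓ := by
        have := congrArg Units.val h1
        simpa using this
      have h5 : W.valuation (jE b') ≠ 0 := by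
        rw [Valuation.ne_zero_iff]; exact (map_ne_zero jE).2 hb'
      rw [Units.val_mul, map_mul, map_mul, h4]
      simp only [map_mul, map_pow, hc, one_pow, one_mul, Units.val_inv_eq_inv_val, map_inv₀,
        Units.val_pow_eq_pow_val, Units.val_mk0]
      rw [map_pow] at hbb'
      rw [hbb']
      exact mul_inv_cancel₀ (pow_ne_zero _ h5)
  have hV : ∀ c, W.valuation (iE c) ≤ 1 ↔ (W.comap iE).valuation c ≤ 1 := by
    intro c
    rw [ValuationSubring.valuation_le_one_iff, ValuationSubring.valuation_le_one_iff]
    exact ValuationSubring.mem_comap.symm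
  have hVeq := ValuationSubring.valuation_map_eq_one_iff (f := iE) hV
  have hVlt := ValuationSubring.valuation_map_lt_one_iff (f := iE) hV
  have hprod : ∀ e : Fin r → ℤ, Units.map (iE : K →* E) (∏ i, Units.map (iL : L →* K) (x i) ^ e i) =
      Units.map (jE : L →* E) (∏ i, x i ^ e i) := by
    intro e
    rw [map_prod, map_prod]
    refine Finset.prod_congr rfl fun i _ => ?_
    rw [map_zpow, map_zpow]
    rfl
  refine milnorSymbol_snoc_ne_zero_of_valuationSubring (W.comap iE) _ z ?_ ?_ h3
  · intro e c b hc h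
    refine key e (Units.map (iE : K →* E) c) (Units.map (iE : K →* E) b) ((hVeq c).2 hc) ?_
    rw [← hprod, h, map_mul, map_pow]
  · intro e m b hm h
    have hw0 : w ≠ 0 := by
      rintro rfl
      rw [zero_pow hℓ0] at hw
      exact (map_ne_zero iE).2 z.ne_zero hw.symm
    have hmE : W.valuation (iE m - 1) < 1 := by
      have := (hVlt ((m : K) - 1)).2 hm
      rwa [map_sub, map_one] at this
    have hm1 : W.valuation (iE m) = 1 := by
      have h1 : W.valuation (iE m - 1) < W.valuation (1 : E) := by rwa [map_one]
      have := Valuation.map_add_eq_of_lt_left W.valuation h1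
      simpa using this
    set mE : Eˣ := Units.map (iE : K →* E) m with hmEdef
    set bE : Eˣ := Units.map (iE : K →* E) b with hbEdef
    have hwu : (Units.mk0 w hw0) ^ ℓ =
        Units.map (jE : L →* E) (∏ i, x i ^ e i) * mE * bE ^ ℓ := by
      rw [← hprod, hmEdef, hbEdef, ← map_pow, ← map_mul, ← map_mul, ← h]
      ext
      simpa using hw
    have hdvd := key e mE⁻¹ (Units.mk0 w hw0 * bE⁻¹) (by simp [hmEdef, hm1]) (by
      rw [mul_pow, hwu, inv_pow]
      rw [mul_inv_cancel_right, mul_comm _ mE, inv_mul_cancel_left])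
    choose f hf using hdvd
    set g : Lˣ := ∏ i, x i ^ f i with hg
    have hgp : ∏ i, x i ^ e i = g ^ ℓ := by
      rw [hg, ← Finset.prod_pow]
      refine Finset.prod_congr rfl fun i _ => ?_
      rw [hf i, mul_comm, zpow_mul, zpow_natCast]
    set w' : Eˣ := Units.mk0 w hw0 * (Units.map (jE : L →* E) g * bE)⁻¹ with hw'
    have hw'pow : (w' : E) ^ ℓ = iE m := by
      have : w' ^ ℓ = mE := by
        rw [hw', mul_pow, hwu, hgp, map_pow, inv_pow, mul_pow]
        rw [mul_inv_eq_iff_eq_mul, mul_comm _ mE, mul_assoc]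
      have := congrArg Units.val this
      simpa [hmEdef] using this
    have hσw' : σ w' = jE ξ * w' := by
      simp only [hw', Units.val_mul, Units.val_mk0, Units.val_inv_eq_inv_val, map_mul, hσw,
        map_inv₀, hbEdef, Units.coe_map, hjE]
      simp [hσ, mul_assoc]
    have hξE : IsPrimitiveRoot (jE ξ) ℓ := hξ.map_of_injective jE.injective
    have hξv : W.valuation (jE ξ) = 1 := by
      have : W.valuation (jE ξ) ^ ℓ = 1 := by rw [← map_pow, hξE.pow_eq_one, map_one]
      exact (pow_eq_one_iff_of_nonneg zero_le hℓ0).1 this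
    have hfac : ∏ ζ ∈ Polynomial.nthRootsFinset ℓ (1 : E), ((w' : E) - ζ) = iE m - 1 := by
      have := congrArg (Polynomial.eval (w' : E)) (X_pow_sub_one_eq_prod hℓ.out.pos hξE)
      rw [Polynomial.eval_prod] at this
      simpa [hw'pow] using this.symm
    obtain ⟨ζ, hζ, hζlt⟩ : ∃ ζ ∈ Polynomial.nthRootsFinset ℓ (1 : E),
        W.valuation ((w' : E) - ζ) < 1 := by
      by_contra! hcon
      have h1 : 1 ≤ W.valuation (iE m - 1) := by
        rw [← hfac, map_prod]
        exact Finset.one_le_prod' hcon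
      exact absurd hmE h1.not_gt
    rw [Polynomial.mem_nthRootsFinset hℓ.out.pos] at hζ
    obtain ⟨n, -, rfl⟩ := hξE.eq_pow_of_pow_eq_one hζ
    have h1 := hC _ hζlt
    have hσξ : σ (jE ξ) = jE ξ := hσ _
    rw [map_sub, hσw', map_pow, hσξ] at h1
    have h2 : W.valuation (jE ξ * ((w' : E) - jE ξ ^ n)) < 1 := by
      rw [map_mul, hξv, one_mul]; exact hζlt
    have h3 := Valuation.map_sub_lt W.valuation h1 h2
    have h4 : jE ξ * (w' : E) - jE ξ ^ n - jE ξ * ((w' : E) - jE ξ ^ n) =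
        jE ξ ^ n * jE (ξ - 1) := by
      rw [map_sub, map_one]; ring
    rw [h4, map_mul, map_pow, hξv, one_pow, one_mul, (hAeq _).2 hξ1] at h3
    exact lt_irrefl _ h3

end

namespace HahnSeries

variable {k : Type*} [Field k] {r : ℕ}

/-- The monomials as a multiplicative homomorphism. -/
def singleHom (Γ k : Type*) [AddCommGroup Γ] [LinearOrder Γ] [IsOrderedAddMonoid Γ] [Field k] :
    Multiplicative Γ →* HahnSeries Γ k where
  toFun g := single g.toAdd 1
  map_one' := rfl
  map_mul' a b := by simp [single_mul_single]

/-- The embedding of polynomials in lexicographic Hahn series. -/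
def ofMvPolynomialLex (k : Type*) [Field k] (r : ℕ) :
    MvPolynomial (Fin r) k →+* HahnSeries (Lex (Fin r → ℤ)) k :=
  MvPolynomial.eval₂Hom C fun i => single (toLex (Pi.single i 1)) 1

theorem prod_single_zpow (e : Fin r → ℤ) :
    ∏ i, (single (toLex (Pi.single i 1 : Fin r → ℤ)) (1 : k)) ^ e i = single (toLex e) 1 := by
  have h : ∀ g : Lex (Fin r → ℤ), single g (1 : k) =
    singleHom (Lex (Fin r → ℤ)) k (Multiplicative.ofAdd g) := fun _ => rfl
  simp only [h]
  simp only [← map_zpow, ← map_prod]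
  congr 1
  apply Multiplicative.toAdd.injective
  rw [toAdd_prod]
  simp only [toAdd_zpow, toAdd_ofAdd]
  change (∑ i, e i • (Pi.single i 1 : Fin r → ℤ)) = e
  ext j
  simp [Finset.sum_apply, Pi.single_apply]

theorem ofMvPolynomialLex_monomial (m : Fin r →₀ ℕ) (c : k) :
    ofMvPolynomialLex k r (MvPolynomial.monomial m c) = single (toLex fun i => (m i : ℤ)) c := by
  rw [ofMvPolynomialLex, MvPolynomial.coe_eval₂Hom, MvPolynomial.eval₂_monomial,
    Finsupp.prod_fintype _ _ (fun i => pow_zero _)]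
  have := prod_single_zpow (k := k) (fun i => (m i : ℤ))
  simp only [zpow_natCast] at this
  rw [this, C_apply, single_mul_single, zero_add, mul_one]

theorem ofMvPolynomialLex_injective : Function.Injective (ofMvPolynomialLex k r) := by
  classical
  rw [injective_iff_map_eq_zero]
  intro f hf
  ext m
  have h : ∀ f : MvPolynomial (Fin r) k,
      (ofMvPolynomialLex k r f).coeff (toLex fun i => (m i : ℤ)) = f.coeff m := by
    intro f
    induction f using MvPolynomial.induction_on' with
    | monomial u a =>
      rw [ofMvPolynomialLex_monomial, coeff_single, MvPolynomial.coeff_monomial]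
      congr 1
      simp only [toLex_inj, eq_iff_iff, funext_iff, Nat.cast_inj]
      rw [Finsupp.ext_iff]
      exact ⟨fun h i => (h i).symm, fun h i => (h i).symm⟩
    | add p q hp hq => simp [hp, hq]
  rw [← h, hf]
  simp

end HahnSeries

/-- An extension of a valuation along a field embedding. -/
theorem Valuation.exists_valuationSubring_extension {F L Γ₀ : Type*} [Field F] [Field L]
    [LinearOrderedCommGroupWithZero Γ₀] (v : Valuation F Γ₀) (α : F →+* L) :
    ∃ W : ValuationSubring L, (∀ c, W.valuation (α c) ≤ 1 ↔ v c ≤ 1) ∧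
      (∀ c, W.valuation (α c) = 1 ↔ v c = 1) ∧ ∀ c, W.valuation (α c) < 1 ↔ v c < 1 := by
  have hV : ∀ c, v.valuationSubring.valuation c ≤ 1 ↔ v c ≤ 1 := fun c => by
    rw [ValuationSubring.valuation_le_one_iff]; rfl
  have hpos : ∀ c : F, c ≠ 0 → 0 < v c := fun c hc => zero_lt_iff.2 ((Valuation.ne_zero_iff v).2 hc)
  have hV1 : ∀ c, v.valuationSubring.valuation c = 1 ↔ v c = 1 := fun c => by
    by_cases hc : c = 0
    · simp [hc]
    · rw [ValuationSubring.valuation_eq_one_iff_mem _ hc, hV, hV, map_inv₀, inv_le_one₀ (hpos c hc)]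
      exact ⟨fun h => le_antisymm h.1 h.2, fun h => by simp [h]⟩
  have hV2 : ∀ c, v.valuationSubring.valuation c < 1 ↔ v c < 1 := fun c => by
    rw [lt_iff_le_and_ne, lt_iff_le_and_ne, hV, ne_eq, hV1]
  obtain ⟨W, hW1, hW2⟩ := ValuationSubring.exists_center_eq
    (α.comp v.valuationSubring.subtype) (IsLocalRing.maximalIdeal v.valuationSubring) (by
      have hinj : Function.Injective (α.comp v.valuationSubring.subtype) :=
        fun a b hab => Subtype.ext (α.injective hab)
      rw [(RingHom.injective_iff_ker_eq_bot _).1 hinj]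
      exact bot_le)
  have hle : ∀ c, W.valuation (α c) ≤ 1 ↔ v.valuationSubring.valuation c ≤ 1 := by
    have h1 : ∀ c, v.valuationSubring.valuation c ≤ 1 → W.valuation (α c) ≤ 1 := fun c hc =>
      (W.valuation_le_one_iff _).2 (hW1 ⟨c, (ValuationSubring.valuation_le_one_iff _ _).1 hc⟩)
    refine fun c => ⟨fun h => ?_, h1 c⟩
    by_contra hcv
    have hc : c ≠ 0 := by rintro rfl; simp at hcv
    have h2 : v.valuationSubring.valuation c⁻¹ < 1 := by
      rw [ValuationSubring.valuation_lt_one_iff_inv _ (inv_ne_zero hc), inv_inv]; exact hcv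
    have hmem : c⁻¹ ∈ v.valuationSubring := (ValuationSubring.valuation_le_one_iff _ _).1 h2.le
    have h3 := (hW2 ⟨c⁻¹, hmem⟩).2
      ((ValuationSubring.valuation_lt_one_iff _ (⟨c⁻¹, hmem⟩ : v.valuationSubring)).2 h2)
    have h4 : W.valuation (α c⁻¹) < 1 := h3
    rw [map_inv₀, ValuationSubring.valuation_lt_one_iff_inv _
      (inv_ne_zero ((map_ne_zero α).2 hc)), inv_inv] at h4
    exact h4 h
  exact ⟨W, fun c => by rw [hle, hV],
    fun c => by rw [ValuationSubring.valuation_map_eq_one_iff hle, hV1],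
    fun c => by rw [ValuationSubring.valuation_map_lt_one_iff hle, hV2]⟩

/-- A valuation with value group of rational rank `r` centred at the origin of `k[y₁, …, yᵣ]`. -/
theorem AlgebraicIndependent.exists_valuationSubring {k L : Type*} [Field k] [Field L] [Algebra k L]
    {r : ℕ} {y : Fin r → L} (hy : AlgebraicIndependent k y) :
    ∃ W : ValuationSubring L, (∀ c : k, c ≠ 0 → W.valuation (algebraMap k L c) = 1) ∧
      (∀ i, W.valuation (y i) < 1) ∧
      (∀ f : MvPolynomial (Fin r) k, f ≠ 0 → ∃ m : Fin r → ℤ,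
        W.valuation (MvPolynomial.aeval y f) = W.valuation (∏ i, y i ^ m i)) ∧
      ∀ e : Fin r → ℤ, W.valuation (∏ i, y i ^ e i) = 1 → e = 0 := by
  let B := MvPolynomial (Fin r) k
  let F := FractionRing B
  let H := HahnSeries (Lex (Fin r → ℤ)) k
  let α : F →+* L := IsFractionRing.lift (A := B) (K := F) (g := (MvPolynomial.aeval y).toRingHom) hy
  let β : F →+* H := IsFractionRing.lift (A := B) (K := F) HahnSeries.ofMvPolynomialLex_injective
  have hα : ∀ f : B, α (algebraMap B F f) = MvPolynomial.aeval y f :=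
    fun f => IsFractionRing.lift_algebraMap _ f
  have hβ : ∀ f : B, β (algebraMap B F f) = HahnSeries.ofMvPolynomialLex k r f :=
    fun f => IsFractionRing.lift_algebraMap _ f
  let v : Valuation F (Multiplicative (WithTop (Lex (Fin r → ℤ)))ᵒᵈ) :=
    Valuation.comap β (AddValuation.toValuation (HahnSeries.addVal (Lex (Fin r → ℤ)) k))
  have hv : ∀ c, v c = Multiplicative.ofAdd (OrderDual.toDual (β c).orderTop) := fun c => rfl
  have hv1 : ∀ c, v c = 1 ↔ (β c).orderTop = 0 := fun c => Iff.rfl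
  have hv2 : ∀ c, v c < 1 ↔ 0 < (β c).orderTop := fun c => Iff.rfl
  obtain ⟨W, -, hW1, hW2⟩ := v.exists_valuationSubring_extension α
  let X : Fin r → F := fun i => algebraMap B F (MvPolynomial.X i)
  have hβX : ∀ i, β (X i) = HahnSeries.single (toLex (Pi.single i 1)) 1 := by
    intro i
    simp [X, hβ, HahnSeries.ofMvPolynomialLex]
  have hαX : ∀ i, α (X i) = y i := by
    intro i
    simp [X, hα]
  have hβp : ∀ e : Fin r → ℤ, β (∏ i, X i ^ e i) = HahnSeries.single (toLex e) 1 := by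
    intro e
    rw [map_prod, ← HahnSeries.prod_single_zpow]
    simp only [map_zpow₀, hβX]
  have hαp : ∀ e : Fin r → ℤ, α (∏ i, X i ^ e i) = ∏ i, y i ^ e i := by
    intro e
    simp [map_prod, map_zpow₀, hαX]
  refine ⟨W, ?_, ?_, ?_, ?_⟩
  · intro c hc
    have : algebraMap k L c = α (algebraMap B F (MvPolynomial.C c)) := by simp [hα]
    rw [this, hW1, hv1, hβ]
    simp [HahnSeries.ofMvPolynomialLex, hc, HahnSeries.C_apply]
  · intro i
    rw [← hαX, hW2, hv2, hβX, HahnSeries.orderTop_single one_ne_zero]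
    rw [← WithTop.coe_zero, WithTop.coe_lt_coe]
    exact Pi.lt_toLex_update_self_iff.2 (zero_lt_one' ℤ)
  · intro f hf
    have hf0 : algebraMap B F f ≠ 0 := by simpa using hf
    have hβ0 : β (algebraMap B F f) ≠ 0 := (map_ne_zero β).2 hf0
    refine ⟨ofLex (β (algebraMap B F f)).order, ?_⟩
    set m := ofLex (β (algebraMap B F f)).order with hm
    have hX0 : ∏ i, X i ^ m i ≠ 0 := by
      intro h
      have := hβp m
      rw [h, map_zero] at this
      exact HahnSeries.single_ne_zero one_ne_zero this.symm
    have h1 : v (algebraMap B F f) = v (∏ i, X i ^ m i) := by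
      rw [hv, hv, hβp, HahnSeries.orderTop_single one_ne_zero, hm, toLex_ofLex,
        HahnSeries.order_eq_orderTop_of_ne_zero hβ0]
    have h2 : v (algebraMap B F f / ∏ i, X i ^ m i) = 1 := by
      rw [map_div₀, h1, div_self]
      exact (Valuation.ne_zero_iff v).2 hX0
    rw [← hW1, map_div₀, map_div₀, hα, hαp] at h2
    exact (div_eq_one_iff_eq (fun h => by simp [h] at h2)).1 h2
  · intro e he
    rw [← hαp, hW1, hv1, hβp, HahnSeries.orderTop_single one_ne_zero, ← WithTop.coe_zero,
      WithTop.coe_inj] at he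
    exact toLex_inj.1 he

section

open Polynomial

/-- If a fixed multiple of a torsion-free abelian group lies in the span of `r` independent
elements, there are `r` elements independent modulo every integer `ℓ`. -/
theorem exists_forall_dvd_of_smul_mem_span {M : Type*} [AddCommGroup M] [IsAddTorsionFree M]
    {r : ℕ} {y : Fin r → M} (hy : LinearIndependent ℤ y) {N : ℕ} (hN : N ≠ 0)
    (h : ∀ g : M, N • g ∈ Submodule.span ℤ (Set.range y)) :
    ∃ x : Fin r → M, ∀ (ℓ : ℕ) (e : Fin r → ℤ) (b : M), ∑ i, e i • x i = ℓ • b →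
      ∀ i, (ℓ : ℤ) ∣ e i := by
  let f : M →ₗ[ℤ] Submodule.span ℤ (Set.range y) :=
    ((N : ℤ) • LinearMap.id).codRestrict _ fun g => by simpa using h g
  have hf : Function.Injective f := by
    intro a b hab
    have : (N : ℤ) • a = (N : ℤ) • b := congrArg Subtype.val hab
    exact smul_right_injective M (by exact_mod_cast hN : (N : ℤ) ≠ 0) this
  have : Module.Finite ℤ (Submodule.span ℤ (Set.range y)) :=
    Module.Finite.span_of_finite ℤ (Set.finite_range y)
  have : Module.Finite ℤ M := Module.Finite.of_injective f hf
  let bs := Module.finBasis ℤ M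
  have hr : r ≤ Module.finrank ℤ M := by simpa using hy.fintype_card_le_finrank
  refine ⟨fun i => bs (Fin.castLE hr i), fun ℓ e b hb i => ⟨bs.repr b (Fin.castLE hr i), ?_⟩⟩
  have := congrArg (fun g => bs.repr g (Fin.castLE hr i)) hb
  simpa [map_sum, Finsupp.finsetSum_apply, Finsupp.single_apply] using this

theorem Valuation.exists_ne_of_sum_eq_zero {R Γ₀ ι : Type*} [Ring R]
    [LinearOrderedCommGroupWithZero Γ₀] (v : Valuation R Γ₀) (s : Finset ι) (f : ι → R)
    (hs : s.Nonempty) (hf : ∀ i ∈ s, v (f i) ≠ 0) (h : ∑ i ∈ s, f i = 0) :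
    ∃ i ∈ s, ∃ j ∈ s, i ≠ j ∧ v (f i) = v (f j) := by
  classical
  obtain ⟨j, hj, hmax⟩ := s.exists_max_image (fun i => v (f i)) hs
  by_contra! hcon
  have := v.map_sum_eq_of_lt (f := f) hj fun i hi => by
    simp only [Finset.mem_sdiff, Finset.mem_singleton] at hi
    exact lt_of_le_of_ne (hmax i hi.1) (hcon i hi.1 j hj hi.2)
  rw [h, map_zero] at this
  exact hf j hj this.symm

theorem ValuationSubring.mem_of_eval₂_eq_zero {B L : Type*} [CommRing B] [Field L]
    (W : ValuationSubring L) (φ : B →+* L) (hφ : ∀ b, φ b ∈ W) (p : B[X]) (a : L)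
    (hp : W.valuation (φ p.leadingCoeff) = 1) (h : p.eval₂ φ a = 0) : a ∈ W := by
  have h0 : φ p.leadingCoeff ≠ 0 := fun h => by simp [h] at hp
  have hinv : (φ p.leadingCoeff)⁻¹ ∈ W := by
    rw [← ValuationSubring.valuation_le_one_iff, map_inv₀, hp, inv_one]
  let φ' : B →+* W := φ.codRestrict W.toSubring hφ
  have h1 : IsIntegral W a := by
    refine ⟨C ⟨_, hinv⟩ * p.map φ', Polynomial.monic_C_mul_of_mul_leadingCoeff_eq_one ?_, ?_⟩
    · rw [Polynomial.leadingCoeff_map_of_leadingCoeff_ne_zero]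
      · exact Subtype.ext (inv_mul_cancel₀ h0)
      · exact fun h => h0 (congrArg Subtype.val h)
    · rw [Polynomial.eval₂_mul, Polynomial.eval₂_map]
      have : p.eval₂ ((algebraMap W L).comp φ') a = 0 := h
      rw [this, mul_zero]
  obtain ⟨y, hy⟩ := IsIntegrallyClosed.isIntegral_iff.1 h1
  rw [← hy]
  exact y.2

theorem exists_valuationSubring_of_degree_bound {k L : Type*} [Field k] [Infinite k] [Field L]
    [Algebra k L] {r : ℕ} {t : Fin r → L} (ht : AlgebraicIndependent k t) (n : ℕ)
    (hn : ∀ a : L, ∃ p : (MvPolynomial (Fin r) k)[X], p ≠ 0 ∧ p.natDegree ≤ n ∧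
      p.eval₂ (MvPolynomial.aeval (R := k) t).toRingHom a = 0) (S : Finset L) :
    ∃ O : ValuationSubring L, (∀ c : k, c ≠ 0 → O.valuation (algebraMap k L c) = 1) ∧
      (∀ s ∈ S, s ∈ O) ∧ ∃ x : Fin r → Lˣ, ∀ (ℓ : ℕ) (e : Fin r → ℤ) (c b : Lˣ),
        O.valuation (c : L) = 1 → ∏ i, x i ^ e i = c * b ^ ℓ → ∀ i, (ℓ : ℤ) ∣ e i := by
  choose p hp0 hpn hp using hn
  obtain ⟨c, hc⟩ : ∃ c : Fin r → k, MvPolynomial.eval c (∏ a ∈ S, (p a).leadingCoeff) ≠ 0 := by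
    by_contra! hcon
    have : ∏ a ∈ S, (p a).leadingCoeff = 0 := MvPolynomial.funext fun c => by simp [hcon c]
    obtain ⟨a, -, ha⟩ := Finset.prod_eq_zero_iff.1 this
    exact hp0 a (Polynomial.leadingCoeff_eq_zero.1 ha)
  rw [map_prod, Finset.prod_ne_zero_iff] at hc
  let y : Fin r → L := fun i => t i - algebraMap k L (c i)
  let τ : MvPolynomial (Fin r) k →ₐ[k] MvPolynomial (Fin r) k :=
    MvPolynomial.aeval fun i => MvPolynomial.X i + MvPolynomial.C (c i)
  let τ' : MvPolynomial (Fin r) k →ₐ[k] MvPolynomial (Fin r) k :=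
    MvPolynomial.aeval fun i => MvPolynomial.X i - MvPolynomial.C (c i)
  have hτ : ∀ f, MvPolynomial.aeval y (τ f) = MvPolynomial.aeval t f := by
    have : (MvPolynomial.aeval y).comp τ = MvPolynomial.aeval t := by
      apply MvPolynomial.algHom_ext
      intro i
      simp [τ, y]
    exact fun f => DFunLike.congr_fun this f
  have hτ' : ∀ f, MvPolynomial.aeval t (τ' f) = MvPolynomial.aeval y f := by
    have : (MvPolynomial.aeval t).comp τ' = MvPolynomial.aeval y := by
      apply MvPolynomial.algHom_ext
      intro i
      simp [τ', y]
    exact fun f => DFunLike.congr_fun this f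
  have hττ : ∀ f, τ (τ' f) = f := by
    have : τ.comp τ' = AlgHom.id k _ := by
      apply MvPolynomial.algHom_ext
      intro i
      simp [τ, τ']
    exact fun f => DFunLike.congr_fun this f
  have hy : AlgebraicIndependent k y := by
    intro f g hfg
    simp only [← hτ'] at hfg
    have := congrArg τ (ht hfg)
    rwa [hττ, hττ] at this
  obtain ⟨W, hW1, hW2, hW3, hW4⟩ := hy.exists_valuationSubring
  have hk : ∀ c : k, W.valuation (algebraMap k L c) ≤ 1 := fun c => by
    by_cases h : c = 0
    · simp [h]
    · exact (hW1 c h).le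
  have hty : ∀ i, W.valuation (t i) ≤ 1 := fun i => by
    have : t i = y i + algebraMap k L (c i) := by simp [y]
    rw [this]
    exact (W.valuation.map_add _ _).trans (max_le (hW2 i).le (hk _))
  have hcong : ∀ f : MvPolynomial (Fin r) k, W.valuation (MvPolynomial.aeval t f -
      algebraMap k L (MvPolynomial.eval c f)) < 1 := by
    intro f
    induction f using MvPolynomial.induction_on with
    | C a => simp
    | add f g hf hg =>
      rw [map_add, map_add, map_add, add_sub_add_comm]
      exact W.valuation.map_add_lt hf hg
    | mul_X f i hf =>
      have : MvPolynomial.aeval t (f * MvPolynomial.X i) -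
          algebraMap k L (MvPolynomial.eval c (f * MvPolynomial.X i)) =
          (MvPolynomial.aeval t f - algebraMap k L (MvPolynomial.eval c f)) * t i +
          algebraMap k L (MvPolynomial.eval c f) * y i := by
        simp [y]; ring
      rw [this]
      refine W.valuation.map_add_lt ?_ ?_
      · rw [map_mul]
        exact mul_lt_one_of_nonneg_of_lt_one_left zero_le hf (hty i)
      · rw [map_mul]
        exact mul_lt_one_of_nonneg_of_lt_one_right (hk _) zero_le (hW2 i)
  have hmem : ∀ f : MvPolynomial (Fin r) k, MvPolynomial.aeval t f ∈ W := by
    intro f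
    rw [← ValuationSubring.valuation_le_one_iff]
    have := W.valuation.map_add (MvPolynomial.aeval t f - algebraMap k L (MvPolynomial.eval c f))
      (algebraMap k L (MvPolynomial.eval c f))
    rw [sub_add_cancel] at this
    exact this.trans (max_le (hcong f).le (hk _))
  have hunit : ∀ f : MvPolynomial (Fin r) k, MvPolynomial.eval c f ≠ 0 →
      W.valuation (MvPolynomial.aeval t f) = 1 := by
    intro f hf
    have := W.valuation.map_add_eq_of_lt_left ((hcong f).trans_eq (hW1 _ hf).symm)
    rwa [add_sub_cancel, hW1 _ hf] at this
  refine ⟨W, hW1, ?_, ?_⟩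
  · intro s hs
    exact W.mem_of_eval₂_eq_zero _ hmem (p s) s (hunit _ (hc s hs)) (hp s)
  let ν : Additive Lˣ →+ Additive (W.ValueGroup)ˣ :=
    MonoidHom.toAdditive (Units.map (W.valuation : L →* W.ValueGroup))
  have hν : ∀ a b : Lˣ, ν (Additive.ofMul a) = ν (Additive.ofMul b) ↔
      W.valuation (a : L) = W.valuation (b : L) := by
    intro a b
    exact Units.ext_iff
  have hν0 : ∀ a : Lˣ, ν (Additive.ofMul a) = 0 ↔ W.valuation (a : L) = 1 := by
    intro a
    exact Units.ext_iff
  have hνs : Function.Surjective ν := by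
    intro g
    obtain ⟨a, ha⟩ := W.valuation_surjective (g.toMul : W.ValueGroup)
    have ha0 : a ≠ 0 := by rintro rfl; exact g.toMul.ne_zero (by rw [← ha, map_zero])
    exact ⟨Additive.ofMul (Units.mk0 a ha0), Units.ext ha⟩
  have hνp : ∀ (x : Fin r → Lˣ) (e : Fin r → ℤ), ν (Additive.ofMul (∏ i, x i ^ e i)) =
      ∑ i, e i • ν (Additive.ofMul (x i)) := by
    intro x e
    rw [ofMul_prod, map_sum]
    simp only [ofMul_zpow, map_zsmul]
  have hy0 : ∀ i, y i ≠ 0 := fun i => hy.ne_zero i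
  let yu : Fin r → Lˣ := fun i => Units.mk0 (y i) (hy0 i)
  have hyu : ∀ m : Fin r → ℤ, ((∏ i, yu i ^ m i : Lˣ) : L) = ∏ i, y i ^ m i := by
    intro m; simp [yu]
  obtain ⟨x, hx⟩ := exists_forall_dvd_of_smul_mem_span (M := Additive (W.ValueGroup)ˣ)
    (y := fun i => ν (Additive.ofMul (yu i))) (by
      rw [Fintype.linearIndependent_iff]
      intro g hg i
      rw [← hνp, hν0, hyu] at hg
      rw [hW4 g hg]; rfl) (Nat.factorial_ne_zero n) (by
      intro g
      obtain ⟨a, rfl⟩ := hνs g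
      have hspan : ∀ f : MvPolynomial (Fin r) k, f ≠ 0 → ∃ u : Lˣ, (u : L) = MvPolynomial.aeval t f ∧
          ν (Additive.ofMul u) ∈
            Submodule.span ℤ (Set.range fun i => ν (Additive.ofMul (yu i))) := by
        intro f hf
        have hf0 : MvPolynomial.aeval t f ≠ 0 := (map_ne_zero_iff _ ht).2 hf
        refine ⟨Units.mk0 _ hf0, rfl, ?_⟩
        have hτf : τ f ≠ 0 := by
          rintro h
          apply hf0
          rw [← hτ, h, map_zero]
        obtain ⟨m, hm⟩ := hW3 _ hτf
        rw [hτ] at hm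
        have : ν (Additive.ofMul (Units.mk0 _ hf0)) = ν (Additive.ofMul (∏ i, yu i ^ m i)) := by
          rw [hν, hyu]; exact hm
        rw [this, hνp]
        exact Submodule.sum_mem _ fun i _ =>
          Submodule.smul_mem _ _ (Submodule.subset_span ⟨i, rfl⟩)
      have hpa := hp (a.toMul : L)
      set P := p (a.toMul : L) with hP
      have hP0 : P ≠ 0 := hp0 _
      rw [Polynomial.eval₂_eq_sum, Polynomial.sum] at hpa
      obtain ⟨i, hi, j, hj, hij, hval⟩ := W.valuation.exists_ne_of_sum_eq_zero _ _
        (Polynomial.support_nonempty.2 hP0) (fun i hi => by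
          rw [Valuation.ne_zero_iff]
          refine mul_ne_zero ((map_ne_zero_iff _ ht).2 (Polynomial.mem_support_iff.1 hi))
            (pow_ne_zero _ a.toMul.ne_zero)) hpa
      have hlt : ∀ i ∈ P.support, ∀ j ∈ P.support, i < j →
          W.valuation (MvPolynomial.aeval t (P.coeff i) * (a.toMul : L) ^ i) =
            W.valuation (MvPolynomial.aeval t (P.coeff j) * (a.toMul : L) ^ j) →
          n.factorial • ν a ∈ Submodule.span ℤ (Set.range fun i => ν (Additive.ofMul (yu i))) := by
        intro i hi j hj hij hval
        obtain ⟨u, hu, hus⟩ := hspan _ (Polynomial.mem_support_iff.1 hi)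
        obtain ⟨w, hw, hws⟩ := hspan _ (Polynomial.mem_support_iff.1 hj)
        have h1 : ν (Additive.ofMul (u * a.toMul ^ i)) = ν (Additive.ofMul (w * a.toMul ^ j)) := by
          rw [hν]
          simpa [hu, hw] using hval
        simp only [ofMul_mul, ofMul_pow, map_add, map_nsmul, ofMul_toMul] at h1
        obtain ⟨d, rfl⟩ := Nat.exists_eq_add_of_lt hij
        have h2 : (d + 1) • ν a = ν (Additive.ofMul u) - ν (Additive.ofMul w) := by
          rw [add_assoc, add_nsmul, add_comm (i • ν a), ← add_assoc] at h1
          rw [eq_sub_iff_add_eq', add_right_cancel h1]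
        have h3 : d + 1 ∣ n.factorial := Nat.dvd_factorial (Nat.succ_pos d)
          (by have := (Polynomial.le_natDegree_of_mem_supp _ hj).trans (hpn (a.toMul : L)); omega)
        obtain ⟨e, he⟩ := h3
        rw [he, mul_comm, mul_nsmul', h2]
        exact Submodule.smul_of_tower_mem _ e (Submodule.sub_mem _ hus hws)
      rcases lt_or_gt_of_ne hij with h | h
      · exact hlt i hi j hj h hval
      · exact hlt j hj i hi h hval.symm)
  choose a ha using fun i => hνs (x i)
  refine ⟨fun i => (a i).toMul, fun ℓ e c b hc h i => ?_⟩
  refine hx ℓ e (ν (Additive.ofMul b)) ?_ i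
  have h1 := congrArg (fun u => ν (Additive.ofMul u)) h
  simp only [hνp, ofMul_mul, ofMul_pow, map_add, map_nsmul, (hν0 c).2 hc, zero_add] at h1
  rw [← h1]
  exact Finset.sum_congr rfl fun i _ => by rw [← ha i]; rfl

end

section

open Polynomial

/-- A polynomial irreducible over `L` and with a root separable over `L` stays irreducible over
an extension in which `L` is algebraically closed. -/
theorem minpoly.map_eq_of_integrallyClosedIn {L E Ω : Type*} [Field L] [Field E] [Field Ω]
    [Algebra L E] [Algebra E Ω] [Algebra L Ω] [IsScalarTower L E Ω]
    (hL : ∀ x : E, IsAlgebraic L x → x ∈ (algebraMap L E).range) {δ : Ω} (hδ : IsIntegral L δ) :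
    (minpoly L δ).map (algebraMap L E) = minpoly E δ := by
  have h1 : minpoly E δ ∣ (minpoly L δ).map (algebraMap L E) := minpoly.dvd_map_of_isScalarTower _ _ _
  have hm : (minpoly E δ).Monic := minpoly.monic hδ.tower_top
  have h2 := integralClosure.mem_lifts_of_monic_of_dvd_map (R := L) E (minpoly.monic hδ) hm h1
  obtain ⟨g, hg⟩ : ∃ g : L[X], g.map (algebraMap L E) = minpoly E δ := by
    rw [← mem_lifts, lifts_iff_coeff_lifts]
    intro n
    rw [lifts_iff_coeff_lifts] at h2
    obtain ⟨y, hy⟩ := h2 n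
    have := hL _ (y.2.isAlgebraic)
    change (y : E) = _ at hy
    rw [hy] at this
    exact this
  have hg0 : Polynomial.aeval δ g = 0 := by
    have := minpoly.aeval E δ
    rwa [← hg, aeval_map_algebraMap] at this
  rw [← hg]
  congr 1
  have hgm : g.Monic := by
    rw [← hg] at hm
    exact (monic_map_iff).1 hm
  refine (minpoly.unique' L δ hgm hg0 ?_).symm
  intro q hq
  rw [or_iff_not_imp_left]
  intro h0 h3
  have : minpoly E δ ∣ q.map (algebraMap L E) := minpoly.dvd _ _ (by rwa [aeval_map_algebraMap])
  have := natDegree_le_of_dvd this (by simpa using h0)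
  rw [← hg, natDegree_map, natDegree_map] at this
  exact absurd (natDegree_lt_natDegree h0 hq) (by omega)

theorem exists_sum_basis_of_mvPolynomial {L D ι κ : Type*} [Fintype κ] [Field L] [Field D]
    [Algebra L D] (b : κ → D) (hb : ∀ d : D, ∃ c : κ → L, d = ∑ i, algebraMap L D (c i) * b i)
    (G : (MvPolynomial ι D)[X]) :
    ∃ g : κ → (MvPolynomial ι L)[X],
      G = ∑ i, (g i).map (MvPolynomial.map (algebraMap L D)) * C (MvPolynomial.C (b i)) := by
  induction G using Polynomial.induction_on' with
  | add p q hp hq =>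
    obtain ⟨g, rfl⟩ := hp
    obtain ⟨h, rfl⟩ := hq
    exact ⟨fun i => g i + h i, by simp [add_mul, Finset.sum_add_distrib]⟩
  | monomial n a =>
    have : ∃ g : κ → MvPolynomial ι L,
        a = ∑ i, MvPolynomial.map (algebraMap L D) (g i) * MvPolynomial.C (b i) := by
      induction a using MvPolynomial.induction_on' with
      | monomial m d =>
        obtain ⟨c, rfl⟩ := hb d
        exact ⟨fun i => MvPolynomial.monomial m (c i), by
          simp [map_sum, mul_comm _ (MvPolynomial.C _), MvPolynomial.C_mul_monomial,
            mul_comm (b _)]⟩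
      | add p q hp hq =>
        obtain ⟨g, rfl⟩ := hp
        obtain ⟨h, rfl⟩ := hq
        exact ⟨fun i => g i + h i, by simp [add_mul, Finset.sum_add_distrib]⟩
    obtain ⟨g, rfl⟩ := this
    exact ⟨fun i => monomial n (g i), by simp [monomial_mul_C]⟩

/-- A kernel generated by one polynomial stays so after a scalar extension which is
linearly disjoint from the target. -/
theorem map_dvd_of_eval₂_eq_zero {L D E Ω ι κ : Type*} [Fintype κ] [Field L] [Field D] [Field E]
    [Field Ω] [Algebra L D] (f : E →+* Ω) (g : D →+* Ω) (ε : MvPolynomial ι L →+* E)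
    (hfg : ∀ c, f (ε (MvPolynomial.C c)) = g (algebraMap L D c)) (θ : E)
    (P : (MvPolynomial ι L)[X]) (hker : ∀ f : (MvPolynomial ι L)[X], f.eval₂ ε θ = 0 → P ∣ f)
    (b : κ → D) (hb : ∀ d : D, ∃ c : κ → L, d = ∑ i, algebraMap L D (c i) * b i)
    (hlin : ∀ e : κ → E, ∑ i, f (e i) * g (b i) = 0 → ∀ i, e i = 0) (G : (MvPolynomial ι D)[X])
    (hG : G.eval₂ (MvPolynomial.eval₂Hom g fun i => f (ε (MvPolynomial.X i))) (f θ) = 0) :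
    P.map (MvPolynomial.map (algebraMap L D)) ∣ G := by
  obtain ⟨h, rfl⟩ := exists_sum_basis_of_mvPolynomial b hb G
  have hcomp : (MvPolynomial.eval₂Hom g fun i => f (ε (MvPolynomial.X i))).comp
      (MvPolynomial.map (algebraMap L D)) = f.comp ε := by
    ext <;> simp [hfg]
  rw [eval₂_finsetSum] at hG
  simp only [eval₂_mul, eval₂_map, hcomp, eval₂_C, MvPolynomial.coe_eval₂Hom,
    MvPolynomial.eval₂_C, ← hom_eval₂] at hG
  refine Finset.dvd_sum fun i _ => Dvd.dvd.mul_right ?_ _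
  exact Polynomial.map_dvd _ (hker _ (hlin _ hG i))

theorem Polynomial.prime_of_eval₂_eq_zero {A Ω : Type*} [CommRing A] [IsDomain A] [Field Ω]
    (φ : A →+* Ω) (θ : Ω) (P : A[X]) (hP0 : P ≠ 0) (hP : P.eval₂ φ θ = 0)
    (hker : ∀ f : A[X], f.eval₂ φ θ = 0 → P ∣ f) : Prime P := by
  have : RingHom.ker (eval₂RingHom φ θ) = Ideal.span {P} := by
    ext f
    rw [RingHom.mem_ker, Ideal.mem_span_singleton]
    refine ⟨fun h => hker f h, ?_⟩
    rintro ⟨g, rfl⟩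
    simp [hP]
  rw [← Ideal.span_singleton_prime hP0, ← this]
  exact RingHom.ker_isPrime _


theorem Polynomial.exists_pow_mem_range_map {A B : Type*} [CommRing A] [CommRing B] (f : A →+* B)
    (p : ℕ) [ExpChar B p] (n : ℕ) (h : ∀ b : B, b ^ p ^ n ∈ f.range) (G : B[X]) :
    ∃ H : A[X], H.map f = G ^ p ^ n := by
  induction G using Polynomial.induction_on' with
  | add x y hx hy =>
    obtain ⟨g, hg⟩ := hx
    obtain ⟨h, hh⟩ := hy
    exact ⟨g + h, by rw [Polynomial.map_add, hg, hh, add_pow_expChar_pow]⟩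
  | monomial m b =>
    obtain ⟨a, ha⟩ := h b
    exact ⟨monomial (m * p ^ n) a, by rw [map_monomial, monomial_pow, ha]⟩

theorem MvPolynomial.pow_mem_range_map {ι A B : Type*} [CommRing A] [CommRing B] (f : A →+* B)
    (p : ℕ) [ExpChar B p] (n : ℕ) (h : ∀ b : B, b ^ p ^ n ∈ f.range) (G : MvPolynomial ι B) :
    G ^ p ^ n ∈ (MvPolynomial.map (σ := ι) f).range := by
  induction G using MvPolynomial.induction_on' with
  | add x y hx hy =>
    rw [add_pow_expChar_pow]
    exact add_mem hx hy
  | monomial m b =>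
    obtain ⟨a, ha⟩ := h b
    exact ⟨MvPolynomial.monomial (p ^ n • m) a, by
      rw [MvPolynomial.map_monomial, MvPolynomial.monomial_pow, ha]⟩

/-- A monic prime polynomial that is separable over the fraction field stays irreducible under
purely inseparable extensions of the coefficients. -/
theorem Polynomial.irreducible_map_of_pow_mem_range {A B : Type*} [CommRing A] [IsDomain A]
    [CommRing B] [IsDomain B] (f : A →+* B) (hf : Function.Injective f)
    (p : ℕ) [ExpChar B p] (n : ℕ) (h : ∀ b : B, b ^ p ^ n ∈ f.range) (P : A[X]) (hP : P.Monic)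
    (hP1 : Prime P) (u v : A[X]) (c : A) (hc : c ≠ 0) (huv : u * P + v * derivative P = C c) :
    Irreducible (P.map f) := by
  have key : ∀ G H : B[X], G.Monic → H.Monic → P.map f = G * H →
      P.map f ∣ G ^ p ^ n → H = 1 := by
    intro G H hG hH hGH hd
    have h1 : H ∣ G ^ p ^ n := (Dvd.intro_left G hGH.symm).trans hd
    have h2 : u.map f * (G * H) + v.map f * (derivative G * H + G * derivative H) = C (f c) := by
      have := congrArg (Polynomial.map f) huv
      simp only [Polynomial.map_add, Polynomial.map_mul, map_C] at this
      rw [← this, ← derivative_map, hGH, derivative_mul]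
    have h3 : ∃ w, C (f c) - G * w ∈ Ideal.span {H} := by
      refine ⟨v.map f * derivative H, Ideal.mem_span_singleton.2 ⟨u.map f * G + v.map f * derivative G, ?_⟩⟩
      rw [← h2]; ring
    obtain ⟨w, hw⟩ := h3
    have h4 : H ∣ C (f c) ^ p ^ n := by
      rw [Ideal.mem_span_singleton] at hw
      have := sub_dvd_pow_sub_pow (C (f c)) (G * w) (p ^ n)
      have h5 := hw.trans this
      have h6 : H ∣ (G * w) ^ p ^ n := by rw [mul_pow]; exact h1.mul_right _
      simpa using dvd_add h5 h6
    have h7 : f c ≠ 0 := by simpa using (map_ne_zero_iff f hf).2 hc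
    rw [← C_pow] at h4
    have h8 := natDegree_le_of_dvd h4 (C_ne_zero.2 (pow_ne_zero _ h7))
    rw [natDegree_C] at h8
    exact (Polynomial.Monic.natDegree_eq_zero hH).1 (by omega)
  have hPm : (P.map f).Monic := hP.map f
  have hP2 : P.map f ≠ 1 := by
    intro h1
    have : P = 1 := map_injective f hf (by simpa using h1)
    exact hP1.not_isUnit (this ▸ isUnit_one)
  rw [irreducible_of_monic hPm hP2]
  · intro G H hG hH hGH
    obtain ⟨g, hg⟩ := exists_pow_mem_range_map f p n h G
    obtain ⟨k, hk⟩ := exists_pow_mem_range_map f p n h H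
    have : P ∣ g * k := by
      have : P ^ p ^ n = g * k := map_injective f hf (by
        rw [Polynomial.map_pow, Polynomial.map_mul, hg, hk, ← hGH, mul_pow])
      rw [← this]
      exact dvd_pow_self _ (pow_ne_zero _ (expChar_ne_zero B p))
    rcases hP1.dvd_or_dvd this with h1 | h1
    · exact Or.inr (key G H hG hH hGH.symm (hg ▸ Polynomial.map_dvd f h1))
    · exact Or.inl (key H G hH hG (by rw [← hGH, mul_comm]) (hk ▸ Polynomial.map_dvd f h1))

theorem prime_map_of_eval₂_eq_zero {L D E Ω ι κ : Type*} [Fintype κ] [Field L] [Field D] [Field E]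
    [Field Ω] [Algebra L D] (f : E →+* Ω) (g : D →+* Ω) (ε : MvPolynomial ι L →+* E)
    (hfg : ∀ c, f (ε (MvPolynomial.C c)) = g (algebraMap L D c)) (θ : E)
    (P : (MvPolynomial ι L)[X]) (hP : P.Monic) (hP0 : P.eval₂ ε θ = 0)
    (hker : ∀ f : (MvPolynomial ι L)[X], f.eval₂ ε θ = 0 → P ∣ f)
    (b : κ → D) (hb : ∀ d : D, ∃ c : κ → L, d = ∑ i, algebraMap L D (c i) * b i)
    (hlin : ∀ e : κ → E, ∑ i, f (e i) * g (b i) = 0 → ∀ i, e i = 0) :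
    Prime (P.map (MvPolynomial.map (σ := ι) (algebraMap L D))) := by
  refine prime_of_eval₂_eq_zero
    (MvPolynomial.eval₂Hom g fun i => f (ε (MvPolynomial.X i)))
    (f θ) _ (hP.map _).ne_zero ?_ ?_
  · have hcomp : (MvPolynomial.eval₂Hom g fun i => f (ε (MvPolynomial.X i))).comp
        (MvPolynomial.map (algebraMap L D)) = f.comp ε := by
      ext <;> simp [hfg]
    rw [eval₂_map, hcomp, ← hom_eval₂, hP0, map_zero]
  · exact map_dvd_of_eval₂_eq_zero f g ε hfg θ P hker b hb hlin

theorem exists_linearIndependent_pow_of_isSeparable (L E F Ω : Type*) [Field L] [Field E]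
    [Field F] [Field Ω] [Algebra L E] [Algebra L F] [FiniteDimensional L F]
    [Algebra.IsSeparable L F] [Algebra E Ω] [Algebra L Ω] [IsScalarTower L E Ω]
    (hL : ∀ x : E, IsAlgebraic L x → x ∈ (algebraMap L E).range) (g : F →ₐ[L] Ω) :
    ∃ (n : ℕ) (b : Fin n → F),
      (∀ d : F, ∃ c : Fin n → L, d = ∑ i, algebraMap L F (c i) * b i) ∧
      ∀ e : Fin n → E, ∑ i, algebraMap E Ω (e i) * (g : F →+* Ω) (b i) = 0 → ∀ i, e i = 0 := by
  let pb := Field.powerBasisOfFiniteOfSeparable L F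
  let δ : Ω := g pb.gen
  have hδ : IsIntegral L δ := (IsIntegral.of_finite L pb.gen).map g
  have hmin : minpoly L δ = minpoly L pb.gen := minpoly.algHom_eq g g.injective _
  have hdeg : (minpoly E δ).natDegree = pb.dim := by
    rw [← minpoly.map_eq_of_integrallyClosedIn hL hδ, natDegree_map, hmin, pb.natDegree_minpoly]
  refine ⟨pb.dim, fun i => pb.gen ^ (i : ℕ), fun d => ⟨fun i => pb.basis.repr d i, ?_⟩, ?_⟩
  · conv_lhs => rw [← pb.basis.sum_repr d]
    exact Finset.sum_congr rfl fun i _ => by rw [Algebra.smul_def, pb.basis_eq_pow]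
  · have := linearIndependent_pow (K := E) δ
    rw [hdeg, Fintype.linearIndependent_iff] at this
    intro e he
    apply this
    rw [← he]
    exact Finset.sum_congr rfl fun i _ => by simp [Algebra.smul_def, δ]

/-- A monic polynomial cutting out the generic point of a separable extension of a rational
function field in which the constants are algebraically closed is absolutely irreducible. -/
theorem Polynomial.irreducible_map_mvPolynomial_of_finite {L E ι D : Type*} [Field L] [Field E]
    [Algebra L E] (hL : ∀ x : E, IsAlgebraic L x → x ∈ (algebraMap L E).range)
    (ε : MvPolynomial ι L →ₐ[L] E) (θ : E) (P : (MvPolynomial ι L)[X])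
    (hP : P.Monic) (hP0 : P.eval₂ (ε : MvPolynomial ι L →+* E) θ = 0)
    (hker : ∀ f : (MvPolynomial ι L)[X], f.eval₂ (ε : MvPolynomial ι L →+* E) θ = 0 → P ∣ f)
    (u v : (MvPolynomial ι L)[X]) (c : MvPolynomial ι L) (hc : c ≠ 0)
    (huv : u * P + v * derivative P = C c) [Field D] [Algebra L D] [FiniteDimensional L D] :
    Irreducible (P.map (MvPolynomial.map (σ := ι) (algebraMap L D))) := by
  let F := separableClosure L D
  let g : F →ₐ[L] AlgebraicClosure E := IsAlgClosed.lift
  obtain ⟨m, b, hb, hlin⟩ :=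
    exists_linearIndependent_pow_of_isSeparable L E F (AlgebraicClosure E) hL g
  have hεC : ∀ a : L, algebraMap E (AlgebraicClosure E) ((ε : MvPolynomial ι L →+* E)
      (MvPolynomial.C a)) = (g : F →+* AlgebraicClosure E) (algebraMap L F a) := by
    intro a
    rw [← MvPolynomial.algebraMap_eq, RingHom.coe_coe, ε.commutes, ← IsScalarTower.algebraMap_apply]
    exact (g.commutes a).symm
  have hprime : Prime (P.map (MvPolynomial.map (σ := ι) (algebraMap L F))) :=
    prime_map_of_eval₂_eq_zero _ _ _ hεC θ P hP hP0 hker b hb hlin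
  obtain ⟨p, hp⟩ := ExpChar.exists D
  have : ExpChar F p := (algebraMap F D).expChar (algebraMap F D).injective p
  obtain ⟨n, hn⟩ : ∃ n : ℕ, ∀ d : D, d ^ p ^ n ∈ (algebraMap F D).range :=
    (IsPurelyInseparable.hasExponent_iff' F D p).1 inferInstance
  have h1 := irreducible_map_of_pow_mem_range (MvPolynomial.map (σ := ι) (algebraMap F D))
    (MvPolynomial.map_injective _ (algebraMap F D).injective) p n
    (MvPolynomial.pow_mem_range_map (algebraMap F D) p n hn)
    (P.map (MvPolynomial.map (σ := ι) (algebraMap L F))) (hP.map _) hprime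
    (u.map (MvPolynomial.map (σ := ι) (algebraMap L F)))
    (v.map (MvPolynomial.map (σ := ι) (algebraMap L F)))
    (MvPolynomial.map (algebraMap L F) c)
    ((map_ne_zero_iff _ (MvPolynomial.map_injective _ (algebraMap L F).injective)).2 hc)
    (by rw [derivative_map, ← Polynomial.map_mul, ← Polynomial.map_mul, ← Polynomial.map_add, huv,
      map_C])
  rw [Polynomial.map_map] at h1
  have h2 : MvPolynomial.map (σ := ι) (algebraMap L D) =
      (MvPolynomial.map (algebraMap F D)).comp (MvPolynomial.map (algebraMap L F)) := by
    apply MvPolynomial.ringHom_ext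
    · intro a
      rw [RingHom.comp_apply, MvPolynomial.map_C, MvPolynomial.map_C, MvPolynomial.map_C]
      rfl
    · simp
  rwa [h2]

end

section

open Polynomial

theorem exists_integral_primitive_element (A Q E : Type*) [CommRing A] [IsDomain A]
    [IsIntegrallyClosed A] [Field Q] [Field E] [Algebra A Q] [IsFractionRing A Q] [Algebra Q E]
    [Algebra A E] [IsScalarTower A Q E] [FiniteDimensional Q E] (p : ℕ) [ExpChar E p] :
    ∃ (θ : E) (P u v : A[X]) (c : A) (n : ℕ), P.Monic ∧ P.eval₂ (algebraMap A E) θ = 0 ∧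
      (∀ f : A[X], f.eval₂ (algebraMap A E) θ = 0 → P ∣ f) ∧ c ≠ 0 ∧
      u * P + v * derivative P = C c ∧
      ∀ a : E, ∃ (G : A[X]) (f : A), f ≠ 0 ∧
        a ^ p ^ n * algebraMap A E f = G.eval₂ (algebraMap A E) θ := by
  let F := separableClosure Q E
  obtain ⟨θ₀, hθ₀⟩ := Field.exists_primitive_element Q F
  have hQ : ∀ s : Q[X], ∃ (b : A) (t : A[X]), b ≠ 0 ∧
      t.map (algebraMap A Q) = C (algebraMap A Q b) * s := by
    intro s
    obtain ⟨b, hb0, hb⟩ := IsLocalization.integerNormalization_spec (nonZeroDivisors A) s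
    exact ⟨b, _, nonZeroDivisors.ne_zero hb0, by rw [hb, ← algebraMap_smul Q b s, smul_eq_C_mul]⟩
  have hinj : Function.Injective (algebraMap A E) := by
    rw [IsScalarTower.algebraMap_eq A Q E]
    exact (algebraMap Q E).injective.comp (IsFractionRing.injective A Q)
  have : FaithfulSMul A E := (faithfulSMul_iff_algebraMap_injective A E).2 hinj
  obtain ⟨a, ha, hθi⟩ : ∃ a : A, a ≠ 0 ∧ IsIntegral A (algebraMap A E a * (θ₀ : E)) := by
    have h1 : IsAlgebraic A (θ₀ : E) := (IsFractionRing.isAlgebraic_iff A Q E).2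
      (IsAlgebraic.of_finite Q _)
    obtain ⟨a, ha, h⟩ := h1.exists_integral_multiple
    exact ⟨a, ha, by rwa [Algebra.smul_def] at h⟩
  have haQ : algebraMap A Q a ≠ 0 := by simpa using ha
  have haE : algebraMap A E a ≠ 0 := by simpa using ha
  set θ : E := algebraMap A E a * (θ₀ : E) with hθ
  have hP : (minpoly A θ).map (algebraMap A Q) = minpoly Q θ :=
    (minpoly.isIntegrallyClosed_eq_field_fractions Q E hθi).symm
  have hθF : θ ∈ F := by
    rw [hθ, IsScalarTower.algebraMap_apply A Q E]
    exact F.mul_mem (F.algebraMap_mem _) θ₀.2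
  have hsep : (minpoly Q θ).Separable := mem_separableClosure_iff.1 hθF
  obtain ⟨s, t, hst⟩ := hsep
  obtain ⟨b, u, hb, hu⟩ := hQ s
  obtain ⟨b', v, hb', hv⟩ := hQ t
  have hpi := (IsPurelyInseparable.hasExponent_iff' F E p).1 inferInstance
  obtain ⟨n, hn⟩ := hpi
  refine ⟨θ, minpoly A θ, C b' * u, C b * v, b * b', n, minpoly.monic hθi, minpoly.aeval A θ,
    fun f hf => minpoly.isIntegrallyClosed_dvd hθi hf, mul_ne_zero hb hb', ?_, ?_⟩
  · apply Polynomial.map_injective _ (IsFractionRing.injective A Q)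
    simp only [Polynomial.map_add, Polynomial.map_mul, map_C, ← derivative_map, hP, hu, hv,
      map_mul]
    linear_combination (C (algebraMap A Q b) * C (algebraMap A Q b')) * hst
  · intro x
    obtain ⟨y, hy⟩ := hn x
    have hy2 : y ∈ IntermediateField.adjoin Q {θ₀} := hθ₀ ▸ IntermediateField.mem_top
    obtain ⟨g, hg⟩ : ∃ g : Q[X], aeval (θ₀ : E) g = (y : E) := by
      rw [← IntermediateField.mem_toSubalgebra, IntermediateField.adjoin_simple_toSubalgebra_of_isAlgebraic
        (IsAlgebraic.of_finite Q _), Algebra.adjoin_singleton_eq_range_aeval] at hy2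
      obtain ⟨g, hg⟩ := hy2
      refine ⟨g, ?_⟩
      rw [← hg]
      exact aeval_algHom_apply F.val θ₀ g
    have hg' : aeval θ (g.comp (C (algebraMap A Q a)⁻¹ * X)) = (y : E) := by
      rw [aeval_comp, ← hg]
      congr 1
      simp only [map_mul, aeval_C, aeval_X, map_inv₀, ← IsScalarTower.algebraMap_apply, hθ]
      field_simp
    obtain ⟨f, G, hf, hG⟩ := hQ (g.comp (C (algebraMap A Q a)⁻¹ * X))
    refine ⟨G, f, hf, ?_⟩
    have h3 := congrArg (aeval θ) hG
    rw [map_mul, hg', aeval_C, aeval_map_algebraMap, ← IsScalarTower.algebraMap_apply, aeval_def] at h3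
    rw [h3, ← hy, mul_comm]
    rfl

theorem IsTranscendenceBasis.finiteDimensional_fractionRing {L E ι : Type*} [Field L] [Field E]
    [Algebra L E] [Algebra.EssFiniteType L E] {t : ι → E} (ht : IsTranscendenceBasis L t)
    (Q : Type*) [Field Q] [Algebra (MvPolynomial ι L) Q] [IsFractionRing (MvPolynomial ι L) Q]
    [Algebra (MvPolynomial ι L) E] [Algebra Q E] [IsScalarTower (MvPolynomial ι L) Q E]
    (hAE : algebraMap (MvPolynomial ι L) E = (MvPolynomial.aeval t : _ →ₐ[L] E).toRingHom) :
    FiniteDimensional Q E := by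
  let : Algebra L Q := ((algebraMap (MvPolynomial ι L) Q).comp MvPolynomial.C).toAlgebra
  have : IsScalarTower L Q E := .of_algebraMap_eq' (by
    rw [RingHom.algebraMap_toAlgebra, ← RingHom.comp_assoc, ← IsScalarTower.algebraMap_eq, hAE]
    ext; simp)
  have : Algebra.IsAlgebraic (MvPolynomial ι L) E := by
    have h := ht.isAlgebraic
    refine ⟨fun x => ?_⟩
    obtain ⟨g, hg0, hg⟩ := h.isAlgebraic x
    let e := ht.1.aevalEquiv
    refine ⟨g.map (e.symm : _ →+* MvPolynomial ι L), ?_, ?_⟩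
    · exact (Polynomial.map_ne_zero_iff e.symm.injective).2 hg0
    · rw [aeval_def, eval₂_map, ← hg, aeval_def]
      congr 1
      ext y
      obtain ⟨y, rfl⟩ := e.surjective y
      simp [e, hAE]
  have : Algebra.IsAlgebraic Q E := (IsFractionRing.comap_isAlgebraic_iff (A := MvPolynomial ι L)).1 this
  have : Algebra.EssFiniteType Q E := Algebra.EssFiniteType.of_comp L Q E
  exact Algebra.finite_of_essFiniteType_of_isAlgebraic

theorem IsTranscendenceBasis.exists_integral_primitive_element {L E ι : Type*} [Field L] [Field E]
    [Algebra L E] [Algebra.EssFiniteType L E] {t : ι → E} (ht : IsTranscendenceBasis L t)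
    (p : ℕ) [ExpChar E p] :
    ∃ (θ : E) (P u v : (MvPolynomial ι L)[X]) (c : MvPolynomial ι L) (n : ℕ), P.Monic ∧
      P.eval₂ (MvPolynomial.aeval t : MvPolynomial ι L →ₐ[L] E).toRingHom θ = 0 ∧
      (∀ f : (MvPolynomial ι L)[X],
        f.eval₂ (MvPolynomial.aeval t : MvPolynomial ι L →ₐ[L] E).toRingHom θ = 0 → P ∣ f) ∧
      c ≠ 0 ∧ u * P + v * derivative P = C c ∧
      ∀ a : E, ∃ (G : (MvPolynomial ι L)[X]) (f : MvPolynomial ι L), f ≠ 0 ∧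
        a ^ p ^ n * (MvPolynomial.aeval t : MvPolynomial ι L →ₐ[L] E).toRingHom f =
          G.eval₂ (MvPolynomial.aeval t : MvPolynomial ι L →ₐ[L] E).toRingHom θ := by
  let := (MvPolynomial.aeval t : MvPolynomial ι L →ₐ[L] E).toRingHom.toAlgebra
  have : FaithfulSMul (MvPolynomial ι L) E :=
    (faithfulSMul_iff_algebraMap_injective _ E).2 ht.1
  let := FractionRing.liftAlgebra (MvPolynomial ι L) E
  have := ht.finiteDimensional_fractionRing (FractionRing (MvPolynomial ι L)) rfl
  exact _root_.exists_integral_primitive_element (MvPolynomial ι L) (FractionRing (MvPolynomial ι L)) E p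

theorem IsTranscendenceBasis.exists_natDegree_le {L E ι : Type*} [Field L] [Field E]
    [Algebra L E] [Algebra.EssFiniteType L E] {t : ι → E} (ht : IsTranscendenceBasis L t) :
    ∃ n : ℕ, ∀ a : E, ∃ p : (MvPolynomial ι L)[X], p ≠ 0 ∧ p.natDegree ≤ n ∧
      p.eval₂ (MvPolynomial.aeval t : MvPolynomial ι L →ₐ[L] E).toRingHom a = 0 := by
  let := (MvPolynomial.aeval t : MvPolynomial ι L →ₐ[L] E).toRingHom.toAlgebra
  have : FaithfulSMul (MvPolynomial ι L) E :=
    (faithfulSMul_iff_algebraMap_injective _ E).2 ht.1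
  let := FractionRing.liftAlgebra (MvPolynomial ι L) E
  have hfin := ht.finiteDimensional_fractionRing (FractionRing (MvPolynomial ι L)) rfl
  let Q := FractionRing (MvPolynomial ι L)
  refine ⟨Module.finrank Q E, fun a => ?_⟩
  obtain ⟨b, hb0, hb⟩ := IsLocalization.integerNormalization_spec
    (nonZeroDivisors (MvPolynomial ι L)) (minpoly Q a)
  set P := IsLocalization.integerNormalization (nonZeroDivisors (MvPolynomial ι L)) (minpoly Q a)
  have hb1 : algebraMap (MvPolynomial ι L) Q b ≠ 0 := by
    simpa using nonZeroDivisors.ne_zero hb0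
  rw [← algebraMap_smul Q b, smul_eq_C_mul] at hb
  have hP0 : P.map (algebraMap _ Q) ≠ 0 := by
    rw [hb]
    exact mul_ne_zero (C_ne_zero.2 hb1) (minpoly.ne_zero (IsIntegral.of_finite Q a))
  refine ⟨P, fun h => hP0 (by rw [h, Polynomial.map_zero]), ?_, ?_⟩
  · rw [← natDegree_map_eq_of_injective (IsFractionRing.injective (MvPolynomial ι L) Q), hb,
      natDegree_C_mul hb1]
    exact minpoly.natDegree_le a
  · change P.eval₂ (algebraMap (MvPolynomial ι L) E) a = 0
    rw [IsScalarTower.algebraMap_eq (MvPolynomial ι L) Q E, ← eval₂_map, hb, eval₂_mul,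
      ← aeval_def a (minpoly Q a), minpoly.aeval, mul_zero]

theorem IsTranscendenceBasis.exists_natDegree_le_of_tower {k L K σ : Type*} [Field k] [Field L]
    [Field K] [Algebra k L] [Algebra L K] [Algebra k K] [IsScalarTower k L K]
    [Algebra.EssFiniteType k K] {t : σ → L} (ht : IsTranscendenceBasis k t) :
    ∃ n : ℕ, ∀ a : L, ∃ p : (MvPolynomial σ k)[X], p ≠ 0 ∧ p.natDegree ≤ n ∧
      p.eval₂ (MvPolynomial.aeval (R := k) t).toRingHom a = 0 := by
  obtain ⟨ι, u, hu⟩ := exists_isTranscendenceBasis' L K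
  have hsum := ht.sumElim_comp hu
  obtain ⟨n, hn⟩ := hsum.exists_natDegree_le
  refine ⟨n, fun a => ?_⟩
  obtain ⟨P, hP0, hPn, hP⟩ := hn (algebraMap L K a)
  let e := MvPolynomial.sumAlgEquiv k ι σ
  have he : ∀ f : MvPolynomial (ι ⊕ σ) k,
      MvPolynomial.aeval u (MvPolynomial.map (MvPolynomial.aeval (R := k) t).toRingHom (e f)) =
        MvPolynomial.aeval (Sum.elim u (algebraMap L K ∘ t)) f := by
    intro f
    induction f using MvPolynomial.induction_on with
    | C c => simp [e, MvPolynomial.sumAlgEquiv_C_inl, ← IsScalarTower.algebraMap_apply]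
    | add p q hp hq => simp only [map_add, hp, hq]
    | mul_X p i hp =>
      rw [map_mul, map_mul, map_mul, hp, map_mul]
      rcases i with i | i <;>
        simp [e, MvPolynomial.sumAlgEquiv_X_inl, MvPolynomial.sumAlgEquiv_X_inr]
  obtain ⟨j, hj⟩ : ∃ j, P.coeff j ≠ 0 := by
    by_contra! h
    exact hP0 (ext h)
  obtain ⟨m, hm⟩ := MvPolynomial.exists_coeff_ne_zero ((map_ne_zero_iff e e.injective).2 hj)
  have hjn : j ≤ n := (le_natDegree_of_ne_zero hj).trans hPn
  have hcoeff : ∀ i ≤ n, (∑ i ∈ Finset.range (n + 1),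
      monomial i (MvPolynomial.coeff m (e (P.coeff i)))).coeff i =
        MvPolynomial.coeff m (e (P.coeff i)) := by
    intro i hi
    simp [coeff_monomial]
    omega
  refine ⟨∑ i ∈ Finset.range (n + 1), monomial i (MvPolynomial.coeff m (e (P.coeff i))),
    fun h => hm ?_, ?_, ?_⟩
  · rw [← hcoeff j hjn, h, coeff_zero]
  · exact natDegree_sum_le_of_forall_le _ _ fun i hi =>
      (natDegree_monomial_le _).trans (Nat.lt_succ_iff.1 (Finset.mem_range.1 hi))
  · have hH : ∑ i ∈ Finset.range (n + 1), MvPolynomial.C (a ^ i) *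
        MvPolynomial.map (MvPolynomial.aeval (R := k) t).toRingHom (e (P.coeff i)) = 0 := by
      apply hu.1
      rw [map_sum, map_zero, ← hP, eval₂_eq_sum_range' _ (Nat.lt_succ_iff.2 hPn)]
      refine Finset.sum_congr rfl fun i _ => ?_
      rw [map_mul, he, ← MvPolynomial.algebraMap_eq, AlgHom.commutes, map_pow, mul_comm]
      rfl
    have := congrArg (MvPolynomial.coeff m) hH
    rw [MvPolynomial.coeff_sum, MvPolynomial.coeff_zero] at this
    rw [eval₂_finsetSum, ← this]
    refine Finset.sum_congr rfl fun i _ => ?_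
    rw [eval₂_monomial, MvPolynomial.coeff_C_mul, MvPolynomial.coeff_map, mul_comm]

end

section

open Polynomial

/-- If `z` is not the product of an element of `L` and an `ℓ`-th power, then adjoining an
`ℓ`-th root of `z` to `K` does not enlarge the algebraic closure of `L`. -/
theorem exists_kummer_extension_isIntegrallyClosedIn {L : Type v} {K : Type u} [Field L] [Field K]
    [Algebra L K] (hL : ∀ x : K, IsAlgebraic L x → x ∈ (algebraMap L K).range) {ℓ : ℕ}
    (hℓ : ℓ.Prime) (ξ : L) (hξ : IsPrimitiveRoot ξ ℓ) (z : K) (hz0 : z ≠ 0)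
    (hz : ∀ (c : L) (b : K), z ≠ algebraMap L K c * b ^ ℓ) :
    ∃ (E : Type u) (_ : Field E) (_ : Algebra K E) (_ : Algebra L E) (_ : IsScalarTower L K E)
      (_ : FiniteDimensional K E) (w : E) (σ : E →ₐ[K] E), w ^ ℓ = algebraMap K E z ∧
      σ w = algebraMap L E ξ * w ∧ ∀ x : E, IsAlgebraic L x → x ∈ (algebraMap L E).range := by
  have hirr : Irreducible (X ^ ℓ - C z : K[X]) :=
    X_pow_sub_C_irreducible_of_prime hℓ fun b hb => hz 1 b (by rw [map_one, one_mul, hb])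
  have : Fact (Irreducible (X ^ ℓ - C z : K[X])) := ⟨hirr⟩
  have hm : (X ^ ℓ - C z : K[X]).Monic := monic_X_pow_sub_C z hℓ.ne_zero
  let E := AdjoinRoot (X ^ ℓ - C z : K[X])
  have hfin : FiniteDimensional K E := hm.finite_adjoinRoot
  let w : E := AdjoinRoot.root _
  have hw : w ^ ℓ = algebraMap K E z := by
    have := AdjoinRoot.eval₂_root (X ^ ℓ - C z : K[X])
    rw [eval₂_sub, eval₂_pow, eval₂_X, eval₂_C] at this
    exact sub_eq_zero.1 this
  have hw0 : w ≠ 0 := by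
    intro h
    rw [h, zero_pow hℓ.ne_zero] at hw
    exact hz0 ((algebraMap K E).injective (by rw [← hw, map_zero]))
  let ξE : E := algebraMap L E ξ
  have hξE : IsPrimitiveRoot ξE ℓ := hξ.map_of_injective (algebraMap L E).injective
  let σ : E →ₐ[K] E := AdjoinRoot.liftAlgHom _ (Algebra.ofId K E) (ξE * w) (by
    rw [eval₂_sub, eval₂_pow, eval₂_X, eval₂_C, mul_pow, hξE.pow_eq_one, one_mul, hw]
    exact sub_self _)
  have hσw : σ w = ξE * w := AdjoinRoot.liftAlgHom_root _ _ _ _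
  refine ⟨E, inferInstance, inferInstance, inferInstance, inferInstance, hfin, w, σ, hw, hσw, ?_⟩
  have hσξ : σ ξE = ξE := by
    change σ (algebraMap L E ξ) = algebraMap L E ξ
    rw [IsScalarTower.algebraMap_apply L K E, σ.commutes]
  have hσi : ∀ (i j : ℕ) (a : K), (σ ^ i) (algebraMap K E a * w ^ j) =
      (ξE ^ j) ^ i * (algebraMap K E a * w ^ j) := by
    intro i j a
    induction i with
    | zero => simp
    | succ i ih =>
      rw [pow_succ', AlgHom.mul_apply, ih]
      simp only [map_mul, map_pow, hσξ, hσw, AlgHom.commutes]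
      ring
  have hℓE : (ℓ : E) ≠ 0 := by
    have : NeZero ℓ := ⟨hℓ.ne_zero⟩
    have : NeZero (ℓ : E) := hξE.neZero'
    exact this.out
  intro α hα
  obtain ⟨a, ha⟩ : ∃ a : ℕ → K, α = ∑ j ∈ Finset.range ℓ, algebraMap K E (a j) * w ^ j := by
    obtain ⟨p, rfl⟩ := AdjoinRoot.mk_surjective α
    refine ⟨fun j => (p %ₘ (X ^ ℓ - C z)).coeff j, ?_⟩
    have h1 : (AdjoinRoot.mk (X ^ ℓ - C z) p : E) = aeval w (p %ₘ (X ^ ℓ - C z)) := by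
      rw [AdjoinRoot.aeval_eq, AdjoinRoot.mk_eq_mk]
      exact ⟨p /ₘ (X ^ ℓ - C z), sub_eq_iff_eq_add.2 (by
        rw [add_comm, modByMonic_add_div])⟩
    rw [h1]
    have h2 : (p %ₘ (X ^ ℓ - C z)).natDegree < ℓ := by
      have := natDegree_modByMonic_lt p hm (by
        intro h
        have := congrArg natDegree h
        rw [natDegree_X_pow_sub_C, natDegree_one] at this
        exact hℓ.ne_zero this)
      rwa [natDegree_X_pow_sub_C] at this
    exact aeval_eq_sum_range' h2 w |>.trans (Finset.sum_congr rfl fun j _ => Algebra.smul_def _ _)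
  have hres : ∀ j < ℓ, IsAlgebraic L (algebraMap K E (a j) * w ^ j) := by
    intro j hj
    have h1 : ∑ i ∈ Finset.range ℓ, ((ξE ^ j)⁻¹) ^ i * (σ ^ i) α =
        ℓ * (algebraMap K E (a j) * w ^ j) := by
      have h2 : ∀ i, ((ξE ^ j)⁻¹) ^ i * (σ ^ i) α = ∑ m ∈ Finset.range ℓ,
          (ξE ^ m * (ξE ^ j)⁻¹) ^ i * (algebraMap K E (a m) * w ^ m) := by
        intro i
        rw [ha, map_sum, Finset.mul_sum]
        refine Finset.sum_congr rfl fun m _ => ?_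
        rw [hσi, mul_pow]
        ring
      rw [Finset.sum_congr rfl fun i _ => h2 i, Finset.sum_comm]
      rw [Finset.sum_eq_single_of_mem j (Finset.mem_range.2 hj)]
      · have : ξE ^ j ≠ 0 := pow_ne_zero _ (hξE.ne_zero hℓ.ne_zero)
        simp [this]
      · intro m hm hmj
        rw [← Finset.sum_mul]
        have hne : ξE ^ m * (ξE ^ j)⁻¹ ≠ 1 := by
          intro h
          rw [mul_inv_eq_one₀ (pow_ne_zero _ (hξE.ne_zero hℓ.ne_zero))] at h
          exact hmj (hξE.pow_inj (Finset.mem_range.1 hm) hj h)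
        rw [geom_sum_eq hne, mul_pow, inv_pow, ← pow_mul, ← pow_mul, mul_comm m, mul_comm j, pow_mul,
          pow_mul, hξE.pow_eq_one]
        simp
    have h2 : IsAlgebraic L (∑ i ∈ Finset.range ℓ, ((ξE ^ j)⁻¹) ^ i * (σ ^ i) α) := by
      refine (Subalgebra.algebraicClosure L E).sum_mem fun i _ => ?_
      rw [Subalgebra.mem_algebraicClosure]
      refine IsAlgebraic.mul ?_ ?_
      · exact (((isAlgebraic_algebraMap ξ).pow _).inv).pow _
      · exact hα.algHom ((σ ^ i).restrictScalars L)
    rw [h1] at h2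
    have h3 := (isAlgebraic_algebraMap (R := L) (A := E) ((ℓ : L)⁻¹)).mul h2
    rwa [map_inv₀, map_natCast, inv_mul_cancel_left₀ hℓE] at h3
  have hzero : ∀ j < ℓ, j ≠ 0 → a j = 0 := by
    intro j hj hj0
    by_contra haj
    have h1 := (hres j hj).pow ℓ
    have h2 : (algebraMap K E (a j) * w ^ j) ^ ℓ = algebraMap K E (a j ^ ℓ * z ^ j) := by
      rw [mul_pow, ← pow_mul, mul_comm j, pow_mul, hw, map_mul, map_pow, map_pow]
    rw [h2, isAlgebraic_algebraMap_iff (algebraMap K E).injective] at h1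
    obtain ⟨c, hc⟩ := hL _ h1
    have hcop : j.Coprime ℓ := (Nat.coprime_of_lt_prime hj0 hj hℓ).symm
    obtain ⟨s, -, hs⟩ := Nat.exists_mul_mod_eq_one_of_coprime hcop hℓ.one_lt
    have hs2 := Nat.div_add_mod (j * s) ℓ
    rw [hs] at hs2
    obtain ⟨t, ht⟩ : ∃ t, j * s = ℓ * t + 1 := ⟨_, hs2.symm⟩
    apply hz (c ^ s) ((a j ^ s)⁻¹ * (z ^ t)⁻¹)
    have h4 : (a j ^ ℓ * z ^ j) ^ s = (a j ^ s * z ^ t) ^ ℓ * z := by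
      rw [mul_pow, ← pow_mul z, ht]
      ring
    rw [map_pow, hc, h4, ← mul_inv, inv_pow, mul_right_comm, mul_inv_cancel₀, one_mul]
    exact pow_ne_zero _ (mul_ne_zero (pow_ne_zero _ haj) (pow_ne_zero _ hz0))
  have hα0 : α = algebraMap K E (a 0) := by
    rw [ha, Finset.sum_eq_single_of_mem 0 (Finset.mem_range.2 hℓ.pos)]
    · simp
    · intro j hj hj0
      rw [hzero j (Finset.mem_range.1 hj) hj0]; simp
  rw [hα0, isAlgebraic_algebraMap_iff (algebraMap K E).injective] at hα
  obtain ⟨c, hc⟩ := hL _ hα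
  exact ⟨c, by rw [hα0, ← hc, ← IsScalarTower.algebraMap_apply]⟩

end

theorem ringChar_ne_expChar {k : Type*} [Field k] {ℓ : ℕ} (hℓ : ℓ.Prime) (h : ringChar k ≠ ℓ)
    (p : ℕ) [hp : ExpChar k p] : p ≠ ℓ := by
  rintro rfl
  rcases hp with _ | hp
  · exact hℓ.ne_one rfl
  · exact h (ringChar.eq k _)

theorem statement_3 (ℓ : ℕ) (hℓ : ℓ.Prime) (k K : Type*) [Field k] [Field K] [Algebra k K]
    [IsAlgClosed k] (hchar : ringChar k ≠ ℓ) (hK : IsFunctionField k K)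
    (d : ℕ) (hd : HasTrdeg k K d)
    (L : IntermediateField k K) (hL : RelAlgClosed L)
    (r : ℕ) (hr : HasTrdeg k L r) (hrd : r < d)
    (z : Kˣ) (hz : K1proj ℓ K z ∉ Omega ℓ L) :
    ∃ x : Fin r → Kˣ, (∀ i, (x i : K) ∈ L) ∧ milnorSymbol ℓ (Fin.snoc x z) ≠ 0 := by
  have : Fact ℓ.Prime := ⟨hℓ⟩
  have : Algebra.EssFiniteType k K := IntermediateField.fg_top_iff.1 hK
  have : Algebra.EssFiniteType L K := Algebra.EssFiniteType.of_comp k L K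
  have hL' : ∀ x : K, IsAlgebraic L x → x ∈ (algebraMap L K).range := fun x hx =>
    ⟨⟨x, hL x hx⟩, rfl⟩
  have hz' : ∀ (c : L) (b : K), (z : K) ≠ algebraMap L K c * b ^ ℓ := by
    intro c b h
    have hc : algebraMap L K c ≠ 0 := fun h0 => z.ne_zero (by rw [h, h0, zero_mul])
    have hb : b ≠ 0 := fun h0 => z.ne_zero (by rw [h, h0, zero_pow hℓ.ne_zero, mul_zero])
    refine hz ⟨Units.mk0 _ hc, c.2, ?_⟩
    refine (QuotientGroup.eq (s := (powMonoidHom ℓ : Kˣ →* Kˣ).range)).2 ⟨Units.mk0 b hb, ?_⟩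
    rw [eq_inv_mul_iff_mul_eq]
    ext
    simpa using h.symm
  have hℓk : NeZero (ℓ : k) := ⟨fun h => hchar
    ((hℓ.eq_one_or_self_of_dvd _ (ringChar.dvd h)).resolve_left (CharP.ringChar_ne_one))⟩
  obtain ⟨ζ, hζ⟩ := HasEnoughRootsOfUnity.exists_primitiveRoot k ℓ
  let ξ : L := algebraMap k L ζ
  have hξ : IsPrimitiveRoot ξ ℓ := hζ.map_of_injective (algebraMap k L).injective
  obtain ⟨E, _, _, _, _, _, w, σ, hw, hσw, hLE⟩ :=
    exists_kummer_extension_isIntegrallyClosedIn hL' hℓ ξ hξ z z.ne_zero hz'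
  have : Algebra.EssFiniteType L E := Algebra.EssFiniteType.comp L K E
  obtain ⟨ι, t, ht⟩ := exists_isTranscendenceBasis' L K
  have : Finite ι := finite_of_isTranscendenceBasis ht
  have htE : IsTranscendenceBasis L (algebraMap K E ∘ t) := ht.algebraMap_comp
  obtain ⟨p, hp⟩ := ExpChar.exists E
  have hpk : ExpChar k p := ((algebraMap K E).comp (algebraMap k K)).expChar
    ((algebraMap K E).comp (algebraMap k K)).injective p
  obtain ⟨θ, P, a, b, c, n, hP, hP0, hker, hc, hab, hq⟩ := htE.exists_integral_primitive_element p
  let ε : MvPolynomial ι L →ₐ[L] E := MvPolynomial.aeval (algebraMap K E ∘ t)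
  obtain ⟨S, hS⟩ := ValuationSubring.exists_finset_forall_exists_extension ε.toRingHom
    htE.1 θ P hP hP0 hker
    (fun D _ _ _ => Polynomial.irreducible_map_mvPolynomial_of_finite hLE ε θ P hP hP0 hker a b c
      hc hab) (p ^ n) (pow_ne_zero _ (expChar_ne_zero E p)) hq
  obtain ⟨s, hs⟩ := hr
  obtain ⟨m, hm⟩ := hs.exists_natDegree_le_of_tower (K := K)
  have : Infinite k := IsAlgClosed.instInfinite
  obtain ⟨O, hOk, hOS, x, hx⟩ := exists_valuationSubring_of_degree_bound hs.1 m hm S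
  obtain ⟨W, hA, hB, hC⟩ := hS O hOS
  have hεC : ∀ y : L, ε.toRingHom (MvPolynomial.C y) = algebraMap K E (algebraMap L K y) := by
    intro y
    rw [← IsScalarTower.algebraMap_apply]
    exact ε.commutes y
  refine ⟨fun i => Units.map (algebraMap L K : L →* K) (x i), fun i => (x i : L).2, ?_⟩
  refine milnorSymbol_snoc_ne_zero_of_extension (algebraMap L K) (algebraMap K E) O W ξ hξ ?_ ?_
    (fun y => by rw [← hA y, hεC]; rfl) (p ^ n) ?_
    (fun y hy => by
      obtain ⟨c, hc, h⟩ := hB y hy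
      exact ⟨c, hc, by rw [h, hεC]⟩) σ.toRingHom σ.commutes
    (hC σ.toRingHom fun f => ?_) z w hw (by rw [← IsScalarTower.algebraMap_apply]; exact hσw) x
    (hx ℓ)
  · have : ξ - 1 = algebraMap k L (ζ - 1) := by rw [map_sub, map_one]
    rw [this]
    exact hOk _ (sub_ne_zero.2 (hζ.ne_one hℓ.one_lt))
  · obtain ⟨y, hy⟩ := IsAlgClosed.exists_pow_nat_eq (-1 : k) hℓ.pos
    have hy0 : y ≠ 0 := by
      rintro rfl
      rw [zero_pow hℓ.ne_zero] at hy
      exact neg_ne_zero.2 one_ne_zero hy.symm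
    refine ⟨Units.map (algebraMap k K : k →* K) (Units.mk0 y hy0), ?_⟩
    ext
    simp [← map_pow, hy]
  · refine Nat.Coprime.pow_right _ ?_
    rcases hp with _ | hpp
    · exact Nat.coprime_one_right _
    · exact (Nat.coprime_primes hℓ hpp).2 (ringChar_ne_expChar hℓ hchar p).symm
  · have : (σ.restrictScalars L).comp ε = ε := by
      ext i
      simp [ε]
    exact DFunLike.congr_fun this f
end
end
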